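/- arXiv:0908.4457 — 4 statements merged into one kernel-verified Lean document; each statement's English description precedes it below -/
import Mathlib

section
/- For any natural numbers a, b and any finite sequence c, the prefix-free Kolmogorov complexity satisfies K(a,b|c) = K(a,b, K(b | a*[c], c) | c) up to an additive constant, where a*[c] denotes the shortest program computing a given c. -/
open Encodable

/-- An optimal universal prefix-free interpreter: programs are binary strings,
conditions and outputs are natural numbers (under fixed computable encodings). -/
structure OptimalInterpreter where
  Φ : List Bool → ℕ → Part ℕ
  partrec : Partrec₂ Φ
  prefixFree : ∀ (y : ℕ) (p q : List Bool), p <+: q → (Φ p y).Dom → (Φ q y).Dom → p = q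
  onto : ∀ x y : ℕ, ∃ p : List Bool, x ∈ Φ p y
  optimal : ∀ ψ : List Bool → ℕ → Part ℕ, Partrec₂ ψ →
      (∀ (y : ℕ) (p q : List Bool), p <+: q → (ψ p y).Dom → (ψ q y).Dom → p = q) →
      ∃ c : ℕ, ∀ (x y : ℕ) (p : List Bool), x ∈ ψ p y →
        ∃ q : List Bool, x ∈ Φ q y ∧ q.length ≤ p.length + c

namespace OptimalInterpreter

variable (U : OptimalInterpreter)

/-- Conditional prefix-free Kolmogorov complexity `K(x|y)`. -/
noncomputable def K (x y : ℕ) : ℕ :=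
  sInf {n | ∃ p : List Bool, p.length = n ∧ x ∈ U.Φ p y}

/-- Plain (unconditional) prefix-free complexity `K(x)` (condition `0` encodes ε). -/
noncomputable def Kp (x : ℕ) : ℕ := U.K x 0

/-- `star x y` = the lexicographically (by code) first shortest program `p`
with `Φ(p|y) = x`, i.e. the witness `x*[y]`. -/
noncomputable def star (x y : ℕ) : List Bool :=
  ((Encodable.decode (α := List Bool)
      (sInf {n | ∃ p : List Bool, Encodable.encode p = n ∧
        p.length = U.K x y ∧ x ∈ U.Φ p y})).getD [])

end OptimalInterpreter


namespace KCaux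

/-- weight of a request -/
noncomputable def w : Option (ℕ × ℕ) → ℝ
  | none => 0
  | some r => (1 / 2 : ℝ) ^ r.2

lemma w_nonneg (o : Option (ℕ × ℕ)) : 0 ≤ w o := by
  cases o <;> simp [w]

/-- running weight -/
noncomputable def W (f : ℕ → Option (ℕ × ℕ)) (n : ℕ) : ℝ := ∑ i ∈ Finset.range n, w (f i)

lemma W_nonneg (f n) : 0 ≤ W f n := Finset.sum_nonneg fun _ _ => w_nonneg _

lemma W_mono (f) : Monotone (W f) := by
  apply monotone_nat_of_le_succ
  intro n
  simp only [W, Finset.sum_range_succ]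
  linarith [w_nonneg (f n)]

lemma W_succ (f n) : W f (n + 1) = W f n + w (f n) := by
  simp only [W, Finset.sum_range_succ]

/-- dyadic numerator/exponent of the running weight -/
def dyStep (o : Option (ℕ × ℕ)) (s : ℕ × ℕ) : ℕ × ℕ :=
  Option.casesOn o s (fun r => (s.1 * 2 ^ r.2 + 2 ^ s.2, s.2 + r.2))

def dy (f : ℕ → Option (ℕ × ℕ)) (n : ℕ) : ℕ × ℕ :=
  Nat.rec (motive := fun _ => ℕ × ℕ) (0, 0) (fun m s => dyStep (f m) s) n

lemma dy_eq (f n) : ((dy f n).1 : ℝ) = W f n * 2 ^ (dy f n).2 := by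
  induction n with
  | zero => simp [dy, W]
  | succ n ih =>
    have h : dy f (n + 1) = dyStep (f n) (dy f n) := rfl
    rw [W_succ, h]
    cases hf : f n with
    | none => simp [dyStep, w, ih]
    | some r =>
      simp only [dyStep, w]
      push_cast
      rw [ih, pow_add, one_div, inv_pow]
      field_simp

lemma prim_pow : Primrec₂ (fun a b : ℕ => a ^ b) :=
  (Primrec₂.unpaired'.1 Nat.Primrec.pow)

lemma prim_two_pow : Primrec (fun b : ℕ => 2 ^ b) :=
  prim_pow.comp (Primrec.const 2) Primrec.id

lemma prim_dyStep : Primrec₂ dyStep := by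
  unfold dyStep
  apply Primrec.option_casesOn Primrec.fst Primrec.snd
  have h1 : Primrec (fun x : (Option (ℕ × ℕ) × (ℕ × ℕ)) × (ℕ × ℕ) => x.1.2.1) :=
    Primrec.fst.comp (Primrec.snd.comp Primrec.fst)
  have h2 : Primrec (fun x : (Option (ℕ × ℕ) × (ℕ × ℕ)) × (ℕ × ℕ) => x.1.2.2) :=
    Primrec.snd.comp (Primrec.snd.comp Primrec.fst)
  have h3 : Primrec (fun x : (Option (ℕ × ℕ) × (ℕ × ℕ)) × (ℕ × ℕ) => x.2.2) :=
    Primrec.snd.comp Primrec.snd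
  exact Primrec.pair
    (Primrec.nat_add.comp (Primrec.nat_mul.comp h1 (prim_two_pow.comp h3)) (prim_two_pow.comp h2))
    (Primrec.nat_add.comp h2 h3)

lemma comp_dy {α : Type} [Primcodable α] {f : α → ℕ → Option (ℕ × ℕ)} (hf : Computable₂ f) :
    Computable₂ (fun a n => dy (f a) n) := by
  unfold dy
  refine Computable.nat_rec (f := fun x : α × ℕ => x.2) (g := fun _ => ((0, 0) : ℕ × ℕ))
    (h := fun x s => dyStep (f x.1 s.1) s.2) Computable.snd (Computable.const _) ?_
  exact prim_dyStep.to_comp.comp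
    (hf.comp (Computable.fst.comp Computable.fst) (Computable.fst.comp Computable.snd))
    (Computable.snd.comp Computable.snd)

/-- value of a bit string -/
def val (p : List Bool) : ℕ := p.foldl (fun acc b => 2 * acc + cond b 1 0) 0

lemma foldl_val (p : List Bool) (i : ℕ) :
    p.foldl (fun acc b => 2 * acc + cond b 1 0) i = i * 2 ^ p.length + val p := by
  unfold val
  induction p generalizing i with
  | nil => simp
  | cons b p ih =>
    simp only [List.foldl_cons, List.length_cons]
    rw [ih, ih (2 * 0 + cond b 1 0)]
    ring

lemma val_append (p q : List Bool) : val (p ++ q) = val p * 2 ^ q.length + val q := by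
  conv_lhs => unfold val
  rw [List.foldl_append, foldl_val]; rfl

lemma val_concat (p : List Bool) (b : Bool) : val (p ++ [b]) = 2 * val p + cond b 1 0 := by
  rw [val_append]; simp [val]; ring

lemma val_lt (p : List Bool) : val p < 2 ^ p.length := by
  induction p using List.reverseRecOn with
  | nil => simp [val]
  | append_singleton p b ih =>
    rw [val_concat, List.length_append, pow_add]
    cases b <;> simp <;> omega

lemma exists_val (l v : ℕ) (h : v < 2 ^ l) : ∃ p : List Bool, p.length = l ∧ val p = v := by
  induction l generalizing v with
  | zero => exact ⟨[], rfl, by simp at h; simp [val, h]⟩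
  | succ l ih =>
    obtain ⟨p, hp, hv⟩ := ih (v / 2) (by rw [pow_succ] at h; omega)
    refine ⟨p ++ [decide (v % 2 = 1)], by simp [hp], ?_⟩
    rw [val_concat, hv]
    by_cases hh : v % 2 = 1 <;> simp [hh] <;> omega

lemma val_inj (p q : List Bool) (h : p.length = q.length) (hv : val p = val q) : p = q := by
  induction p using List.reverseRecOn generalizing q with
  | nil => simp at h; exact (List.length_eq_zero_iff.1 h.symm).symm
  | append_singleton p b ih =>
    induction q using List.reverseRecOn with
    | nil => simp at h
    | append_singleton q c _ =>
      rw [val_concat, val_concat] at hv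
      simp at h
      have : val p = val q ∧ b = c := by
        cases b <;> cases c <;> simp at hv ⊢ <;> omega
      rw [ih q h this.1, this.2]

lemma prim_val : Primrec val := by
  unfold val
  refine Primrec.list_foldl (f := fun p : List Bool => p) (g := fun _ => 0)
    (h := fun _ s => 2 * s.1 + cond s.2 1 0) Primrec.id (Primrec.const 0) ?_
  exact Primrec.nat_add.comp
    (Primrec.nat_mul.comp (Primrec.const 2) (Primrec.fst.comp Primrec.snd))
    (Primrec.cond (Primrec.snd.comp Primrec.snd) (Primrec.const 1) (Primrec.const 0))

/-- the Boolean test: is `p` a code for a request `r` at state `s` -/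
def okTest (p : List Bool) (r s : ℕ × ℕ) : Bool :=
  decide (p.length = r.2 + 1) && (decide (s.1 * 2 ^ (r.2 + 1) ≤ val p * 2 ^ s.2) &&
    decide (val p * 2 ^ s.2 ≤ s.1 * 2 ^ (r.2 + 1) + 2 ^ s.2))

lemma prim_okTest : Primrec (fun x : List Bool × (ℕ × ℕ) × (ℕ × ℕ) => okTest x.1 x.2.1 x.2.2) := by
  unfold okTest
  have hl : Primrec (fun x : List Bool × (ℕ × ℕ) × (ℕ × ℕ) => x.1.length) :=
    Primrec.list_length.comp Primrec.fst
  have hr : Primrec (fun x : List Bool × (ℕ × ℕ) × (ℕ × ℕ) => x.2.1.2 + 1) :=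
    Primrec.succ.comp (Primrec.snd.comp (Primrec.fst.comp Primrec.snd))
  have hs : Primrec (fun x : List Bool × (ℕ × ℕ) × (ℕ × ℕ) => x.2.2.1 * 2 ^ (x.2.1.2 + 1)) :=
    Primrec.nat_mul.comp (Primrec.fst.comp (Primrec.snd.comp Primrec.snd)) (prim_two_pow.comp hr)
  have he : Primrec (fun x : List Bool × (ℕ × ℕ) × (ℕ × ℕ) => 2 ^ x.2.2.2) :=
    prim_two_pow.comp (Primrec.snd.comp (Primrec.snd.comp Primrec.snd))
  have hv : Primrec (fun x : List Bool × (ℕ × ℕ) × (ℕ × ℕ) => val x.1 * 2 ^ x.2.2.2) :=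
    Primrec.nat_mul.comp (prim_val.comp Primrec.fst) he
  refine Primrec.and.comp (PrimrecRel.decide Primrec.eq |>.comp hl hr) (Primrec.and.comp ?_ ?_)
  · exact PrimrecRel.decide Primrec.nat_le |>.comp hs hv
  · exact PrimrecRel.decide Primrec.nat_le |>.comp hv (Primrec.nat_add.comp hs he)

/-- uncurried version -/
def okT (x : List Bool × (ℕ × ℕ) × (ℕ × ℕ)) : Bool := okTest x.1 x.2.1 x.2.2

lemma comp_okT : Computable okT := prim_okTest.to_comp

lemma okTest_iff (p : List Bool) (r : ℕ × ℕ) (f n) : okTest p r (dy f n) = true ↔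
    p.length = r.2 + 1 ∧ W f n * 2 ^ (r.2 + 1) ≤ val p ∧
      (val p : ℝ) ≤ W f n * 2 ^ (r.2 + 1) + 1 := by
  have hpos : (0 : ℝ) < 2 ^ (dy f n).2 := by positivity
  simp only [okTest, Bool.and_eq_true, decide_eq_true_eq]
  refine and_congr_right fun _ => and_congr ?_ ?_
  · rw [← Nat.cast_le (α := ℝ)]
    push_cast
    rw [dy_eq, mul_right_comm, mul_le_mul_iff_left₀ hpos]
  · rw [← Nat.cast_le (α := ℝ)]
    push_cast
    rw [dy_eq, mul_right_comm, ← add_one_mul, mul_le_mul_iff_left₀ hpos]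

end KCaux

namespace KCaux

lemma okTest_interval {p : List Bool} {f : ℕ → Option (ℕ × ℕ)} {n r} (hr : f n = some r)
    (h : okTest p r (dy f n) = true) :
    W f n ≤ val p / 2 ^ p.length ∧ (val p + 1 : ℝ) / 2 ^ p.length ≤ W f (n + 1) := by
  rw [okTest_iff] at h
  obtain ⟨h0, h1, h2⟩ := h
  rw [W_succ, hr, h0, le_div_iff₀ (by positivity), div_le_iff₀ (by positivity)]
  refine ⟨h1, ?_⟩
  simp only [w]
  have : (1 / 2 : ℝ) ^ r.2 * 2 ^ (r.2 + 1) = 2 := by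
    rw [pow_succ, ← mul_assoc, ← mul_pow]; norm_num
  rw [add_mul, this]
  linarith

lemma okTest_unique {p q : List Bool} {f : ℕ → Option (ℕ × ℕ)} {n r m r'} (hr : f n = some r)
    (hr' : f m = some r') (h : okTest p r (dy f n) = true) (h' : okTest q r' (dy f m) = true)
    (hpq : p <+: q) : n = m := by
  obtain ⟨a1, a2⟩ := okTest_interval hr h
  obtain ⟨b1, b2⟩ := okTest_interval hr' h'
  obtain ⟨t, rfl⟩ := hpq
  have ht : (val t : ℝ) + 1 ≤ 2 ^ t.length := by exact_mod_cast val_lt t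
  have hp : (0 : ℝ) < 2 ^ p.length := by positivity
  have htp : (0 : ℝ) < 2 ^ t.length := by positivity
  have c1 : (val p : ℝ) / 2 ^ p.length ≤ val (p ++ t) / 2 ^ (p ++ t).length := by
    rw [val_append, List.length_append, pow_add, div_le_div_iff₀ hp (by positivity)]
    push_cast
    have : (0 : ℝ) ≤ val t * 2 ^ p.length := by positivity
    nlinarith
  have c2 : ((val (p ++ t) : ℝ) + 1) / 2 ^ (p ++ t).length ≤ (val p + 1) / 2 ^ p.length := by
    rw [val_append, List.length_append, pow_add, div_le_div_iff₀ (by positivity) hp]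
    push_cast
    nlinarith
  have c3 : (val (p ++ t) : ℝ) / 2 ^ (p ++ t).length
      < ((val (p ++ t) : ℝ) + 1) / 2 ^ (p ++ t).length := by
    apply div_lt_div_of_pos_right _ (by positivity); linarith
  rcases lt_trichotomy n m with hnm | hnm | hnm
  · have := W_mono f (show n + 1 ≤ m from hnm)
    linarith
  · exact hnm
  · have := W_mono f (show m + 1 ≤ n from hnm)
    linarith

def tst (f : ℕ → ℕ → Option (ℕ × ℕ)) (a : List Bool × ℕ) (n : ℕ) : Option ℕ :=
  (f a.2 n).bind fun r => cond (okT (a.1, r, dy (f a.2) n)) (some r.1) none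

lemma comp_tst {f : ℕ → ℕ → Option (ℕ × ℕ)} (hf : Computable₂ f) : Computable₂ (tst f) := by
  have hy : Computable (fun x : (List Bool × ℕ) × ℕ => x.1.2) :=
    Computable.snd.comp Computable.fst
  have h1 : Computable (fun x : (List Bool × ℕ) × ℕ => f x.1.2 x.2) := hf.comp hy Computable.snd
  have hd : Computable (fun x : ((List Bool × ℕ) × ℕ) × (ℕ × ℕ) => dy (f x.1.1.2) x.1.2) :=
    (comp_dy hf).comp (hy.comp Computable.fst) (Computable.snd.comp Computable.fst)
  have hp : Computable (fun x : ((List Bool × ℕ) × ℕ) × (ℕ × ℕ) =>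
      (x.1.1.1, x.2, dy (f x.1.1.2) x.1.2)) :=
    Computable.pair
      (Computable.fst.comp (Computable.fst.comp Computable.fst)) (Computable.pair Computable.snd hd)
  have ho : Computable (fun x : ((List Bool × ℕ) × ℕ) × (ℕ × ℕ) =>
      okT (x.1.1.1, x.2, dy (f x.1.1.2) x.1.2)) := comp_okT.comp hp
  have hs : Computable (fun x : ((List Bool × ℕ) × ℕ) × (ℕ × ℕ) => some x.2.1) :=
    Computable.option_some.comp (Computable.fst.comp Computable.snd)
  have hc : Computable₂ (fun (x : (List Bool × ℕ) × ℕ) (r : ℕ × ℕ) =>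
      cond (okT (x.1.1, r, dy (f x.1.2) x.2)) (some r.1) none) :=
    Computable.cond ho hs (Computable.const none)
  exact Computable.option_bind h1 hc

lemma tst_mem {f : ℕ → ℕ → Option (ℕ × ℕ)} {p y n x} : x ∈ tst f (p, y) n ↔
    ∃ r, f y n = some r ∧ okTest p r (dy (f y) n) = true ∧ r.1 = x := by
  simp only [tst, Option.mem_def, Option.bind_eq_some_iff]
  refine exists_congr fun r => and_congr_right fun _ => ?_
  rw [okT]
  cases okTest p r (dy (f y) n) <;> simp

lemma K_le {U : OptimalInterpreter} {x y : ℕ} {p : List Bool} (h : x ∈ U.Φ p y) :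
    U.K x y ≤ p.length := Nat.sInf_le ⟨p, rfl, h⟩

lemma K_spec (U : OptimalInterpreter) (x y : ℕ) :
    ∃ p : List Bool, p.length = U.K x y ∧ x ∈ U.Φ p y := by
  have : {n | ∃ p : List Bool, p.length = n ∧ x ∈ U.Φ p y}.Nonempty := by
    obtain ⟨p, hp⟩ := U.onto x y
    exact ⟨_, p, rfl, hp⟩
  exact Nat.sInf_mem this

lemma star_spec (U : OptimalInterpreter) (x y : ℕ) :
    (U.star x y).length = U.K x y ∧ x ∈ U.Φ (U.star x y) y := by
  have : {n | ∃ p : List Bool, Encodable.encode p = n ∧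
        p.length = U.K x y ∧ x ∈ U.Φ p y}.Nonempty := by
    obtain ⟨p, hp⟩ := K_spec U x y
    exact ⟨_, p, rfl, hp⟩
  obtain ⟨p, hp, h⟩ := Nat.sInf_mem this
  have : U.star x y = p := by
    unfold OptimalInterpreter.star
    rw [← hp]; simp
  rwa [this]

lemma KC (U : OptimalInterpreter) {f : ℕ → ℕ → Option (ℕ × ℕ)} (hf : Computable₂ f) :
    ∃ C : ℕ, ∀ y, (∀ N, W (f y) N ≤ 1) → ∀ n x l, f y n = some (x, l) → U.K x y ≤ l + C := by
  obtain ⟨C, hC⟩ := U.optimal (fun p y => Nat.rfindOpt (tst f (p, y)))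
    (Partrec.rfindOpt (comp_tst hf)) (by
      intro y p q hpq h1 h2
      obtain ⟨n, x, h1⟩ := Nat.rfindOpt_dom.1 h1
      obtain ⟨m, x', h2⟩ := Nat.rfindOpt_dom.1 h2
      obtain ⟨r, hr, ho, -⟩ := tst_mem.1 h1
      obtain ⟨r', hr', ho', -⟩ := tst_mem.1 h2
      have := okTest_unique hr hr' ho ho' hpq
      subst this
      rw [hr] at hr'
      cases hr'
      have e1 := ((okTest_iff _ _ _ _).1 ho).1
      have e2 := ((okTest_iff _ _ _ _).1 ho').1
      exact hpq.eq_of_length (e1.trans e2.symm))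
  refine ⟨1 + C, fun y hy n x l hn => ?_⟩
  have h0 : 0 ≤ W (f y) n * 2 ^ (l + 1) := mul_nonneg (W_nonneg _ _) (by positivity)
  have hc := Nat.ceil_lt_add_one h0
  have hlt : ⌈W (f y) n * 2 ^ (l + 1)⌉₊ < 2 ^ (l + 1) := by
    have h1 := hy (n + 1)
    rw [W_succ, hn] at h1
    simp only [w] at h1
    have : (1 / 2 : ℝ) ^ l * 2 ^ (l + 1) = 2 := by
      rw [pow_succ, ← mul_assoc, ← mul_pow]; norm_num
    have h2 : (W (f y) n + (1 / 2 : ℝ) ^ l) * 2 ^ (l + 1) ≤ 1 * 2 ^ (l + 1) := by gcongr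
    rw [add_mul, this] at h2
    rw [← Nat.cast_lt (α := ℝ)]
    push_cast
    linarith
  obtain ⟨p, hp, hv⟩ := exists_val _ _ hlt
  have hok : okTest p (x, l) (dy (f y) n) = true := by
    rw [okTest_iff, hv]
    exact ⟨hp, Nat.le_ceil _, hc.le⟩
  have hmem : x ∈ Nat.rfindOpt (tst f (p, y)) := by
    have hd : (Nat.rfindOpt (tst f (p, y))).Dom :=
      Nat.rfindOpt_dom.2 ⟨n, x, tst_mem.2 ⟨_, hn, hok, rfl⟩⟩
    obtain ⟨m, hm⟩ := Nat.rfindOpt_spec (Part.get_mem hd)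
    obtain ⟨r, hr, ho, hx⟩ := tst_mem.1 hm
    have := okTest_unique hn hr hok ho (List.prefix_refl _)
    subst this
    rw [hn] at hr
    cases hr
    have hx' : x = (Nat.rfindOpt (tst f (p, y))).get hd := hx
    rw [hx']
    exact Part.get_mem hd
  obtain ⟨q, hq, hl⟩ := hC x y p hmem
  have := K_le hq
  omega

lemma kraft (S : Finset (List Bool)) (h : ∀ p ∈ S, ∀ q ∈ S, p <+: q → p = q) :
    ∑ p ∈ S, (1 / 2 : ℝ) ^ p.length ≤ 1 := by
  by_cases h0 : [] ∈ S
  · have : S = {[]} := by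
      ext q
      simp only [Finset.mem_singleton]
      exact ⟨fun hq => (h _ h0 q hq List.nil_prefix).symm, fun hq => hq ▸ h0⟩
    simp [this]
  · have hU : InformationTheory.UniquelyDecodable (S : Set (List Bool)) := by
      intro L1
      induction L1 with
      | nil =>
        intro L2 _ h2 he
        cases L2 with
        | nil => rfl
        | cons q L2 =>
          simp at he
          exact absurd (h2 q (by simp)) (by rw [he.1]; simpa using h0)
      | cons p L1 ih =>
        intro L2 h1 h2 he
        cases L2 with
        | nil =>
          simp at he
          exact absurd (h1 p (by simp)) (by rw [he.1]; simpa using h0)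
        | cons q L2 =>
          simp only [List.flatten_cons] at he
          have hp : p ∈ S := by simpa using h1 p (by simp)
          have hq : q ∈ S := by simpa using h2 q (by simp)
          have hpq : p = q := by
            rcases List.prefix_or_prefix_of_prefix (List.prefix_append p L1.flatten)
              (he ▸ List.prefix_append q L2.flatten) with hh | hh
            · exact h p hp q hq hh
            · exact (h q hq p hp hh).symm
          subst hpq
          rw [ih L2 (fun x hx => h1 x (by simp [hx])) (fun x hx => h2 x (by simp [hx]))
            (List.append_cancel_left he)]
    simpa using InformationTheory.kraft_mcmillan_inequality hU

end KCaux

namespace KCaux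

open Nat.Partrec in
lemma exists_eval (U : OptimalInterpreter) : ∃ cd : Code, ∀ (p : List Bool) (y x : ℕ),
    (x ∈ cd.eval (Nat.pair (encode p) y) ↔ x ∈ U.Φ p y) := by
  obtain ⟨cd, hcd⟩ := Code.exists_code.1 U.partrec
  refine ⟨cd, fun p y x => ?_⟩
  have : Nat.pair (encode p) y = encode (p, y) := rfl
  rw [hcd, this]
  simp

/-- `R` enumerates the graph of the interpreter. -/
structure Enumerates (U : OptimalInterpreter) (R : ℕ → ℕ → Option (ℕ × ℕ)) : Prop where
  comp : Computable₂ R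
  sound : ∀ c k e x l, R c (Nat.pair k e) = some (x, l) →
    ∃ p : List Bool, encode p = e ∧ x ∈ U.Φ p c ∧ p.length = l
  complete : ∀ c (p : List Bool) x, x ∈ U.Φ p c →
    ∃ k, R c (Nat.pair k (encode p)) = some (x, p.length)
  uniq : ∀ c k k' e, R c (Nat.pair k e) ≠ none → R c (Nat.pair k' e) ≠ none → k = k'

open Nat.Partrec in
lemma exists_enum (U : OptimalInterpreter) : ∃ R, Enumerates U R := by
  obtain ⟨cd, hcd⟩ := exists_eval U
  let H : ℕ → ℕ → ℕ → Option ℕ := fun k e c => Code.evaln k cd (Nat.pair e c)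
  let R : ℕ → ℕ → Option (ℕ × ℕ) := fun c n =>
    (decode₂ (List Bool) n.unpair.2).bind fun p =>
      Option.casesOn (H n.unpair.1 n.unpair.2 c)
        ((H (n.unpair.1 + 1) n.unpair.2 c).map fun x => (x, p.length)) (fun _ => none)
  have hR : ∀ c k e r, R c (Nat.pair k e) = some r ↔ ∃ p : List Bool, encode p = e ∧
      H k e c = Option.none ∧ H (k + 1) e c = some r.1 ∧ p.length = r.2 := by
    intro c k e r
    simp only [R, Nat.unpair_pair, Option.bind_eq_some_iff, Encodable.decode₂_eq_some]
    refine exists_congr fun p => and_congr_right fun _ => ?_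
    cases H k e c with
    | none =>
      cases H (k + 1) e c with
      | none => simp
      | some x => simp [Prod.ext_iff]
    | some x => simp
  have hmono : ∀ {k k' e c x}, k ≤ k' → H k e c = some x → H k' e c = some x :=
    fun h1 h2 => Code.evaln_mono h1 h2
  refine ⟨R, ?_, ?_, ?_, ?_⟩
  · have hH : Primrec (fun x : ℕ × ℕ × ℕ => H x.1 x.2.1 x.2.2) :=
      Code.primrec_evaln.comp (Primrec.pair (Primrec.pair Primrec.fst (Primrec.const cd))
        (Primrec₂.natPair.comp (Primrec.fst.comp Primrec.snd) (Primrec.snd.comp Primrec.snd)))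
    have hu1 : Primrec (fun x : ℕ × ℕ => x.2.unpair.1) :=
      Primrec.fst.comp (Primrec.unpair.comp Primrec.snd)
    have hu2 : Primrec (fun x : ℕ × ℕ => x.2.unpair.2) :=
      Primrec.snd.comp (Primrec.unpair.comp Primrec.snd)
    have hH1 : Primrec (fun x : ℕ × ℕ => H x.2.unpair.1 x.2.unpair.2 x.1) :=
      hH.comp (Primrec.pair hu1 (Primrec.pair hu2 Primrec.fst))
    have hH2 : Primrec (fun x : ℕ × ℕ => H (x.2.unpair.1 + 1) x.2.unpair.2 x.1) :=
      hH.comp (Primrec.pair (Primrec.succ.comp hu1) (Primrec.pair hu2 Primrec.fst))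
    have : Primrec (fun x : ℕ × ℕ => R x.1 x.2) := by
      refine Primrec.option_bind (Primrec.decode₂.comp hu2) ?_
      refine Primrec.option_casesOn (hH1.comp Primrec.fst) ?_ (Primrec.const none)
      refine Primrec.option_map (hH2.comp Primrec.fst) ?_
      exact Primrec.pair Primrec.snd
        (Primrec.list_length.comp (Primrec.snd.comp Primrec.fst))
    exact this.to_comp
  · intro c k e x l h
    obtain ⟨p, rfl, h1, h2, h3⟩ := (hR _ _ _ _).1 h
    exact ⟨p, rfl, (hcd p c x).1 (Code.evaln_sound h2), h3⟩
  · intro c p x hx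
    have hex : ∃ k, H k (encode p) c = some x := Code.evaln_complete.1 ((hcd p c x).2 hx)
    classical
    have h0 : Nat.find hex ≠ 0 := by
      intro h0
      have := Nat.find_spec hex
      rw [h0] at this
      simp [H, Code.evaln] at this
    obtain ⟨k, hk⟩ := Nat.exists_eq_succ_of_ne_zero h0
    refine ⟨k, (hR _ _ _ _).2 ⟨p, rfl, ?_, ?_, rfl⟩⟩
    · cases hh : H k (encode p) c with
      | none => rfl
      | some z =>
        have h1 := hmono (Nat.le_succ k) hh
        have h2 := Nat.find_spec hex
        rw [hk, h1] at h2
        cases h2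
        exact absurd hh (Nat.find_min hex (by omega))
    · have := Nat.find_spec hex
      rwa [hk] at this
  · intro c k k' e h1 h2
    obtain ⟨r, h1⟩ := Option.ne_none_iff_exists'.1 h1
    obtain ⟨r', h2⟩ := Option.ne_none_iff_exists'.1 h2
    obtain ⟨_, _, a1, a2, _⟩ := (hR _ _ _ _).1 h1
    obtain ⟨_, _, b1, b2, _⟩ := (hR _ _ _ _).1 h2
    rcases lt_trichotomy k k' with h | h | h
    · rw [hmono h a2] at b1; cases b1
    · exact h
    · rw [hmono h b2] at a1; cases a1

lemma W_le_inj {β : Type} [DecidableEq β] (f : ℕ → Option (ℕ × ℕ)) (N : ℕ) (i : ℕ → β)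
    (B : Finset β) (G : β → ℝ) (hG : ∀ b ∈ B, 0 ≤ G b)
    (h : ∀ n < N, f n ≠ none → i n ∈ B ∧ w (f n) ≤ G (i n))
    (inj : ∀ n m, f n ≠ none → f m ≠ none → i n = i m → n = m) : W f N ≤ ∑ b ∈ B, G b := by
  classical
  have e1 : W f N = ∑ n ∈ (Finset.range N).filter (fun n => f n ≠ none), w (f n) := by
    rw [Finset.sum_filter, W]
    refine Finset.sum_congr rfl fun n _ => ?_
    split_ifs with hn
    · rfl
    · rw [not_not.1 hn]; rfl
  rw [e1]
  have e2 : ∀ n ∈ (Finset.range N).filter (fun n => f n ≠ none), i n ∈ B ∧ w (f n) ≤ G (i n) := by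
    intro n hn
    rw [Finset.mem_filter, Finset.mem_range] at hn
    exact h n hn.1 hn.2
  refine (Finset.sum_le_sum fun n hn => (e2 n hn).2).trans ?_
  rw [← Finset.sum_image (f := G) (g := i)]
  · refine Finset.sum_le_sum_of_subset_of_nonneg ?_ fun b hb _ => hG b hb
    intro b hb
    obtain ⟨n, hn, rfl⟩ := Finset.mem_image.1 hb
    exact (e2 n hn).1
  · intro n hn m hm hnm
    simp only [Finset.coe_filter, Set.mem_ofPred_eq] at hn hm
    exact inj n m hn.2 hm.2 hnm

variable {U : OptimalInterpreter} {R : ℕ → ℕ → Option (ℕ × ℕ)}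

lemma W_R_le (hR : Enumerates U R) (c N : ℕ) : W (R c) N ≤ 1 := by
  classical
  have hs : ∀ n, R c n ≠ none → ∃ p : List Bool, encode p = n.unpair.2 ∧ (U.Φ p c).Dom ∧
      w (R c n) = (1 / 2 : ℝ) ^ p.length := by
    intro n hn
    obtain ⟨r, hr⟩ := Option.ne_none_iff_exists'.1 hn
    have hr' := hr
    rw [← Nat.pair_unpair n] at hr'
    obtain ⟨p, h1, h2, h3⟩ := hR.sound _ _ _ r.1 r.2 hr'
    exact ⟨p, h1, Part.dom_iff_mem.2 ⟨_, h2⟩, by rw [hr, h3]; rfl⟩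
  choose! P hP1 hP2 hP3 using hs
  let B := ((Finset.range N).filter (fun n => R c n ≠ none)).image P
  have hB : ∀ p ∈ B, (U.Φ p c).Dom := by
    intro p hp
    obtain ⟨n, hn, rfl⟩ := Finset.mem_image.1 hp
    exact hP2 n (Finset.mem_filter.1 hn).2
  refine (W_le_inj (R c) N P B (fun p => (1 / 2 : ℝ) ^ p.length) (fun _ _ => by positivity)
    ?_ ?_).trans (kraft B fun p hp q hq hpq => U.prefixFree c p q hpq (hB p hp) (hB q hq))
  · intro n hn hn'
    exact ⟨Finset.mem_image_of_mem _ (Finset.mem_filter.2 ⟨Finset.mem_range.2 hn, hn'⟩),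
      (hP3 n hn').le⟩
  · intro n m hn hm hnm
    have h2 : n.unpair.2 = m.unpair.2 := by rw [← hP1 n hn, ← hP1 m hm, hnm]
    have h1 : n.unpair.1 = m.unpair.1 := by
      apply hR.uniq c _ _ n.unpair.2
      · rwa [Nat.pair_unpair]
      · rwa [h2, Nat.pair_unpair]
    rw [← Nat.pair_unpair n, ← Nat.pair_unpair m, h1, h2]

/-- projection -/
lemma easy_dir (hR : Enumerates U R) {g : ℕ → ℕ} (hg : Computable g) :
    ∃ C, ∀ x c, U.K (g x) c ≤ U.K x c + C := by
  let f : ℕ → ℕ → Option (ℕ × ℕ) := fun c n => (R c n).map fun r => (g r.1, r.2)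
  have hf : Computable₂ f := by
    refine Computable.option_map hR.comp ?_
    exact Computable.pair (hg.comp (Computable.fst.comp Computable.snd))
      (Computable.snd.comp Computable.snd)
  obtain ⟨C, hC⟩ := KC U hf
  refine ⟨C, fun x c => ?_⟩
  have hW : ∀ N, W (f c) N ≤ 1 := by
    intro N
    refine le_trans (le_of_eq ?_) (W_R_le hR c N)
    refine Finset.sum_congr rfl fun n _ => ?_
    simp only [f]
    cases R c n <;> rfl
  obtain ⟨p, hp, hx⟩ := K_spec U x c
  obtain ⟨k, hk⟩ := hR.complete c p x hx
  rw [← hp]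
  exact hC c hW (Nat.pair k (encode p)) _ _ (by simp [f, hk])

/-- sequential composition -/
lemma compose (hR : Enumerates U R) : ∃ C, ∀ a b c (p q : List Bool),
    a ∈ U.Φ p c → b ∈ U.Φ q (Nat.pair (encode p) c) →
    U.K (Nat.pair a (Nat.pair b q.length)) c ≤ p.length + q.length + C := by
  let f : ℕ → ℕ → Option (ℕ × ℕ) := fun c n =>
    (R c n.unpair.1).bind fun r =>
      (R (Nat.pair n.unpair.1.unpair.2 c) n.unpair.2).map fun s =>
        (Nat.pair r.1 (Nat.pair s.1 s.2), r.2 + s.2)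
  have hf : Computable₂ f := by
    have hu : Computable (fun x : ℕ × ℕ => x.2.unpair) := Computable.unpair.comp Computable.snd
    have hu1 : Computable (fun x : ℕ × ℕ => x.2.unpair.1) := Computable.fst.comp hu
    have hu2 : Computable (fun x : ℕ × ℕ => x.2.unpair.2) := Computable.snd.comp hu
    have hu12 : Computable (fun x : ℕ × ℕ => x.2.unpair.1.unpair.2) :=
      Computable.snd.comp (Computable.unpair.comp hu1)
    have hy : Computable (fun x : ℕ × ℕ => Nat.pair x.2.unpair.1.unpair.2 x.1) :=
      Primrec₂.natPair.to_comp.comp hu12 Computable.fst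
    have hR2 : Computable (fun x : ℕ × ℕ => R (Nat.pair x.2.unpair.1.unpair.2 x.1) x.2.unpair.2) :=
      hR.comp.comp hy hu2
    refine Computable.option_bind (hR.comp.comp Computable.fst hu1) ?_
    refine Computable.option_map (hR2.comp Computable.fst) ?_
    have hr : Computable (fun x : ((ℕ × ℕ) × (ℕ × ℕ)) × (ℕ × ℕ) => x.1.2) :=
      Computable.snd.comp Computable.fst
    have hs : Computable (fun x : ((ℕ × ℕ) × (ℕ × ℕ)) × (ℕ × ℕ) => x.2) := Computable.snd
    exact Computable.pair
      (Primrec₂.natPair.to_comp.comp (Computable.fst.comp hr)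
        (Primrec₂.natPair.to_comp.comp (Computable.fst.comp hs) (Computable.snd.comp hs)))
      (Primrec.nat_add.to_comp.comp (Computable.snd.comp hr) (Computable.snd.comp hs))
  obtain ⟨C, hC⟩ := KC U hf
  refine ⟨C, fun a b c p q hp hq => ?_⟩
  have hW : ∀ N, W (f c) N ≤ 1 := by
    intro N
    let G : ℕ × ℕ → ℝ := fun m => w (R c m.1) * w (R (Nat.pair m.1.unpair.2 c) m.2)
    refine (W_le_inj (f c) N Nat.unpair (Finset.range N ×ˢ Finset.range N) G
      (fun _ _ => mul_nonneg (w_nonneg _) (w_nonneg _)) ?_ ?_).trans ?_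
    · intro n hn hf
      refine ⟨Finset.mem_product.2 ⟨Finset.mem_range.2 ((Nat.unpair_left_le n).trans_lt hn),
        Finset.mem_range.2 ((Nat.unpair_right_le n).trans_lt hn)⟩, le_of_eq ?_⟩
      simp only [f, G]
      cases R c n.unpair.1 with
      | none => simp [w]
      | some r =>
        cases R (Nat.pair n.unpair.1.unpair.2 c) n.unpair.2 with
        | none => simp [w]
        | some s => simp [w, pow_add]
    · intro n m _ _ h
      rw [← Nat.pair_unpair n, ← Nat.pair_unpair m, h]
    · rw [Finset.sum_product]
      refine le_trans (Finset.sum_le_sum fun m _ => ?_) (W_R_le hR c N)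
      simp only [G]
      rw [← Finset.mul_sum]
      exact mul_le_of_le_one_right (w_nonneg _) (W_R_le hR _ N)
  obtain ⟨k, hk⟩ := hR.complete c p a hp
  obtain ⟨k', hk'⟩ := hR.complete _ q b hq
  exact hC c hW (Nat.pair (Nat.pair k (encode p)) (Nat.pair k' (encode q))) _ _
    (by simp [f, hk, hk'])

end KCaux

namespace KCaux

variable {U : OptimalInterpreter} {R : ℕ → ℕ → Option (ℕ × ℕ)}

/-- requests whose first output component is `a` -/
def flt (R : ℕ → ℕ → Option (ℕ × ℕ)) (x : ℕ × ℕ) (n : ℕ) : Option (ℕ × ℕ) :=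
  (R x.1 n).bind fun r => cond (decide (r.1.unpair.1 = x.2)) (some r) none

lemma comp_flt (hR : Computable₂ R) : Computable₂ (flt R) := by
  unfold flt
  refine Computable.option_bind
    (hR.comp (Computable.fst.comp Computable.fst) Computable.snd) ?_
  have h1 : Computable (fun x : ((ℕ × ℕ) × ℕ) × (ℕ × ℕ) => x.2.1.unpair.1) :=
    Computable.fst.comp (Computable.unpair.comp (Computable.fst.comp Computable.snd))
  have h2 : Computable (fun x : ((ℕ × ℕ) × ℕ) × (ℕ × ℕ) => x.1.1.2) :=
    Computable.snd.comp (Computable.fst.comp Computable.fst)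
  have h3 : Computable (fun x : ((ℕ × ℕ) × ℕ) × (ℕ × ℕ) =>
      decide (x.2.1.unpair.1 = x.1.1.2)) :=
    (PrimrecRel.decide (Primrec.eq (α := ℕ))).to_comp.comp h1 h2
  exact Computable.cond h3 (Computable.option_some.comp Computable.snd) (Computable.const none)

lemma flt_eq_some {x : ℕ × ℕ} {n r} : flt R x n = some r ↔
    R x.1 n = some r ∧ r.1.unpair.1 = x.2 := by
  simp only [flt, Option.bind_eq_some_iff]
  constructor
  · rintro ⟨s, h1, h2⟩
    by_cases h : s.1.unpair.1 = x.2
    · simp [h] at h2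
      subst h2; exact ⟨h1, h⟩
    · simp [h] at h2
  · rintro ⟨h1, h2⟩
    exact ⟨r, h1, by simp [h2]⟩

lemma sum_W_flt (c N : ℕ) (A : Finset ℕ) : ∑ a ∈ A, W (flt R (c, a)) N ≤ W (R c) N := by
  unfold W
  rw [Finset.sum_comm]
  refine Finset.sum_le_sum fun n _ => ?_
  cases hr : R c n with
  | none => simp [flt, hr, w]
  | some r =>
    have : ∀ a ∈ A, w (flt R (c, a) n) = if r.1.unpair.1 = a then w (some r) else 0 := by
      intro a _
      simp only [flt, hr, Option.bind_some]
      by_cases h : r.1.unpair.1 = a <;> simp [h, w]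
    rw [Finset.sum_congr rfl this, Finset.sum_ite_eq]
    split_ifs
    · exact le_rfl
    · exact w_nonneg _

def thr (s : ℕ × ℕ) (j : ℕ) : Bool := decide (2 ^ s.2 ≤ s.1 * 2 ^ j)

lemma prim_thr : Primrec₂ thr := by
  unfold thr
  exact (PrimrecRel.decide Primrec.nat_le).comp
    (prim_two_pow.comp (Primrec.snd.comp Primrec.fst))
    (Primrec.nat_mul.comp (Primrec.fst.comp Primrec.fst) (prim_two_pow.comp Primrec.snd))

lemma thr_iff (f n j) : thr (dy f n) j = true ↔ (1 / 2 : ℝ) ^ j ≤ W f n := by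
  have hpos : (0 : ℝ) < 2 ^ (dy f n).2 := by positivity
  simp only [thr, decide_eq_true_eq]
  rw [← Nat.cast_le (α := ℝ)]
  push_cast
  rw [dy_eq, mul_right_comm, le_mul_iff_one_le_left hpos, one_div, inv_pow,
    inv_le_iff_one_le_mul₀ (by positivity)]

/-- first time threshold -/
def cross (R : ℕ → ℕ → Option (ℕ × ℕ)) (c t a j : ℕ) : Bool :=
  thr (dy (flt R (c, a)) (t + 1)) j && !(thr (dy (flt R (c, a)) t) j)

lemma cross_iff (c t a j) : cross R c t a j = true ↔
    (1 / 2 : ℝ) ^ j ≤ W (flt R (c, a)) (t + 1) ∧ W (flt R (c, a)) t < (1 / 2 : ℝ) ^ j := by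
  simp only [cross, Bool.and_eq_true, Bool.not_eq_true', thr_iff]
  rw [← Bool.not_eq_true, thr_iff, not_le]

def f1 (R : ℕ → ℕ → Option (ℕ × ℕ)) (c m : ℕ) : Option (ℕ × ℕ) :=
  cond (cross R c m.unpair.1 m.unpair.2.unpair.1 m.unpair.2.unpair.2)
    (some (m.unpair.2.unpair.1, m.unpair.2.unpair.2 + 1)) none

lemma comp_f1 (hR : Computable₂ R) : Computable₂ (f1 R) := by
  have hu : Computable (fun x : ℕ × ℕ => x.2.unpair) := Computable.unpair.comp Computable.snd
  have ht : Computable (fun x : ℕ × ℕ => x.2.unpair.1) := Computable.fst.comp hu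
  have hu2 : Computable (fun x : ℕ × ℕ => x.2.unpair.2.unpair) :=
    Computable.unpair.comp (Computable.snd.comp hu)
  have ha : Computable (fun x : ℕ × ℕ => x.2.unpair.2.unpair.1) := Computable.fst.comp hu2
  have hj : Computable (fun x : ℕ × ℕ => x.2.unpair.2.unpair.2) := Computable.snd.comp hu2
  have hca : Computable (fun x : ℕ × ℕ => (x.1, x.2.unpair.2.unpair.1)) :=
    Computable.pair Computable.fst ha
  have hdy := comp_dy (comp_flt hR)
  have hd1 : Computable (fun x : ℕ × ℕ =>
      dy (flt R (x.1, x.2.unpair.2.unpair.1)) (x.2.unpair.1 + 1)) :=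
    hdy.comp hca (Computable.succ.comp ht)
  have hd2 : Computable (fun x : ℕ × ℕ =>
      dy (flt R (x.1, x.2.unpair.2.unpair.1)) x.2.unpair.1) := hdy.comp hca ht
  have hc : Computable (fun x : ℕ × ℕ =>
      cross R x.1 x.2.unpair.1 x.2.unpair.2.unpair.1 x.2.unpair.2.unpair.2) := by
    unfold cross
    exact Primrec.and.to_comp.comp (prim_thr.to_comp.comp hd1 hj)
      (Primrec.not.to_comp.comp (prim_thr.to_comp.comp hd2 hj))
  have hs : Computable (fun x : ℕ × ℕ =>
      some (x.2.unpair.2.unpair.1, x.2.unpair.2.unpair.2 + 1)) :=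
    Computable.option_some.comp (Computable.pair ha (Computable.succ.comp hj))
  exact Computable.cond hc hs (Computable.const none)

lemma f1_ne_none {c m} (h : f1 R c m ≠ none) :
    cross R c m.unpair.1 m.unpair.2.unpair.1 m.unpair.2.unpair.2 = true ∧
    f1 R c m = some (m.unpair.2.unpair.1, m.unpair.2.unpair.2 + 1) := by
  unfold f1 at h ⊢
  cases hc : cross R c m.unpair.1 m.unpair.2.unpair.1 m.unpair.2.unpair.2 <;> simp_all

lemma geom_bound (A : Finset ℕ) (S : ℝ) (h0 : 0 ≤ S) (h : ∀ j ∈ A, (1 / 2 : ℝ) ^ j ≤ S) :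
    ∑ j ∈ A, (1 / 2 : ℝ) ^ (j + 1) ≤ S := by
  rcases A.eq_empty_or_nonempty with rfl | hA
  · simpa using h0
  · set j0 := A.min' hA
    refine le_trans ?_ (h j0 (A.min'_mem hA))
    have key : ∀ n, ∑ j ∈ Finset.Ico j0 (j0 + n), (1 / 2 : ℝ) ^ (j + 1)
        = (1 / 2 : ℝ) ^ j0 - (1 / 2 : ℝ) ^ (j0 + n) := by
      intro n
      induction n with
      | zero => simp
      | succ n ih =>
        rw [← add_assoc, Finset.sum_Ico_succ_top (by omega), ih]
        ring
    have hsub : A ⊆ Finset.Ico j0 (j0 + (A.max' hA + 1)) := by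
      intro j hj
      have h1 := A.min'_le j hj
      have h2 := A.le_max' j hj
      rw [Finset.mem_Ico]
      exact ⟨h1, by omega⟩
    refine (Finset.sum_le_sum_of_subset_of_nonneg hsub fun _ _ _ => by positivity).trans ?_
    rw [key]
    have : (0 : ℝ) ≤ (1 / 2 : ℝ) ^ (j0 + (A.max' hA + 1)) := by positivity
    linarith

lemma W_f1_le (hR : Enumerates U R) (c N : ℕ) : W (f1 R c) N ≤ 1 := by
  classical
  let A := (Finset.range N).image (fun m => m.unpair.2.unpair.1)
  let J := (Finset.range N).image (fun m => m.unpair.2.unpair.2)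
  let T : ℕ → Finset ℕ := fun a => J.filter (fun j => (1 / 2 : ℝ) ^ j ≤ W (flt R (c, a)) N)
  refine (W_le_inj (f1 R c) N (fun m => (⟨m.unpair.2.unpair.1, m.unpair.2.unpair.2⟩ : Σ _ : ℕ, ℕ))
    (A.sigma T) (fun x => (1 / 2 : ℝ) ^ (x.2 + 1)) (fun _ _ => by positivity) ?_ ?_).trans ?_
  · intro m hm hf
    obtain ⟨h1, h2⟩ := f1_ne_none hf
    rw [h2]
    refine ⟨?_, le_rfl⟩
    have hm' := Finset.mem_range.2 hm
    rw [Finset.mem_sigma]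
    refine ⟨Finset.mem_image_of_mem _ hm', Finset.mem_filter.2
      ⟨Finset.mem_image_of_mem (fun m => m.unpair.2.unpair.2) hm', ?_⟩⟩
    refine ((cross_iff _ _ _ _).1 h1).1.trans (W_mono _ ?_)
    have := Nat.unpair_left_le m
    omega
  · intro n m hn hm hnm
    have h1 := (cross_iff _ _ _ _).1 (f1_ne_none hn).1
    have h2 := (cross_iff _ _ _ _).1 (f1_ne_none hm).1
    simp only [Sigma.mk.injEq, heq_eq_eq] at hnm
    obtain ⟨e1, e2⟩ := hnm
    rw [e1, e2] at h1
    have e3 : n.unpair.2 = m.unpair.2 := by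
      rw [← Nat.pair_unpair n.unpair.2, ← Nat.pair_unpair m.unpair.2, e1, e2]
    have e4 : n.unpair.1 = m.unpair.1 := by
      rcases lt_trichotomy n.unpair.1 m.unpair.1 with h | h | h
      · have := W_mono (flt R (c, m.unpair.2.unpair.1)) (show n.unpair.1 + 1 ≤ m.unpair.1 from h)
        linarith
      · exact h
      · have := W_mono (flt R (c, m.unpair.2.unpair.1)) (show m.unpair.1 + 1 ≤ n.unpair.1 from h)
        linarith
    rw [← Nat.pair_unpair n, ← Nat.pair_unpair m, e3, e4]
  · rw [Finset.sum_sigma]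
    refine (Finset.sum_le_sum fun a _ => geom_bound (T a) (W (flt R (c, a)) N) (W_nonneg _ _)
      fun j hj => (Finset.mem_filter.1 hj).2).trans ?_
    exact (sum_W_flt c N A).trans (W_R_le hR c N)

lemma W_flt_le (hR : Enumerates U R) (c a N : ℕ) : W (flt R (c, a)) N ≤ 1 := by
  have := (sum_W_flt (R := R) c N {a}).trans (W_R_le hR c N)
  simpa using this

/-- the coding theorem for the marginal -/
lemma coding (hR : Enumerates U R) :
    ∃ D : ℕ, ∀ c a N, W (flt R (c, a)) N * 2 ^ (U.K a c) ≤ 2 ^ D := by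
  obtain ⟨C, hC⟩ := KC U (comp_f1 hR.comp)
  refine ⟨C + 2, fun c a N => ?_⟩
  rcases (W_nonneg (flt R (c, a)) N).eq_or_lt with h0 | h0
  · rw [← h0]; simp
  classical
  have hex : ∃ j : ℕ, (1 / 2 : ℝ) ^ j ≤ W (flt R (c, a)) N := by
    obtain ⟨j, hj⟩ := exists_pow_lt_of_lt_one h0 (by norm_num : (1 / 2 : ℝ) < 1)
    exact ⟨j, hj.le⟩
  set j := Nat.find hex with hj
  have hj1 : (1 / 2 : ℝ) ^ j ≤ W (flt R (c, a)) N := Nat.find_spec hex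
  have hj2 : W (flt R (c, a)) N ≤ 2 * (1 / 2 : ℝ) ^ j := by
    rcases Nat.eq_zero_or_pos j with h | h
    · rw [h]
      have := W_flt_le hR c a N
      norm_num
      linarith
    · have := Nat.find_min hex (show j - 1 < Nat.find hex by omega)
      rw [not_le] at this
      obtain ⟨i, hi⟩ : ∃ i, j = i + 1 := ⟨j - 1, by omega⟩
      rw [hi, pow_succ]
      rw [hi] at this
      simp only [Nat.add_sub_cancel] at this
      linarith
  have hex2 : ∃ t : ℕ, (1 / 2 : ℝ) ^ j ≤ W (flt R (c, a)) t := ⟨N, hj1⟩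
  have ht0 : Nat.find hex2 ≠ 0 := by
    intro h
    have := Nat.find_spec hex2
    rw [h] at this
    have h3 : (0 : ℝ) < (1 / 2 : ℝ) ^ j := by positivity
    simp only [W, Finset.range_zero, Finset.sum_empty] at this
    linarith
  obtain ⟨t, ht⟩ := Nat.exists_eq_succ_of_ne_zero ht0
  have hcr : cross R c t a j = true := by
    rw [cross_iff]
    constructor
    · have := Nat.find_spec hex2
      rwa [ht] at this
    · exact not_le.1 (Nat.find_min hex2 (by omega))
  have hK : U.K a c ≤ j + 1 + C := by
    refine hC c (W_f1_le hR c) (Nat.pair t (Nat.pair a j)) a (j + 1) ?_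
    simp [f1, hcr]
  calc W (flt R (c, a)) N * 2 ^ (U.K a c) ≤ (2 * (1 / 2 : ℝ) ^ j) * 2 ^ (j + 1 + C) := by
        gcongr
        norm_num
    _ = 2 ^ (C + 2) := by
        have : (1 / 2 : ℝ) ^ j * 2 ^ j = 1 := by rw [← mul_pow]; norm_num
        calc _ = ((1 / 2 : ℝ) ^ j * 2 ^ j) * 2 ^ (C + 2) := by ring
          _ = _ := by rw [this, one_mul]

def f2 (R : ℕ → ℕ → Option (ℕ × ℕ)) (D y n : ℕ) : Option (ℕ × ℕ) :=
  (R y.unpair.2 (Nat.pair n.unpair.1 y.unpair.1)).bind fun r0 =>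
    (flt R (y.unpair.2, r0.1) n.unpair.2).map fun r => (r.1.unpair.2, r.2 + D - r0.2)

lemma comp_f2 (hR : Computable₂ R) (D : ℕ) : Computable₂ (f2 R D) := by
  have hu : Computable (fun x : ℕ × ℕ => x.2.unpair) := Computable.unpair.comp Computable.snd
  have hv : Computable (fun x : ℕ × ℕ => x.1.unpair) := Computable.unpair.comp Computable.fst
  have hu1 : Computable (fun x : ℕ × ℕ => x.2.unpair.1) := Computable.fst.comp hu
  have hu2 : Computable (fun x : ℕ × ℕ => x.2.unpair.2) := Computable.snd.comp hu
  have hv1 : Computable (fun x : ℕ × ℕ => x.1.unpair.1) := Computable.fst.comp hv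
  have hv2 : Computable (fun x : ℕ × ℕ => x.1.unpair.2) := Computable.snd.comp hv
  have hr0 : Computable (fun x : ℕ × ℕ => R x.1.unpair.2 (Nat.pair x.2.unpair.1 x.1.unpair.1)) :=
    hR.comp hv2 (Primrec₂.natPair.to_comp.comp hu1 hv1)
  have hca : Computable (fun x : (ℕ × ℕ) × (ℕ × ℕ) => (x.1.1.unpair.2, x.2.1)) :=
    Computable.pair (hv2.comp Computable.fst) (Computable.fst.comp Computable.snd)
  have hfl : Computable (fun x : (ℕ × ℕ) × (ℕ × ℕ) =>
      flt R (x.1.1.unpair.2, x.2.1) x.1.2.unpair.2) :=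
    (comp_flt hR).comp hca (hu2.comp Computable.fst)
  have h1 : Computable (fun x : ((ℕ × ℕ) × (ℕ × ℕ)) × (ℕ × ℕ) => x.2.1.unpair.2) :=
    Computable.snd.comp (Computable.unpair.comp (Computable.fst.comp Computable.snd))
  have h2 : Computable (fun x : ((ℕ × ℕ) × (ℕ × ℕ)) × (ℕ × ℕ) => x.2.2 + D) :=
    Primrec.nat_add.to_comp.comp (Computable.snd.comp Computable.snd) (Computable.const D)
  have h3 : Computable (fun x : ((ℕ × ℕ) × (ℕ × ℕ)) × (ℕ × ℕ) => x.2.2 + D - x.1.2.2) :=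
    Primrec.nat_sub.to_comp.comp h2 (Computable.snd.comp (Computable.snd.comp Computable.fst))
  exact Computable.option_bind hr0 (Computable.option_map hfl (Computable.pair h1 h3))

lemma chain (hR : Enumerates U R) : ∃ C, ∀ a b c,
    U.K a c + U.K b (Nat.pair (encode (U.star a c)) c) ≤ U.K (Nat.pair a b) c + C := by
  obtain ⟨D, hD⟩ := coding hR
  obtain ⟨C, hC⟩ := KC U (comp_f2 hR.comp D)
  refine ⟨D + C, fun a b c => ?_⟩
  obtain ⟨hs1, hs2⟩ := star_spec U a c
  set p0 := U.star a c
  have hr0 : ∀ k r, R c (Nat.pair k (encode p0)) = some r → r = (a, U.K a c) := by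
    intro k r hr
    obtain ⟨p, h1, h2, h3⟩ := hR.sound _ _ _ r.1 r.2 hr
    have := Encodable.encode_injective h1
    subst this
    exact Prod.ext (Part.mem_unique h2 hs2) (h3.symm.trans hs1)
  have hlen : ∀ m r, flt R (c, a) m = some r → U.K a c ≤ r.2 + D := by
    intro m r hr
    have h1 := hD c a (m + 1)
    have h2 : (1 / 2 : ℝ) ^ r.2 ≤ W (flt R (c, a)) (m + 1) := by
      rw [W_succ, hr]
      have := W_nonneg (flt R (c, a)) m
      simp only [w]
      linarith
    have h3 : (1 / 2 : ℝ) ^ r.2 * 2 ^ U.K a c ≤ 2 ^ D := le_trans (by gcongr) h1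
    have h4 : (2 : ℝ) ^ U.K a c ≤ 2 ^ (r.2 + D) := by
      rw [one_div, inv_pow, inv_mul_le_iff₀ (by positivity)] at h3
      rwa [pow_add]
    exact (pow_le_pow_iff_right₀ (by norm_num)).1 h4
  have hW : ∀ N, W (f2 R D (Nat.pair (encode p0) c)) N ≤ 1 := by
    intro N
    refine (W_le_inj _ N (fun n => n.unpair.2) (Finset.range N)
      (fun m => w (flt R (c, a) m) * (2 ^ U.K a c / 2 ^ D))
      (fun _ _ => mul_nonneg (w_nonneg _) (by positivity)) ?_ ?_).trans ?_
    · intro n hn hf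
      refine ⟨Finset.mem_range.2 ((Nat.unpair_right_le n).trans_lt hn), le_of_eq ?_⟩
      simp only [f2, Nat.unpair_pair] at hf ⊢
      cases h0 : R c (Nat.pair n.unpair.1 (encode p0)) with
      | none => simp [h0] at hf
      | some r0 =>
        have := hr0 _ _ h0
        subst this
        cases h1 : flt R (c, a) n.unpair.2 with
        | none => simp [h0, h1] at hf
        | some r =>
          have hl := hlen _ _ h1
          simp only [Option.bind_some, h1, Option.map_some, w]
          obtain ⟨d, hd⟩ := Nat.exists_eq_add_of_le hl
          have e : r.2 + D - U.K a c = d := by omega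
          rw [e]
          have e2 : (2 : ℝ) ^ r.2 * 2 ^ D = 2 ^ U.K a c * 2 ^ d := by
            rw [← pow_add, ← pow_add, hd]
          rw [one_div, inv_pow, inv_pow]
          field_simp
          linarith
    · intro n m hn hm hnm
      have h1 : n.unpair.1 = m.unpair.1 := by
        apply hR.uniq c _ _ (encode p0)
        · intro h
          simp [f2, h] at hn
        · intro h
          simp [f2, h] at hm
      rw [← Nat.pair_unpair n, ← Nat.pair_unpair m, h1, hnm]
    · rw [← Finset.sum_mul]
      have := hD c a N
      change W (flt R (c, a)) N * _ ≤ 1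
      rw [← mul_div_assoc, div_le_one (by positivity)]
      exact this
  obtain ⟨p, hp, hx⟩ := K_spec U (Nat.pair a b) c
  obtain ⟨k, hk⟩ := hR.complete c p _ hx
  obtain ⟨k0, hk0⟩ := hR.complete c p0 _ hs2
  have hfl : flt R (c, a) (Nat.pair k (encode p)) = some (Nat.pair a b, p.length) := by
    rw [flt_eq_some]
    exact ⟨hk, by simp⟩
  have h1 := hC (Nat.pair (encode p0) c) hW (Nat.pair k0 (Nat.pair k (encode p))) b
    (p.length + D - p0.length) (by simp [f2, hk0, hfl])
  have h2 := hlen _ _ hfl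
  simp only at h2
  omega

end KCaux

/-- For any naturals `a, b` and finite sequence `c`,
`K(a,b|c) =⁺ K(a, b, K(b | a*[c], c) | c)`. -/
theorem complexity_of_complexity_conditional (U : OptimalInterpreter) :
    ∃ C : ℕ, ∀ (a b : ℕ) (c : List ℕ),
      U.K (Nat.pair a b) (encode c) ≤
        U.K (Nat.pair a (Nat.pair b
          (U.K b (Nat.pair (encode (U.star a (encode c))) (encode c))))) (encode c) + C ∧
      U.K (Nat.pair a (Nat.pair b
          (U.K b (Nat.pair (encode (U.star a (encode c))) (encode c))))) (encode c) ≤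
        U.K (Nat.pair a b) (encode c) + C := by
  obtain ⟨R, hR⟩ := KCaux.exists_enum U
  have hg : Computable (fun x : ℕ => Nat.pair x.unpair.1 x.unpair.2.unpair.1) :=
    Primrec₂.natPair.to_comp.comp (Computable.fst.comp Computable.unpair)
      (Computable.fst.comp (Computable.unpair.comp (Computable.snd.comp Computable.unpair)))
  obtain ⟨C1, h1⟩ := KCaux.easy_dir hR hg
  obtain ⟨C2, h2⟩ := KCaux.compose hR
  obtain ⟨C3, h3⟩ := KCaux.chain hR
  refine ⟨C1 + (C2 + C3), fun a b c => ⟨?_, ?_⟩⟩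
  · have := h1 (Nat.pair a (Nat.pair b
          (U.K b (Nat.pair (encode (U.star a (encode c))) (encode c))))) (encode c)
    simp only [Nat.unpair_pair] at this
    omega
  · obtain ⟨hs1, hs2⟩ := KCaux.star_spec U a (encode c)
    obtain ⟨q, hq1, hq2⟩ := KCaux.K_spec U b
      (Nat.pair (encode (U.star a (encode c))) (encode c))
    have h4 := h2 a b (encode c) _ q hs2 hq2
    have h5 := h3 a b (encode c)
    rw [hq1, hs1] at h4
    omega
end

section
/- For any binary string b and any a, c, the inequality K(a, b | c) ≥ K(a, b*[a,c] | c) − 2·log(l(b)) − O(1) holds, where b*[a,c] is the shortest program computing b from (a,c). -/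
open Encodable

namespace KStar

theorem K_le (U : OptimalInterpreter) {x y : ℕ} {p : List Bool} (h : x ∈ U.Φ p y) :
    U.K x y ≤ p.length := Nat.sInf_le ⟨p, rfl, h⟩

theorem K_spec (U : OptimalInterpreter) (x y : ℕ) :
    ∃ p : List Bool, p.length = U.K x y ∧ x ∈ U.Φ p y := by
  have : (({n | ∃ p : List Bool, p.length = n ∧ x ∈ U.Φ p y} : Set ℕ)).Nonempty := by
    obtain ⟨p, hp⟩ := U.onto x y
    exact ⟨p.length, p, rfl, hp⟩
  exact Nat.sInf_mem this

theorem star_spec (U : OptimalInterpreter) (x y : ℕ) :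
    (U.star x y).length = U.K x y ∧ x ∈ U.Φ (U.star x y) y := by
  have : (({n | ∃ p : List Bool, Encodable.encode p = n ∧
        p.length = U.K x y ∧ x ∈ U.Φ p y} : Set ℕ)).Nonempty := by
    obtain ⟨p, hp, hp'⟩ := K_spec U x y
    exact ⟨_, p, rfl, hp, hp'⟩
  obtain ⟨p, hp, h1, h2⟩ := Nat.sInf_mem this
  have e : U.star x y = p := by
    unfold OptimalInterpreter.star
    rw [← hp]; simp
  rw [e]; exact ⟨h1, h2⟩

/-- A computable enumeration of a prefix-free set of (program, output) pairs
bounds the complexity. -/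
theorem machine (U : OptimalInterpreter) {τ : Type} [Primcodable τ]
    (G : ℕ → τ → Option (List Bool × ℕ)) (hG : Primrec₂ G)
    (hpf : ∀ y T T' p q u v, G y T = some (p, u) → G y T' = some (q, v) → p <+: q →
      p = q ∧ u = v) :
    ∃ C : ℕ, ∀ y T p u, G y T = some (p, u) → U.K u y ≤ p.length + C := by
  let F : List Bool × ℕ → ℕ → Option ℕ := fun a N =>
    (decode (α := τ) N).bind fun T => (G a.2 T).bind fun e =>
      if e.1 = a.1 then some e.2 else none
  have hF : Primrec₂ F := by
    refine Primrec.option_bind (Primrec.decode.comp Primrec.snd) ?_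
    refine Primrec.option_bind
      (hG.comp (Primrec.snd.comp (Primrec.fst.comp Primrec.fst)) Primrec.snd) ?_
    refine Primrec.ite (Primrec.eq.comp (Primrec.fst.comp Primrec.snd)
      (Primrec.fst.comp (Primrec.fst.comp (Primrec.fst.comp Primrec.fst)))) ?_ (Primrec.const none)
    exact Primrec.option_some.comp (Primrec.snd.comp Primrec.snd)
  have hFs : ∀ a N x, x ∈ F a N → ∃ T, G a.2 T = some (a.1, x) := by
    intro a N x h
    simp only [F, Option.mem_def, Option.bind_eq_some_iff] at h
    obtain ⟨T, _, e, he, h⟩ := h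
    split_ifs at h with h'
    refine ⟨T, ?_⟩
    rw [he, ← h']
    simp at h
    rw [← h]
  have hFc : ∀ y T p u, G y T = some (p, u) → u ∈ F (p, y) (encode T) := by
    intro y T p u h
    simp [F, h]
  obtain ⟨C, hC⟩ := U.optimal (fun p y => Nat.rfindOpt (F (p, y))) (Partrec.rfindOpt hF.to_comp) (by
    intro y p q hpq hp hq
    obtain ⟨n, u, h1⟩ := Nat.rfindOpt_dom.1 hp
    obtain ⟨m, v, h2⟩ := Nat.rfindOpt_dom.1 hq
    obtain ⟨T, h1⟩ := hFs _ _ _ h1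
    obtain ⟨T', h2⟩ := hFs _ _ _ h2
    exact (hpf _ _ _ _ _ _ _ h1 h2 hpq).1)
  refine ⟨C, fun y T p u h => ?_⟩
  have hd : (Nat.rfindOpt (F (p, y))).Dom := Nat.rfindOpt_dom.2 ⟨_, _, hFc _ _ _ _ h⟩
  have hm := Part.get_mem hd
  obtain ⟨n, hn⟩ := Nat.rfindOpt_spec hm
  obtain ⟨T', h'⟩ := hFs _ _ _ hn
  have := (hpf _ _ _ _ _ _ _ h h' (List.prefix_refl _)).2
  rw [← this] at hm
  obtain ⟨q, hq, hl⟩ := hC _ _ _ hm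
  exact (K_le U hq).trans hl

/-- Enumeration of halting computations without repetition. -/
theorem exists_ev (U : OptimalInterpreter) :
    ∃ ev : ℕ → ℕ → Option (List Bool × ℕ), Primrec₂ ev ∧
      (∀ y t p x, ev y t = some (p, x) → x ∈ U.Φ p y) ∧
      (∀ y p x, x ∈ U.Φ p y → ∃ t, ev y t = some (p, x)) ∧
      (∀ y t t' p x x', ev y t = some (p, x) → ev y t' = some (p, x') → t = t') := by
  obtain ⟨cd, hcd⟩ := Nat.Partrec.Code.exists_code.1 U.partrec
  have hcd' : ∀ p y x, x ∈ Nat.Partrec.Code.eval cd (encode ((p, y) : List Bool × ℕ)) ↔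
      x ∈ U.Φ p y := by
    intro p y x
    rw [hcd]
    simp
  let ev : ℕ → ℕ → Option (List Bool × ℕ) := fun y t =>
    (decode (α := ℕ × List Bool) t).bind fun a =>
      (Nat.Partrec.Code.evaln (a.1 + 1) cd (encode ((a.2, y) : List Bool × ℕ))).bind fun x =>
        if Nat.Partrec.Code.evaln a.1 cd (encode ((a.2, y) : List Bool × ℕ)) = none ∧
            encode a = t then
          some (a.2, x) else none
  have hev : ∀ y t p x, ev y t = some (p, x) ↔ ∃ s : ℕ, encode (s, p) = t ∧
      Nat.Partrec.Code.evaln (s + 1) cd (encode ((p, y) : List Bool × ℕ)) = some x ∧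
      Nat.Partrec.Code.evaln s cd (encode ((p, y) : List Bool × ℕ)) = none := by
    intro y t p x
    simp only [ev, Option.bind_eq_some_iff]
    constructor
    · rintro ⟨⟨s, p'⟩, h1, x', h2, h3⟩
      split_ifs at h3 with h4
      simp at h3
      obtain ⟨rfl, rfl⟩ := h3
      exact ⟨s, h4.2, h2, h4.1⟩
    · rintro ⟨s, h1, h2, h3⟩
      exact ⟨(s, p), by rw [← h1]; simp, x, h2, if_pos ⟨h3, h1⟩⟩
  refine ⟨ev, ?_, ?_, ?_, ?_⟩
  · refine Primrec.option_bind (Primrec.decode.comp Primrec.snd) ?_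
    have henc : Primrec fun z : (ℕ × ℕ) × (ℕ × List Bool) =>
        (encode ((z.2.2, z.1.1) : List Bool × ℕ)) :=
      Primrec.encode.comp (Primrec.pair (Primrec.snd.comp Primrec.snd)
        (Primrec.fst.comp Primrec.fst))
    refine Primrec.option_bind (f := fun z : (ℕ × ℕ) × (ℕ × List Bool) =>
      Nat.Partrec.Code.evaln (z.2.1 + 1) cd (encode ((z.2.2, z.1.1) : List Bool × ℕ))) ?_ ?_
    · exact Nat.Partrec.Code.primrec_evaln.comp (Primrec.pair (Primrec.pair
        (Primrec.succ.comp (Primrec.fst.comp Primrec.snd)) (Primrec.const cd)) henc)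
    · refine Primrec.ite (PrimrecPred.and (Primrec.eq.comp ?_ (Primrec.const none))
        (Primrec.eq.comp (Primrec.encode.comp (Primrec.snd.comp Primrec.fst))
          (Primrec.snd.comp (Primrec.fst.comp Primrec.fst)))) ?_ (Primrec.const none)
      · exact Nat.Partrec.Code.primrec_evaln.comp (Primrec.pair (Primrec.pair
          ((Primrec.fst.comp Primrec.snd).comp Primrec.fst) (Primrec.const cd))
          (henc.comp Primrec.fst))
      · exact Primrec.option_some.comp (Primrec.pair
          (Primrec.snd.comp (Primrec.snd.comp Primrec.fst)) Primrec.snd)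
  · intro y t p x h
    obtain ⟨s, h1, h2, h3⟩ := (hev _ _ _ _).1 h
    exact (hcd' _ _ _).1 (Nat.Partrec.Code.evaln_sound h2)
  · intro y p x h
    have h := Nat.Partrec.Code.evaln_complete.1 ((hcd' _ _ _).2 h)
    classical
    have hs := Nat.find_spec h
    have hm := fun m => Nat.find_min h (m := m)
    generalize Nat.find h = s at hs hm
    cases s with
    | zero => simp [Nat.Partrec.Code.evaln] at hs
    | succ s =>
      refine ⟨encode ((s, p) : ℕ × List Bool), (hev _ _ _ _).2 ⟨s, rfl, hs, ?_⟩⟩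
      by_contra hne
      obtain ⟨x', hx'⟩ := Option.ne_none_iff_exists'.1 hne
      have h2 := Nat.Partrec.Code.evaln_mono (Nat.le_succ s) hx'
      rw [Option.mem_def] at hs h2
      have : x' = x := by
        have := h2.symm.trans hs
        simpa using this
      subst this
      exact hm s (Nat.lt_succ_self s) hx'
  · intro y t t' p x x' h h'
    obtain ⟨s, h1, h2, h3⟩ := (hev _ _ _ _).1 h
    obtain ⟨s', h1', h2', h3'⟩ := (hev _ _ _ _).1 h'
    have key : ∀ s s' x, Nat.Partrec.Code.evaln (s + 1) cd (encode ((p, y) : List Bool × ℕ)) = some x →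
      Nat.Partrec.Code.evaln s' cd (encode ((p, y) : List Bool × ℕ)) = none → s' ≤ s := by
      intro s s' x h2 h3
      by_contra hlt
      have := Nat.Partrec.Code.evaln_mono (show s + 1 ≤ s' by omega) h2
      rw [Option.mem_def, h3] at this
      simp at this
    have : s = s' := le_antisymm (key _ _ _ h2' h3) (key _ _ _ h2 h3')
    subst this
    rw [← h1, ← h1']

/-- Prefix-free codes are uniquely decodable. -/
theorem ud_of_prefixFree {S : Set (List Bool)} (h0 : [] ∉ S)
    (h : ∀ p ∈ S, ∀ q ∈ S, p <+: q → p = q) : InformationTheory.UniquelyDecodable S := by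
  intro L₁
  induction L₁ with
  | nil =>
    intro L₂ _ h2 he
    cases L₂ with
    | nil => rfl
    | cons a l =>
      simp at he
      exact absurd (h2 a (by simp)) (by rw [he.1]; exact h0)
  | cons a l ih =>
    intro L₂ h1 h2 he
    cases L₂ with
    | nil =>
      simp at he
      exact absurd (h1 a (by simp)) (by rw [he.1]; exact h0)
    | cons a' l' =>
      simp only [List.flatten_cons] at he
      have hp : a <+: a' ++ l'.flatten := ⟨_, he⟩
      have hp' : a' <+: a' ++ l'.flatten := ⟨_, rfl⟩
      have haa : a = a' := by
        rcases List.prefix_or_prefix_of_prefix hp hp' with hh | hh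
        · exact h _ (h1 a (by simp)) _ (h2 a' (by simp)) hh
        · exact (h _ (h2 a' (by simp)) _ (h1 a (by simp)) hh).symm
      subst haa
      rw [List.append_cancel_left_eq] at he
      rw [ih l' (fun w hw => h1 w (by simp [hw])) (fun w hw => h2 w (by simp [hw])) he]

theorem kraft (U : OptimalInterpreter) (y : ℕ) (S : Finset (List Bool))
    (hS : ∀ p ∈ S, (U.Φ p y).Dom) : ∑ p ∈ S, (1 / 2 : ℝ) ^ p.length ≤ 1 := by
  have := InformationTheory.kraft_mcmillan_inequality (S := S) (ud_of_prefixFree ?_ ?_)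
  · simpa using this
  · intro h
    have hd := hS [] (by simpa using h)
    obtain ⟨p, hp⟩ := U.onto 0 y
    obtain ⟨q, hq⟩ := U.onto 1 y
    have e1 := U.prefixFree y [] p (by simp) hd (Part.dom_iff_mem.2 ⟨_, hp⟩)
    have e2 := U.prefixFree y [] q (by simp) hd (Part.dom_iff_mem.2 ⟨_, hq⟩)
    rw [← e1] at hp
    rw [← e2] at hq
    exact absurd (Part.mem_unique hp hq) (by simp)
  · intro p hp q hq hpq
    exact U.prefixFree y p q hpq (hS p (by simpa using hp)) (hS q (by simpa using hq))

/-- Value of a binary string. -/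
def val (l : List Bool) : ℕ := l.foldl (fun n b => 2 * n + b.toNat) 0

theorem foldl_val (l : List Bool) : ∀ n : ℕ,
    l.foldl (fun n b => 2 * n + b.toNat) n = n * 2 ^ l.length + val l := by
  induction l with
  | nil => intro n; simp [val]
  | cons b l ih =>
    intro n
    simp only [val, List.foldl_cons, List.length_cons]
    rw [ih, ih (2 * 0 + b.toNat)]
    ring

theorem val_append (l m : List Bool) : val (l ++ m) = val l * 2 ^ m.length + val m := by
  rw [val, List.foldl_append, foldl_val m]; rfl

theorem val_lt (l : List Bool) : val l < 2 ^ l.length := by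
  induction l using List.reverseRecOn with
  | nil => simp [val]
  | append_singleton l b ih =>
    rw [val_append]
    have : val [b] < 2 := by cases b <;> simp [val]
    simp only [List.length_append, List.length_singleton, pow_succ, pow_zero]
    omega

theorem exists_val (r : ℕ) : ∀ v : ℕ, v < 2 ^ r → ∃ l : List Bool, l.length = r ∧ val l = v := by
  induction r with
  | zero => intro v hv; exact ⟨[], rfl, by simp at hv; simp [val, hv]⟩
  | succ r ih =>
    intro v hv
    obtain ⟨l, h1, h2⟩ := ih (v / 2) (by rw [pow_succ] at hv; omega)
    refine ⟨l ++ [decide (v % 2 = 1)], by simp [h1], ?_⟩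
    rw [val_append, h2]
    rcases Nat.mod_two_eq_zero_or_one v with h | h <;> simp [h, val] <;> omega

theorem primrec_val : Primrec val := by
  refine Primrec.list_foldl (α := List Bool) (h := fun _ a => 2 * a.1 + a.2.toNat)
    Primrec.id (Primrec.const 0) ?_
  refine Primrec.nat_add.comp (Primrec.nat_mul.comp (Primrec.const 2)
    (Primrec.fst.comp Primrec.snd)) ?_
  exact (Primrec.dom_finite Bool.toNat).comp (Primrec.snd.comp Primrec.snd)

/-- Unary code of `k` followed by `q`. -/
def un (k : ℕ) (q : List Bool) : List Bool := (List.range k).map (fun _ => true) ++ false :: q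

theorem primrec_un : Primrec₂ un := by
  refine Primrec.list_append.comp (Primrec.list_map (Primrec.list_range.comp Primrec.fst)
    (Primrec.const true).to₂) ?_
  exact Primrec.list_cons.comp (Primrec.const false) Primrec.snd

theorem un_zero (q : List Bool) : un 0 q = false :: q := by simp [un]

theorem un_succ (k : ℕ) (q : List Bool) : un (k + 1) q = true :: un k q := by
  simp [un, List.range_succ_eq_map]

theorem un_length (k : ℕ) (q : List Bool) : (un k q).length = k + 1 + q.length := by
  simp [un]; omega

theorem un_prefix : ∀ {k k' : ℕ} {q q' : List Bool}, un k q <+: un k' q' → k = k' ∧ q <+: q'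
  | 0, 0, q, q', h => by simpa [un_zero, List.cons_prefix_cons] using h
  | 0, k' + 1, q, q', h => by simp [un_zero, un_succ, List.cons_prefix_cons] at h
  | k + 1, 0, q, q', h => by simp [un_zero, un_succ, List.cons_prefix_cons] at h
  | k + 1, k' + 1, q, q', h => by
    simp only [un_succ, List.cons_prefix_cons, true_and] at h
    have := un_prefix h
    exact ⟨by omega, this.2⟩

theorem sd_prefix {s s' : List Bool} (h : un s.length s <+: un s'.length s') : s = s' := by
  obtain ⟨h1, h2⟩ := un_prefix h
  exact h2.eq_of_length h1

theorem primrec_pow : Primrec₂ ((· ^ ·) : ℕ → ℕ → ℕ) :=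
  Primrec₂.unpaired'.1 Nat.Primrec.pow

/-- Simple upper bound on complexity. -/
theorem K_bound (U : OptimalInterpreter) :
    ∃ C : ℕ, ∀ (b : List Bool) (y : ℕ), U.K (encode b) y ≤ 2 * b.length + C := by
  obtain ⟨C, hC⟩ := machine U (τ := List Bool)
    (fun _ s => some (un s.length s, encode s))
    (by
      refine Primrec.option_some.comp (Primrec.pair ?_ (Primrec.encode.comp Primrec.snd))
      exact primrec_un.comp (Primrec.list_length.comp Primrec.snd) Primrec.snd)
    (by
      intro y T T' p q u v h h' hpq
      simp only [Option.some.injEq, Prod.mk.injEq] at h h'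
      obtain ⟨rfl, rfl⟩ := h
      obtain ⟨rfl, rfl⟩ := h'
      have := sd_prefix hpq
      subst this
      simp)
  refine ⟨C + 1, fun b y => ?_⟩
  have := hC y b _ _ rfl
  rw [un_length] at this
  omega

section Count

variable (ev : ℕ → ℕ → Option (List Bool × ℕ))

/-- The (length, output) pair of an event. -/
def key (y t : ℕ) : Option (ℕ × ℕ) := (ev y t).map fun e => (e.1.length, e.2)

/-- Number of earlier events with the given length and output. -/
def cnt (y : ℕ) (z : ℕ × ℕ) (t : ℕ) : ℕ :=
  Nat.rec 0 (fun i acc => if key ev y i = some z then acc + 1 else acc) t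

theorem cnt_succ (y : ℕ) (z : ℕ × ℕ) (t : ℕ) : cnt ev y z (t + 1) =
    if key ev y t = some z then cnt ev y z t + 1 else cnt ev y z t := rfl

theorem cnt_card (y : ℕ) (z : ℕ × ℕ) (t : ℕ) : cnt ev y z t =
    ((Finset.range t).filter fun i => key ev y i = some z).card := by
  induction t with
  | zero => rfl
  | succ t ih =>
    rw [cnt_succ, Finset.range_add_one, Finset.filter_insert, ih]
    split_ifs
    · rw [Finset.card_insert_of_notMem (by simp)]
    · rfl

theorem cnt_mono (y : ℕ) (z : ℕ × ℕ) : Monotone (cnt ev y z) :=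
  monotone_nat_of_le_succ fun t => by rw [cnt_succ]; split_ifs <;> omega

theorem cnt_inj {y : ℕ} {z : ℕ × ℕ} {t t' : ℕ} (h : key ev y t = some z)
    (h' : key ev y t' = some z) (hc : cnt ev y z t = cnt ev y z t') : t = t' := by
  have aux : ∀ t t', key ev y t = some z → t < t' → cnt ev y z t < cnt ev y z t' := by
    intro t t' h hlt
    have h1 := cnt_succ ev y z t
    rw [if_pos h] at h1
    have h2 := cnt_mono ev y z (show t + 1 ≤ t' from hlt)
    omega
  rcases lt_trichotomy t t' with hl | hl | hl
  · have := aux _ _ h hl; omega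
  · exact hl
  · have := aux _ _ h' hl; omega

theorem cnt_reach (y : ℕ) (z : ℕ × ℕ) {J : ℕ} (hJ : 0 < J) (T : ℕ) (h : J ≤ cnt ev y z T) :
    ∃ t, key ev y t = some z ∧ cnt ev y z t + 1 = J := by
  induction T with
  | zero => have : cnt ev y z 0 = 0 := rfl
            omega
  | succ T ih =>
    rw [cnt_succ] at h
    by_cases h' : J ≤ cnt ev y z T
    · exact ih h'
    · split_ifs at h with hk
      · exact ⟨T, hk, by omega⟩
      · omega

variable {ev} in
theorem primrec_key (hev : Primrec₂ ev) : Primrec₂ (key ev) :=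
  Primrec.option_map hev (Primrec.pair (Primrec.list_length.comp (Primrec.fst.comp Primrec.snd))
    (Primrec.snd.comp Primrec.snd))

variable {ev} in
theorem primrec_cnt (hev : Primrec₂ ev) :
    Primrec fun a : (ℕ × (ℕ × ℕ)) × ℕ => cnt ev a.1.1 a.1.2 a.2 := by
  refine Primrec.nat_rec' (α := (ℕ × (ℕ × ℕ)) × ℕ)
    (h := fun a b => if key ev a.1.1 b.1 = some a.1.2 then b.2 + 1 else b.2) Primrec.snd (Primrec.const 0) ?_
  refine Primrec.ite (Primrec.eq.comp ((primrec_key hev).comp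
      (Primrec.fst.comp (Primrec.fst.comp Primrec.fst)) (Primrec.fst.comp Primrec.snd))
      (Primrec.option_some.comp (Primrec.snd.comp (Primrec.fst.comp Primrec.fst)))) ?_ ?_
  · exact Primrec.succ.comp (Primrec.snd.comp Primrec.snd)
  · exact Primrec.snd.comp Primrec.snd

/-- Requests: the `4^k`-th event with given length and output. -/
def req (k y t : ℕ) : Option (ℕ × ℕ) :=
  (key ev y t).bind fun z => if cnt ev y z t + 1 = 4 ^ k then some z else none

theorem req_iff (k y t : ℕ) (z : ℕ × ℕ) : req ev k y t = some z ↔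
    key ev y t = some z ∧ cnt ev y z t + 1 = 4 ^ k := by
  simp only [req, Option.bind_eq_some_iff]
  constructor
  · rintro ⟨z', h, h'⟩
    split_ifs at h' with hh
    simp at h'
    subst h'
    exact ⟨h, hh⟩
  · rintro ⟨h, h'⟩
    exact ⟨z, h, if_pos h'⟩

variable {ev} in
theorem primrec_req (hev : Primrec₂ ev) :
    Primrec fun a : (ℕ × ℕ) × ℕ => req ev a.1.1 a.1.2 a.2 := by
  refine Primrec.option_bind ((primrec_key hev).comp (Primrec.snd.comp Primrec.fst)
    Primrec.snd) ?_
  refine Primrec.ite (Primrec.eq.comp ?_ ?_) (Primrec.option_some.comp Primrec.snd)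
    (Primrec.const none)
  · exact Primrec.succ.comp ((primrec_cnt hev).comp (Primrec.pair (Primrec.pair
      (Primrec.snd.comp (Primrec.fst.comp Primrec.fst)) Primrec.snd)
      (Primrec.snd.comp Primrec.fst)))
  · exact primrec_pow.comp (Primrec.const 4) (Primrec.fst.comp (Primrec.fst.comp Primrec.fst))

/-- Left end of the interval allotted at time `t`, as numerator and binary exponent. -/
def pos (k y t : ℕ) : ℕ × ℕ :=
  Nat.rec (0, 0) (fun i s => Option.casesOn (req ev k y i) s
    (fun z => (s.1 * 2 ^ z.1 + 4 ^ k * 2 ^ s.2, s.2 + z.1))) t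

/-- Weight of the request at time `t`. -/
noncomputable def wt (k y t : ℕ) : ℝ :=
  Option.casesOn (req ev k y t) 0 (fun z => 4 ^ k / 2 ^ z.1)

/-- Left end as a real. -/
noncomputable def posR (k y t : ℕ) : ℝ := (pos ev k y t).1 / 2 ^ (pos ev k y t).2

theorem posR_succ (k y t : ℕ) : posR ev k y (t + 1) = posR ev k y t + wt ev k y t := by
  have : pos ev k y (t + 1) = Option.casesOn (req ev k y t) (pos ev k y t)
    (fun z => ((pos ev k y t).1 * 2 ^ z.1 + 4 ^ k * 2 ^ (pos ev k y t).2,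
      (pos ev k y t).2 + z.1)) := rfl
  unfold posR wt
  rw [this]
  cases req ev k y t with
  | none => simp
  | some z =>
    simp only
    push_cast
    rw [pow_add]
    field_simp

theorem wt_nonneg (k y t : ℕ) : 0 ≤ wt ev k y t := by
  unfold wt
  cases req ev k y t with
  | none => simp
  | some z => simp only; positivity

theorem posR_mono (k y : ℕ) : Monotone (posR ev k y) :=
  monotone_nat_of_le_succ fun t => by
    rw [posR_succ]; linarith [wt_nonneg ev k y t]

theorem posR_sum (k y t : ℕ) : posR ev k y t = ∑ i ∈ Finset.range t, wt ev k y i := by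
  induction t with
  | zero => simp [posR, pos]
  | succ t ih => rw [posR_succ, Finset.sum_range_succ, ih]

variable {ev} in
theorem primrec_pos (hev : Primrec₂ ev) :
    Primrec fun a : (ℕ × ℕ) × ℕ => pos ev a.1.1 a.1.2 a.2 := by
  refine Primrec.nat_rec' (α := (ℕ × ℕ) × ℕ)
    (h := fun a b => Option.casesOn (req ev a.1.1 a.1.2 b.1) b.2
      (fun z => (b.2.1 * 2 ^ z.1 + 4 ^ a.1.1 * 2 ^ b.2.2, b.2.2 + z.1))) Primrec.snd (Primrec.const (0, 0)) ?_
  refine Primrec.option_casesOn ?_ (Primrec.snd.comp Primrec.snd) ?_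
  · exact (primrec_req hev).comp (Primrec.pair (Primrec.fst.comp Primrec.fst)
      (Primrec.fst.comp Primrec.snd))
  · have hs : Primrec fun a : (((ℕ × ℕ) × ℕ) × ℕ × (ℕ × ℕ)) × (ℕ × ℕ) => a.1.2.2 :=
      Primrec.snd.comp (Primrec.snd.comp Primrec.fst)
    have hz : Primrec fun a : (((ℕ × ℕ) × ℕ) × ℕ × (ℕ × ℕ)) × (ℕ × ℕ) => a.2.1 :=
      Primrec.fst.comp Primrec.snd
    have hk : Primrec fun a : (((ℕ × ℕ) × ℕ) × ℕ × (ℕ × ℕ)) × (ℕ × ℕ) => a.1.1.1.1 :=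
      Primrec.fst.comp (Primrec.fst.comp (Primrec.fst.comp Primrec.fst))
    refine Primrec.pair (Primrec.nat_add.comp ?_ ?_) ?_
    · exact Primrec.nat_mul.comp (Primrec.fst.comp hs) (primrec_pow.comp (Primrec.const 2) hz)
    · exact Primrec.nat_mul.comp (primrec_pow.comp (Primrec.const 4) hk)
        (primrec_pow.comp (Primrec.const 2) (Primrec.snd.comp hs))
    · exact Primrec.nat_add.comp (Primrec.snd.comp hs) hz

end Count

theorem sum_events (U : OptimalInterpreter) (ev : ℕ → ℕ → Option (List Bool × ℕ))
    (hs : ∀ y t p x, ev y t = some (p, x) → x ∈ U.Φ p y)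
    (hi : ∀ y t t' p x x', ev y t = some (p, x) → ev y t' = some (p, x') → t = t')
    (y T : ℕ) :
    ∑ j ∈ (Finset.range T).filter (fun j => (key ev y j).isSome),
      (1 / 2 : ℝ) ^ ((key ev y j).getD (0, 0)).1 ≤ 1 := by
  classical
  let prog : ℕ → List Bool := fun j => ((ev y j).getD ([], 0)).1
  set E := (Finset.range T).filter (fun j => (key ev y j).isSome) with hE
  have hE' : ∀ j ∈ E, ∃ p x, ev y j = some (p, x) := by
    intro j hj
    rw [hE, Finset.mem_filter] at hj
    have h := hj.2
    simp only [key, Option.isSome_map] at h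
    obtain ⟨⟨p, x⟩, h⟩ := Option.isSome_iff_exists.1 h
    exact ⟨p, x, h⟩
  have h1 := kraft U y (E.image prog) (by
    intro p hp
    obtain ⟨j, hj, rfl⟩ := Finset.mem_image.1 hp
    obtain ⟨p, x, h⟩ := hE' j hj
    simp only [prog, h]
    exact Part.dom_iff_mem.2 ⟨x, hs _ _ _ _ h⟩)
  rw [Finset.sum_image] at h1
  · refine le_of_eq_of_le (Finset.sum_congr rfl ?_) h1
    intro j hj
    obtain ⟨p, x, h⟩ := hE' j hj
    simp [key, prog, h]
  · intro j hj j' hj' he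
    obtain ⟨p, x, h⟩ := hE' j hj
    obtain ⟨p', x', h'⟩ := hE' j' hj'
    simp only [prog, h, h', Option.getD_some] at he
    subst he
    exact hi _ _ _ _ _ _ h h'

theorem posR_le_one (U : OptimalInterpreter) (ev : ℕ → ℕ → Option (List Bool × ℕ))
    (hs : ∀ y t p x, ev y t = some (p, x) → x ∈ U.Φ p y)
    (hi : ∀ y t t' p x x', ev y t = some (p, x) → ev y t' = some (p, x') → t = t')
    (k y T : ℕ) : posR ev k y T ≤ 1 := by
  classical
  refine le_trans ?_ (sum_events U ev hs hi y T)
  rw [posR_sum]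
  let A : ℕ → Finset ℕ := fun i =>
    (Finset.range (i + 1)).filter fun j => ∃ z, req ev k y i = some z ∧ key ev y j = some z
  have hA : ∀ i, wt ev k y i = ∑ j ∈ A i, (1 / 2 : ℝ) ^ ((key ev y j).getD (0, 0)).1 := by
    intro i
    unfold wt
    cases h : req ev k y i with
    | none => simp [A, h]
    | some z =>
      simp only
      have h' := (req_iff ev k y i z).1 h
      have hAi : A i = (Finset.range (i + 1)).filter fun j => key ev y j = some z := by
        ext j
        simp only [A, h, Finset.mem_filter, Option.some.injEq, exists_eq_left']
      have hcard : (A i).card = 4 ^ k := by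
        rw [hAi, ← cnt_card, cnt_succ, if_pos h'.1, h'.2]
      rw [Finset.sum_congr rfl (g := fun _ => (1 / 2 : ℝ) ^ z.1), Finset.sum_const, hcard]
      · simp [div_eq_mul_inv]
      · intro j hj
        rw [hAi, Finset.mem_filter] at hj
        simp [hj.2]
  rw [Finset.sum_congr rfl (fun i _ => hA i), ← Finset.sum_biUnion]
  · refine Finset.sum_le_sum_of_subset_of_nonneg ?_ (fun _ _ _ => by positivity)
    intro j hj
    simp only [A, Finset.mem_biUnion, Finset.mem_filter, Finset.mem_range] at hj ⊢
    obtain ⟨i, hi, hj, z, _, hz⟩ := hj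
    exact ⟨by omega, by simp [hz]⟩
  · intro i _ i' _ hne
    rw [Function.onFun, Finset.disjoint_left]
    intro j hj hj'
    simp only [A, Finset.mem_filter] at hj hj'
    obtain ⟨_, z, hz, hkz⟩ := hj
    obtain ⟨_, z', hz', hkz'⟩ := hj'
    rw [hkz] at hkz'
    simp only [Option.some.injEq] at hkz'
    subst hkz'
    have h1 := (req_iff ev k y _ _).1 hz
    have h2 := (req_iff ev k y _ _).1 hz'
    exact hne (cnt_inj ev h1.1 h2.1 (by omega))

/-- The coding machine (enumeration form). -/
def codeM (ev : ℕ → ℕ → Option (List Bool × ℕ)) (y : ℕ) (T : (ℕ × ℕ) × List Bool) :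
    Option (List Bool × ℕ) :=
  (req ev T.1.1 y T.1.2).bind fun z =>
    if 2 * T.1.1 + T.2.length = z.1 + 1 ∧
      (pos ev T.1.1 y T.1.2).1 * 2 ^ T.2.length ≤ val T.2 * 2 ^ (pos ev T.1.1 y T.1.2).2 ∧
      (val T.2 + 1) * 2 ^ (pos ev T.1.1 y (T.1.2 + 1)).2 ≤
        (pos ev T.1.1 y (T.1.2 + 1)).1 * 2 ^ T.2.length
    then some (un T.1.1 T.2, z.2) else none

theorem codeM_iff (ev : ℕ → ℕ → Option (List Bool × ℕ)) (y k t : ℕ) (q p : List Bool) (u : ℕ) :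
    codeM ev y ((k, t), q) = some (p, u) ↔ p = un k q ∧ ∃ n, req ev k y t = some (n, u) ∧
      2 * k + q.length = n + 1 ∧ posR ev k y t ≤ val q / 2 ^ q.length ∧
      ((val q : ℝ) + 1) / 2 ^ q.length ≤ posR ev k y (t + 1) := by
  have e1 : (pos ev k y t).1 * 2 ^ q.length ≤ val q * 2 ^ (pos ev k y t).2 ↔
      posR ev k y t ≤ val q / 2 ^ q.length := by
    unfold posR
    rw [div_le_div_iff₀ (by positivity) (by positivity)]
    exact_mod_cast Iff.rfl
  have e2 : (val q + 1) * 2 ^ (pos ev k y (t + 1)).2 ≤ (pos ev k y (t + 1)).1 * 2 ^ q.length ↔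
      ((val q : ℝ) + 1) / 2 ^ q.length ≤ posR ev k y (t + 1) := by
    unfold posR
    rw [div_le_div_iff₀ (by positivity) (by positivity)]
    exact_mod_cast Iff.rfl
  rw [← e1, ← e2]
  simp only [codeM, Option.bind_eq_some_iff]
  constructor
  · rintro ⟨⟨n, x⟩, h, h'⟩
    split_ifs at h' with hh
    simp only [Option.some.injEq, Prod.mk.injEq] at h'
    obtain ⟨rfl, rfl⟩ := h'
    exact ⟨rfl, n, h, hh⟩
  · rintro ⟨rfl, n, h, hh⟩
    exact ⟨(n, u), h, if_pos hh⟩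

theorem primrec_codeM {ev : ℕ → ℕ → Option (List Bool × ℕ)} (hev : Primrec₂ ev) :
    Primrec₂ (codeM ev) := by
  have hk : Primrec fun a : ℕ × (ℕ × ℕ) × List Bool => a.2.1.1 :=
    Primrec.fst.comp (Primrec.fst.comp Primrec.snd)
  have ht : Primrec fun a : ℕ × (ℕ × ℕ) × List Bool => a.2.1.2 :=
    Primrec.snd.comp (Primrec.fst.comp Primrec.snd)
  have hq : Primrec fun a : ℕ × (ℕ × ℕ) × List Bool => a.2.2 :=
    Primrec.snd.comp Primrec.snd
  have hl := Primrec.list_length.comp hq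
  have hv := primrec_val.comp hq
  have hp := (primrec_pos hev).comp (Primrec.pair (Primrec.pair hk Primrec.fst) ht)
  have hp' := (primrec_pos hev).comp (Primrec.pair (Primrec.pair hk Primrec.fst)
    (Primrec.succ.comp ht))
  have h2 : ∀ {f : ℕ × (ℕ × ℕ) × List Bool → ℕ}, Primrec f → Primrec fun a => 2 ^ f a :=
    fun hf => primrec_pow.comp (Primrec.const 2) hf
  refine Primrec.option_bind ((primrec_req hev).comp
    (Primrec.pair (Primrec.pair hk Primrec.fst) ht)) ?_
  refine Primrec.ite (PrimrecPred.and ?_ (PrimrecPred.and ?_ ?_)) ?_ (Primrec.const none)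
  · exact Primrec.eq.comp (Primrec.nat_add.comp
      (Primrec.nat_mul.comp (Primrec.const 2) (hk.comp Primrec.fst)) (hl.comp Primrec.fst))
      (Primrec.succ.comp (Primrec.fst.comp Primrec.snd))
  · exact Primrec.nat_le.comp
      ((Primrec.nat_mul.comp (Primrec.fst.comp hp) (h2 hl)).comp Primrec.fst)
      ((Primrec.nat_mul.comp hv (h2 (Primrec.snd.comp hp))).comp Primrec.fst)
  · exact Primrec.nat_le.comp
      ((Primrec.nat_mul.comp (Primrec.succ.comp hv) (h2 (Primrec.snd.comp hp'))).comp Primrec.fst)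
      ((Primrec.nat_mul.comp (Primrec.fst.comp hp') (h2 hl)).comp Primrec.fst)
  · exact Primrec.option_some.comp (Primrec.pair
      ((primrec_un.comp hk hq).comp Primrec.fst) (Primrec.snd.comp Primrec.snd))

theorem codeM_pf (ev : ℕ → ℕ → Option (List Bool × ℕ)) (y : ℕ) (T T' : (ℕ × ℕ) × List Bool)
    (p q : List Bool) (u v : ℕ) (h : codeM ev y T = some (p, u))
    (h' : codeM ev y T' = some (q, v)) (hpq : p <+: q) : p = q ∧ u = v := by
  obtain ⟨⟨k, t⟩, r⟩ := T
  obtain ⟨⟨k', t'⟩, r'⟩ := T'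
  obtain ⟨rfl, n, h1, h2, h3, h4⟩ := (codeM_iff ev y k t r p u).1 h
  obtain ⟨rfl, n', h1', h2', h3', h4'⟩ := (codeM_iff ev y k' t' r' q v).1 h'
  obtain ⟨rfl, hrr⟩ := un_prefix hpq
  obtain ⟨w, rfl⟩ := hrr
  have hw : (val w : ℝ) < 2 ^ w.length := by exact_mod_cast val_lt w
  have hv : (val (r ++ w) : ℝ) = val r * 2 ^ w.length + val w := by
    exact_mod_cast val_append r w
  have hl : (2 : ℝ) ^ (r ++ w).length = 2 ^ r.length * 2 ^ w.length := by
    rw [List.length_append, pow_add]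
  have a1 : (val r : ℝ) / 2 ^ r.length ≤ val (r ++ w) / 2 ^ (r ++ w).length := by
    rw [hv, hl, div_le_div_iff₀ (by positivity) (by positivity)]
    have : (0 : ℝ) ≤ val w * 2 ^ r.length := by positivity
    nlinarith
  have a2 : (val (r ++ w) : ℝ) / 2 ^ (r ++ w).length < (val r + 1) / 2 ^ r.length := by
    rw [hv, hl, div_lt_div_iff₀ (by positivity) (by positivity)]
    have : (val w : ℝ) * 2 ^ r.length < 2 ^ w.length * 2 ^ r.length := by gcongr
    nlinarith
  have a3 : (val (r ++ w) : ℝ) / 2 ^ (r ++ w).length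
      < (val (r ++ w) + 1) / 2 ^ (r ++ w).length := by
    gcongr; linarith
  have htt : t = t' := by
    rcases lt_trichotomy t t' with hlt | heq | hlt
    · have := posR_mono ev k y (show t + 1 ≤ t' from hlt)
      linarith
    · exact heq
    · have := posR_mono ev k y (show t' + 1 ≤ t from hlt)
      linarith
  subst htt
  rw [h1] at h1'
  simp only [Option.some.injEq, Prod.mk.injEq] at h1'
  obtain ⟨rfl, rfl⟩ := h1'
  have : w = [] := by
    rw [← List.length_eq_zero_iff]
    rw [List.length_append] at h2'
    omega
  subst this
  simp

/-- The number of shortest programs is bounded. -/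
theorem count_bound (U : OptimalInterpreter) (ev : ℕ → ℕ → Option (List Bool × ℕ))
    (hev : Primrec₂ ev)
    (hs : ∀ y t p x, ev y t = some (p, x) → x ∈ U.Φ p y)
    (hi : ∀ y t t' p x x', ev y t = some (p, x) → ev y t' = some (p, x') → t = t') :
    ∃ J : ℕ, 0 < J ∧ ∀ y x t, cnt ev y (U.K x y, x) t < J := by
  obtain ⟨C, hC⟩ := machine U (codeM ev) (primrec_codeM hev) (codeM_pf ev)
  refine ⟨4 ^ (C + 3), by positivity, fun y x T => ?_⟩
  by_contra hcon
  push Not at hcon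
  set k := C + 3 with hk
  set n := U.K x y with hn
  obtain ⟨t, ht1, ht2⟩ := cnt_reach ev y (n, x) (by positivity) T hcon
  have hr := (req_iff ev k y t _).2 ⟨ht1, ht2⟩
  have hw : wt ev k y t = 4 ^ k / 2 ^ n := by simp [wt, hr]
  have hsucc := posR_succ ev k y t
  have hle := posR_le_one U ev hs hi k y (t + 1)
  have h0 : 0 ≤ posR ev k y t := by unfold posR; positivity
  have h4 : (4 : ℝ) ^ k = 2 ^ (2 * k) := by rw [pow_mul]; norm_num
  have hkn : 2 * k ≤ n := by
    have h1 : (4 : ℝ) ^ k / 2 ^ n ≤ 1 := by linarith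
    rw [div_le_one (by positivity), h4] at h1
    exact (pow_le_pow_iff_right₀ (by norm_num : (1 : ℝ) < 2)).1 h1
  obtain ⟨m, hm⟩ := Nat.exists_eq_add_of_le hkn
  have hw' : wt ev k y t = 2 / 2 ^ (m + 1) := by
    rw [hw, hm, h4, pow_add, pow_succ]
    field_simp
  set v := ⌈posR ev k y t * 2 ^ (m + 1)⌉₊ with hv
  have hv1 : posR ev k y t * 2 ^ (m + 1) ≤ v := Nat.le_ceil _
  have hv2 : (v : ℝ) < posR ev k y t * 2 ^ (m + 1) + 1 := Nat.ceil_lt_add_one (by positivity)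
  have hpos : (0 : ℝ) < 2 ^ (m + 1) := by positivity
  have hb : ((v : ℝ) + 1) / 2 ^ (m + 1) ≤ posR ev k y (t + 1) := by
    rw [hsucc, hw', div_le_iff₀ hpos, add_mul, div_mul_cancel₀ _ hpos.ne']
    linarith
  have hvlt : v < 2 ^ (m + 1) := by
    have := hb.trans hle
    rw [div_le_one hpos] at this
    have : (v : ℝ) < 2 ^ (m + 1) := by linarith
    exact_mod_cast this
  obtain ⟨q, hq1, hq2⟩ := exists_val (m + 1) v hvlt
  have := hC y ((k, t), q) (un k q) x ((codeM_iff ev y k t q _ x).2 ⟨rfl, n, hr, by omega,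
    by rw [hq1, hq2, le_div_iff₀ hpos]; exact hv1, by rw [hq1, hq2]; exact hb⟩)
  rw [un_length, hq1] at this
  omega

/-- The machine producing `(a, b*)` (enumeration form). -/
def starM (ev : ℕ → ℕ → Option (List Bool × ℕ)) (J c : ℕ) (T : (ℕ × ℕ) × List Bool) :
    Option (List Bool × ℕ) :=
  (ev c T.1.1).bind fun e => (ev (Nat.pair e.2.unpair.1 c) T.1.2).bind fun g =>
    if g.2 = e.2.unpair.2 ∧
      val T.2 = g.1.length * J +
        cnt ev (Nat.pair e.2.unpair.1 c) (g.1.length, e.2.unpair.2) T.1.2 ∧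
      cnt ev (Nat.pair e.2.unpair.1 c) (g.1.length, e.2.unpair.2) T.1.2 < J
    then some (e.1 ++ un T.2.length T.2, Nat.pair e.2.unpair.1 (encode g.1)) else none

theorem starM_iff (ev : ℕ → ℕ → Option (List Bool × ℕ)) (J c t1 t2 : ℕ) (s w : List Bool)
    (u : ℕ) : starM ev J c ((t1, t2), s) = some (w, u) ↔
    ∃ q a x p, ev c t1 = some (q, Nat.pair a x) ∧ ev (Nat.pair a c) t2 = some (p, x) ∧
      w = q ++ un s.length s ∧ u = Nat.pair a (encode p) ∧
      val s = p.length * J + cnt ev (Nat.pair a c) (p.length, x) t2 ∧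
      cnt ev (Nat.pair a c) (p.length, x) t2 < J := by
  simp only [starM, Option.bind_eq_some_iff]
  constructor
  · rintro ⟨⟨q, ax⟩, h1, ⟨p, x⟩, h2, h3⟩
    split_ifs at h3 with hh
    simp only [Option.some.injEq, Prod.mk.injEq] at h3
    obtain ⟨rfl, rfl⟩ := h3
    obtain ⟨hx, hh⟩ := hh
    simp only at hx
    subst hx
    exact ⟨q, ax.unpair.1, ax.unpair.2, p, by simpa using h1, h2, rfl, rfl, hh⟩
  · rintro ⟨q, a, x, p, h1, h2, rfl, rfl, hh⟩
    refine ⟨_, h1, (p, x), by simpa using h2, ?_⟩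
    simp only [Nat.unpair_pair]
    exact if_pos ⟨trivial, hh⟩

theorem primrec_starM {ev : ℕ → ℕ → Option (List Bool × ℕ)} (hev : Primrec₂ ev) (J : ℕ) :
    Primrec₂ (starM ev J) := by
  refine Primrec.option_bind
    (hev.comp Primrec.fst (Primrec.fst.comp (Primrec.fst.comp Primrec.snd))) ?_
  have ha : Primrec fun z : (ℕ × (ℕ × ℕ) × List Bool) × (List Bool × ℕ) => z.2.2.unpair.1 :=
    Primrec.fst.comp (Primrec.unpair.comp (Primrec.snd.comp Primrec.snd))
  have hx : Primrec fun z : (ℕ × (ℕ × ℕ) × List Bool) × (List Bool × ℕ) => z.2.2.unpair.2 :=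
    Primrec.snd.comp (Primrec.unpair.comp (Primrec.snd.comp Primrec.snd))
  have hac : Primrec fun z : (ℕ × (ℕ × ℕ) × List Bool) × (List Bool × ℕ) =>
      Nat.pair z.2.2.unpair.1 z.1.1 :=
    Primrec₂.natPair.comp ha (Primrec.fst.comp Primrec.fst)
  have ht : Primrec fun z : (ℕ × (ℕ × ℕ) × List Bool) × (List Bool × ℕ) => z.1.2.1.2 :=
    Primrec.snd.comp (Primrec.fst.comp (Primrec.snd.comp Primrec.fst))
  have hs : Primrec fun z : (ℕ × (ℕ × ℕ) × List Bool) × (List Bool × ℕ) => z.1.2.2 :=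
    Primrec.snd.comp (Primrec.snd.comp Primrec.fst)
  refine Primrec.option_bind (hev.comp hac ht) ?_
  have hl : Primrec fun z : ((ℕ × (ℕ × ℕ) × List Bool) × (List Bool × ℕ)) × (List Bool × ℕ) =>
      z.2.1.length := Primrec.list_length.comp (Primrec.fst.comp Primrec.snd)
  have hcn := (primrec_cnt hev).comp (Primrec.pair (Primrec.pair (hac.comp Primrec.fst)
    (Primrec.pair hl (hx.comp Primrec.fst))) (ht.comp Primrec.fst))
  refine Primrec.ite (PrimrecPred.and ?_ (PrimrecPred.and ?_ ?_)) ?_ (Primrec.const none)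
  · exact Primrec.eq.comp (Primrec.snd.comp Primrec.snd) (hx.comp Primrec.fst)
  · exact Primrec.eq.comp (primrec_val.comp (hs.comp Primrec.fst))
      (Primrec.nat_add.comp (Primrec.nat_mul.comp hl (Primrec.const J)) hcn)
  · exact Primrec.nat_lt.comp hcn (Primrec.const J)
  · refine Primrec.option_some.comp (Primrec.pair ?_ ?_)
    · exact Primrec.list_append.comp (Primrec.fst.comp (Primrec.snd.comp Primrec.fst))
        ((primrec_un.comp (Primrec.list_length.comp hs) hs).comp Primrec.fst)
    · exact Primrec₂.natPair.comp (ha.comp Primrec.fst)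
        (Primrec.encode.comp (Primrec.fst.comp Primrec.snd))

theorem starM_pf (U : OptimalInterpreter) (ev : ℕ → ℕ → Option (List Bool × ℕ)) (J : ℕ)
    (hs : ∀ y t p x, ev y t = some (p, x) → x ∈ U.Φ p y)
    (hi : ∀ y t t' p x x', ev y t = some (p, x) → ev y t' = some (p, x') → t = t')
    (c : ℕ) (T T' : (ℕ × ℕ) × List Bool)
    (w w' : List Bool) (u u' : ℕ) (h : starM ev J c T = some (w, u))
    (h' : starM ev J c T' = some (w', u')) (hww : w <+: w') : w = w' ∧ u = u' := by
  obtain ⟨⟨t1, t2⟩, s⟩ := T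
  obtain ⟨⟨t1', t2'⟩, s'⟩ := T'
  obtain ⟨q, a, x, p, h1, h2, rfl, rfl, h3, h4⟩ := (starM_iff ev J c t1 t2 s _ _).1 h
  obtain ⟨q', a', x', p', h1', h2', rfl, rfl, h3', h4'⟩ := (starM_iff ev J c t1' t2' s' _ _).1 h'
  have hq : q = q' := by
    have d1 := Part.dom_iff_mem.2 ⟨_, hs _ _ _ _ h1⟩
    have d2 := Part.dom_iff_mem.2 ⟨_, hs _ _ _ _ h1'⟩
    have p1 : q <+: q' ++ un s'.length s' := (List.prefix_append _ _).trans hww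
    rcases List.prefix_or_prefix_of_prefix p1 (List.prefix_append q' _) with hh | hh
    · exact U.prefixFree c _ _ hh d1 d2
    · exact (U.prefixFree c _ _ hh d2 d1).symm
  subst hq
  have hss := sd_prefix ((List.prefix_append_right_inj q).1 hww)
  subst hss
  have := hi _ _ _ _ _ _ h1 h1'
  subst this
  rw [h1] at h1'
  simp only [Option.some.injEq, Prod.mk.injEq, Nat.pair_eq_pair, true_and] at h1'
  obtain ⟨rfl, rfl⟩ := h1'
  have e := h3.symm.trans h3'
  have hlen : p.length = p'.length := by
    have e1 : (p.length * J + cnt ev (Nat.pair a c) (p.length, x) t2) / J = p.length := by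
      rw [mul_comm, Nat.mul_add_div (by omega), Nat.div_eq_of_lt h4, add_zero]
    have e2 : (p'.length * J + cnt ev (Nat.pair a c) (p'.length, x) t2') / J = p'.length := by
      rw [mul_comm, Nat.mul_add_div (by omega), Nat.div_eq_of_lt h4', add_zero]
    rw [← e1, ← e2, e]
  rw [← hlen] at e
  have hcc := Nat.add_left_cancel e
  have k1 : key ev (Nat.pair a c) t2 = some (p.length, x) := by simp [key, h2]
  have k2 : key ev (Nat.pair a c) t2' = some (p.length, x) := by simp [key, h2', hlen]
  have ht := cnt_inj ev k1 k2 hcc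
  subst ht
  rw [h2] at h2'
  simp only [Option.some.injEq, Prod.mk.injEq, and_true] at h2'
  subst h2'
  exact ⟨rfl, rfl⟩

end KStar

/-- `K(a, b | c) ≥ K(a, b*[a,c] | c) − 2·log l(b) − O(1)` for binary strings `b`. -/
theorem K_pair_star_lower (U : OptimalInterpreter) :
    ∃ C : ℕ, ∀ (b : List Bool) (a c : ℕ),
      U.K (Nat.pair a (encode (U.star (encode b) (Nat.pair a c)))) c ≤
        U.K (Nat.pair a (encode b)) c + 2 * Nat.log 2 b.length + C := by
  obtain ⟨ev, hev, hs, hc, hi⟩ := KStar.exists_ev U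
  obtain ⟨J, hJ, hcnt⟩ := KStar.count_bound U ev hev hs hi
  obtain ⟨C₁, hC₁⟩ := KStar.K_bound U
  obtain ⟨C, hC⟩ := KStar.machine U (KStar.starM ev J) (KStar.primrec_starM hev J)
    (KStar.starM_pf U ev J hs hi)
  refine ⟨2 * (1 + (C₁ + 3) * J) + 1 + C, fun b a c => ?_⟩
  obtain ⟨q, hq1, hq2⟩ := KStar.K_spec U (Nat.pair a (encode b)) c
  obtain ⟨hp1, hp2⟩ := KStar.star_spec U (encode b) (Nat.pair a c)
  set p := U.star (encode b) (Nat.pair a c) with hp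
  obtain ⟨t1, ht1⟩ := hc _ _ _ hq2
  obtain ⟨t2, ht2⟩ := hc _ _ _ hp2
  have hlt := hcnt (Nat.pair a c) (encode b) t2
  rw [← hp1] at hlt
  have hb := hC₁ b (Nat.pair a c)
  rw [← hp1] at hb
  set m := KStar.cnt ev (Nat.pair a c) (p.length, encode b) t2 with hm
  have hv : p.length * J + m < 2 ^ (Nat.log 2 b.length + 1 + (C₁ + 3) * J) := by
    have h1 : b.length < 2 ^ (Nat.log 2 b.length + 1) :=
      Nat.lt_pow_succ_log_self (by norm_num) _
    have h2 : (C₁ + 3) * J < 2 ^ ((C₁ + 3) * J) := Nat.lt_two_pow_self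
    have h3 : p.length + 1 ≤ 2 ^ (Nat.log 2 b.length + 1) * (C₁ + 3) := by
      have h4 : 1 ≤ 2 ^ (Nat.log 2 b.length + 1) := Nat.one_le_two_pow
      nlinarith
    calc p.length * J + m < (p.length + 1) * J := by nlinarith
      _ ≤ 2 ^ (Nat.log 2 b.length + 1) * (C₁ + 3) * J := Nat.mul_le_mul_right _ h3
      _ = 2 ^ (Nat.log 2 b.length + 1) * ((C₁ + 3) * J) := by ring
      _ ≤ 2 ^ (Nat.log 2 b.length + 1) * 2 ^ ((C₁ + 3) * J) := Nat.mul_le_mul_left _ h2.le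
      _ = _ := by rw [← pow_add]
  obtain ⟨s, hs1, hs2⟩ := KStar.exists_val _ _ hv
  have := hC c ((t1, t2), s) (q ++ KStar.un s.length s) (Nat.pair a (encode p))
    ((KStar.starM_iff ev J c t1 t2 s _ _).2
      ⟨q, a, encode b, p, ht1, ht2, rfl, rfl, hs2, hlt⟩)
  rw [List.length_append, KStar.un_length, hs1, hq1] at this
  omega
end

section
/- For any binary string b, K(b* | b) = K(K(b) | b) up to an additive constant, where b* is the shortest program for b and K(b) its length. -/
open Encodable

namespace KC

/-- Finite prefix-free sets satisfy Kraft's inequality. -/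
lemma kraft (S : Finset (List Bool))
    (h : ∀ p ∈ S, ∀ q ∈ S, p <+: q → p = q) :
    ∑ w ∈ S, (1 / 2 : ℝ) ^ w.length ≤ 1 := by
  by_cases h0 : [] ∈ S
  · have : S = {[]} := by
      ext q
      simp only [Finset.mem_singleton]
      refine ⟨fun hq => (h _ h0 _ hq ⟨q, rfl⟩).symm, ?_⟩
      rintro rfl
      exact h0
    rw [this]
    simp
  · have hU : InformationTheory.UniquelyDecodable (S : Set (List Bool)) := by
      intro L₁
      induction L₁ with
      | nil =>
        intro L₂ _ h2 hf
        cases L₂ with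
        | nil => rfl
        | cons b L =>
          exfalso
          simp at hf
          have := h2 b (by simp)
          rw [hf.1] at this
          exact h0 this
      | cons a L ih =>
        intro L₂ h1 h2 hf
        cases L₂ with
        | nil =>
          exfalso
          simp at hf
          have := h1 a (by simp)
          rw [hf.1] at this
          exact h0 this
        | cons b L' =>
          simp only [List.flatten_cons] at hf
          have ha : a ∈ S := h1 a (by simp)
          have hb : b ∈ S := h2 b (by simp)
          have hab : a = b := by
            have p1 : a <+: b ++ L'.flatten := hf ▸ List.prefix_append _ _
            have p2 : b <+: b ++ L'.flatten := List.prefix_append _ _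
            rcases le_total a.length b.length with hh | hh
            · exact h _ ha _ hb (List.prefix_of_prefix_length_le p1 p2 hh)
            · exact (h _ hb _ ha (List.prefix_of_prefix_length_le p2 p1 hh)).symm
          subst hab
          have hf' := List.append_cancel_left hf
          rw [ih L' (fun w hw => h1 w (by simp [hw])) (fun w hw => h2 w (by simp [hw])) hf']
    have := InformationTheory.kraft_mcmillan_inequality hU
    simpa using this

/-- A duplicate-free primitive recursive enumeration of the graph of a partial
recursive function on programs. -/
lemma exists_enum (f : List Bool →. ℕ) (hf : Partrec f) :
    ∃ ev : ℕ → Option (List Bool × ℕ), Primrec ev ∧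
      (∀ p x, x ∈ f p ↔ ∃ i, ev i = some (p, x)) ∧
      (∀ i j p x x', ev i = some (p, x) → ev j = some (p, x') → i = j) ∧
      (∀ i p x, ev i = some (p, x) → p.length ≤ i) := by
  obtain ⟨c, hc⟩ := Nat.Partrec.Code.exists_code.1 hf
  have hc' : ∀ p x, x ∈ f p ↔ x ∈ c.eval (encode p) := by
    intro p x
    rw [hc]
    simp
  let ev : ℕ → Option (List Bool × ℕ) := fun i =>
    (decode₂ (List Bool) i.unpair.1).bind fun p =>
      if c.evaln i.unpair.2 (encode p) = none then
        (c.evaln (i.unpair.2 + 1) (encode p)).map fun x => (p, x)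
      else none
  have hev : ∀ i p x, ev i = some (p, x) ↔ decode₂ (List Bool) i.unpair.1 = some p ∧
      c.evaln i.unpair.2 (encode p) = none ∧ c.evaln (i.unpair.2 + 1) (encode p) = some x := by
    intro i p x
    simp only [ev]
    cases decode₂ (List Bool) i.unpair.1 with
    | none => simp
    | some q =>
      simp only [Option.bind_some]
      split_ifs with hh
      · cases hq : c.evaln (i.unpair.2 + 1) (encode q) with
        | none => simp; rintro rfl _; simp [hq]
        | some z =>
          simp
          rintro rfl
          simp [hh, hq]
      · simp; rintro rfl h1; exact absurd h1 hh
  have hmono : ∀ k₁ k₂ n x, k₁ ≤ k₂ → c.evaln k₁ n = some x → c.evaln k₂ n = some x :=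
    fun k₁ k₂ n x hk hx => Nat.Partrec.Code.evaln_mono hk hx
  refine ⟨ev, ?_, ?_, ?_, ?_⟩
  · have hE : ∀ g : ℕ × List Bool → ℕ, Primrec g →
        Primrec fun a : ℕ × List Bool => c.evaln (g a) (encode a.2) := by
      intro g hg
      exact Nat.Partrec.Code.primrec_evaln.comp
        ((hg.pair (Primrec.const c)).pair (Primrec.encode.comp Primrec.snd))
    have h2 : Primrec fun a : ℕ × List Bool => a.1.unpair.2 :=
      Primrec.snd.comp (Primrec.unpair.comp Primrec.fst)
    refine Primrec.option_bind (Primrec.decode₂.comp (Primrec.fst.comp Primrec.unpair)) ?_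
    refine Primrec.ite (Primrec.eq.comp (hE _ h2) (Primrec.const none)) ?_ (Primrec.const none)
    refine Primrec.option_map (hE _ (Primrec.succ.comp h2)) ?_
    exact (Primrec.snd.comp Primrec.fst).pair Primrec.snd
  · intro p x
    rw [hc', Nat.Partrec.Code.evaln_complete]
    constructor
    · intro hk
      classical
      have hs := Nat.find_spec hk
      have hm := fun m => Nat.find_min hk (m := m)
      generalize Nat.find hk = k at hs hm
      cases k with
      | zero => simp [Nat.Partrec.Code.evaln] at hs
      | succ k =>
        refine ⟨Nat.pair (encode p) k, (hev _ _ _).2 ⟨by simp, ?_, by simpa using hs⟩⟩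
        simp only [Nat.unpair_pair]
        rw [Option.eq_none_iff_forall_ne_some]
        intro y hy
        have := hmono k (k + 1) _ _ (Nat.le_succ k) hy
        have hs' : c.evaln (k + 1) (encode p) = some x := hs
        rw [this] at hs'
        rw [hs'] at hy
        exact hm k (Nat.lt_succ_self k) hy
    · rintro ⟨i, hi⟩
      exact ⟨_, ((hev _ _ _).1 hi).2.2⟩
  · intro i j p x x' hi hj
    obtain ⟨a1, a2, a3⟩ := (hev _ _ _).1 hi
    obtain ⟨b1, b2, b3⟩ := (hev _ _ _).1 hj
    have e1 : i.unpair.1 = j.unpair.1 := by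
      rw [← decode₂_eq_some.1 a1, ← decode₂_eq_some.1 b1]
    have e2 : i.unpair.2 = j.unpair.2 := by
      rcases lt_trichotomy i.unpair.2 j.unpair.2 with h | h | h
      · have := hmono _ _ _ _ (Nat.succ_le_of_lt h) a3
        rw [b2] at this
        cases this
      · exact h
      · have := hmono _ _ _ _ (Nat.succ_le_of_lt h) b3
        rw [a2] at this
        cases this
    rw [← Nat.pair_unpair i, ← Nat.pair_unpair j, e1, e2]
  · intro i p x hi
    obtain ⟨a1, -, -⟩ := (hev _ _ _).1 hi
    have := decode₂_eq_some.1 a1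
    exact (length_le_encode p).trans (this.le.trans (Nat.unpair_left_le i))

variable (ev : ℕ → Option (List Bool × ℕ))

/-- length and output of the `i`-th event -/
def key (i : ℕ) : Option (ℕ × ℕ) := (ev i).map fun a => (a.1.length, a.2)

/-- rank of the `i`-th event among events with the same key -/
def rk (i : ℕ) : ℕ := Nat.count (fun j => key ev j = key ev i) i

/-- `m+1` if `m+1` is a power of two and `0` otherwise -/
def hh (m : ℕ) : ℕ := if 2 ^ (m + 1) % (m + 1) = 0 then m + 1 else 0

/-- half-width of the `i`-th interval at scale `2^(i+3)` -/
def dd (i : ℕ) : ℕ := ((ev i).map fun a => hh (rk ev i) * 2 ^ (i - a.1.length)).getD 0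

/-- left end of the `i`-th interval at scale `2^(i+3)` -/
def AA (i : ℕ) : ℕ := Nat.rec 0 (fun j A => 2 * A + 4 * dd ev j) i

/-- binary value of a string -/
def val (q : List Bool) : ℕ := q.foldl (fun a b => 2 * a + b.toNat) 0

/-- `q` is the code word allotted to event `i` -/
def test (q : List Bool) (i : ℕ) : Prop :=
  2 ^ q.length * dd ev i = 2 ^ (i + 3) ∧ AA ev i < val q * dd ev i ∧
    val q * dd ev i ≤ AA ev i + dd ev i

instance (q : List Bool) (i : ℕ) : Decidable (test ev q i) := by
  unfold test
  infer_instance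

lemma AA_succ (i : ℕ) : AA ev (i + 1) = 2 * AA ev i + 4 * dd ev i := rfl

lemma hh_pow (j m : ℕ) (h : m + 1 = 2 ^ j) : hh m = m + 1 := by
  unfold hh
  rw [if_pos]
  apply Nat.mod_eq_zero_of_dvd
  rw [h]
  exact pow_dvd_pow 2 Nat.lt_two_pow_self.le

lemma hh_sum (N : ℕ) : ∑ m ∈ Finset.range N, hh m ≤ 2 * N := by
  have key : ∀ N, ∃ j, 2 ^ j ≤ N + 1 ∧ N + 1 < 2 ^ (j + 1) ∧
      ∑ m ∈ Finset.range (N + 1), hh m + 1 ≤ 2 ^ (j + 1) := by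
    intro N
    induction N with
    | zero => exact ⟨0, by simp [hh]⟩
    | succ N ih =>
      obtain ⟨j, h1, h2, h3⟩ := ih
      rw [Finset.sum_range_succ]
      by_cases hN : N + 1 + 1 = 2 ^ (j + 1)
      · refine ⟨j + 1, hN.ge, ?_, ?_⟩
        · rw [hN]; exact Nat.pow_lt_pow_right (by norm_num) (by omega)
        · rw [hh_pow (j + 1) _ hN, hN, pow_succ 2 (j + 1)]
          omega
      · have h0 : hh (N + 1) = 0 := by
          unfold hh
          rw [if_neg]
          intro hd
          obtain ⟨k, -, hk⟩ := (Nat.dvd_prime_pow Nat.prime_two).1 (Nat.dvd_of_mod_eq_zero hd)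
          have a1 : 2 ^ j < 2 ^ k := by omega
          have a2 : 2 ^ k < 2 ^ (j + 1) := by omega
          rw [Nat.pow_lt_pow_iff_right (by norm_num)] at a1 a2
          omega
        refine ⟨j, by omega, by omega, by omega⟩
  cases N with
  | zero => simp
  | succ N =>
    obtain ⟨j, h1, h2, h3⟩ := key N
    rw [pow_succ] at h3
    omega

lemma sum_count (P : ℕ → Prop) [DecidablePred P] (h : ℕ → ℝ) (i : ℕ) :
    ∑ k ∈ Finset.range i with P k, h (Nat.count P k) =
      ∑ m ∈ Finset.range (Nat.count P i), h m := by
  induction i with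
  | zero => simp
  | succ i ih =>
    rw [Finset.range_add_one, Finset.filter_insert, Nat.count_succ]
    split_ifs with hp
    · rw [Finset.sum_insert (by simp), ih, Finset.sum_range_succ, add_comm]
    · simpa using ih

lemma sum_group {κ : Type} [DecidableEq κ] (g : ℕ → κ) (u : κ → ℝ) (hu : ∀ a, 0 ≤ u a) (i : ℕ) :
    ∑ k ∈ Finset.range i, (hh (Nat.count (fun j => g j = g k) k) : ℝ) * u (g k) ≤
      2 * ∑ k ∈ Finset.range i, u (g k) := by
  have hm : ∀ k ∈ Finset.range i, g k ∈ (Finset.range i).image g :=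
    fun k hk => Finset.mem_image_of_mem g hk
  rw [← Finset.sum_fiberwise_of_maps_to hm, ← Finset.sum_fiberwise_of_maps_to hm (fun k => u (g k)),
    Finset.mul_sum]
  refine Finset.sum_le_sum fun a _ => ?_
  have e1 : ∑ k ∈ Finset.range i with g k = a,
      (hh (Nat.count (fun j => g j = g k) k) : ℝ) * u (g k) =
      (∑ k ∈ Finset.range i with g k = a, (hh (Nat.count (fun j => g j = a) k) : ℝ)) * u a := by
    rw [Finset.sum_mul]
    refine Finset.sum_congr rfl fun k hk => ?_
    have : g k = a := (Finset.mem_filter.1 hk).2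
    subst this
    rfl
  have e2 : ∑ k ∈ Finset.range i with g k = a, u (g k) =
      (Nat.count (fun j => g j = a) i : ℝ) * u a := by
    rw [Nat.count_eq_card_filter_range, ← nsmul_eq_mul, ← Finset.sum_const]
    refine Finset.sum_congr rfl fun k hk => ?_
    rw [(Finset.mem_filter.1 hk).2]
  rw [e1, e2, sum_count (fun j => g j = a) (fun m => (hh m : ℝ)), ← mul_assoc]
  refine mul_le_mul_of_nonneg_right ?_ (hu a)
  exact_mod_cast hh_sum _

/-- weight of a key -/
noncomputable def uu (o : Option (ℕ × ℕ)) : ℝ := (o.map fun a => (1 / 2 : ℝ) ^ a.1).getD 0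

lemma uu_nonneg (o : Option (ℕ × ℕ)) : 0 ≤ uu o := by
  cases o <;> simp [uu]

lemma sum_uu (hpf : ∀ i j p q x y, ev i = some (p, x) → ev j = some (q, y) → p <+: q → p = q)
    (hinj : ∀ i j p x x', ev i = some (p, x) → ev j = some (p, x') → i = j) (i : ℕ) :
    ∑ k ∈ Finset.range i, uu (key ev k) ≤ 1 := by
  let pr : ℕ → List Bool := fun k => ((ev k).map Prod.fst).getD []
  have e1 : ∑ k ∈ Finset.range i, uu (key ev k) =
      ∑ k ∈ Finset.range i with (ev k).isSome, (1 / 2 : ℝ) ^ (pr k).length := by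
    rw [Finset.sum_filter]
    refine Finset.sum_congr rfl fun k _ => ?_
    cases hk : ev k <;> simp [uu, key, pr, hk]
  have hs : ∀ k ∈ (Finset.range i).filter (fun k => (ev k).isSome), ∃ x, ev k = some (pr k, x) := by
    intro k hk
    obtain ⟨⟨p, x⟩, hx⟩ := Option.isSome_iff_exists.1 (Finset.mem_filter.1 hk).2
    exact ⟨x, by simp [pr, hx]⟩
  rw [e1, ← Finset.sum_image (f := fun p : List Bool => (1 / 2 : ℝ) ^ p.length)]
  · apply kraft
    intro p hp q hq hpq
    obtain ⟨k, hk, rfl⟩ := Finset.mem_image.1 hp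
    obtain ⟨l, hl, rfl⟩ := Finset.mem_image.1 hq
    obtain ⟨x, hx⟩ := hs k hk
    obtain ⟨y, hy⟩ := hs l hl
    exact hpf _ _ _ _ _ _ hx hy hpq
  · intro k hk l hl hkl
    obtain ⟨x, hx⟩ := hs k hk
    obtain ⟨y, hy⟩ := hs l hl
    rw [hkl] at hx
    exact hinj _ _ _ _ _ hx hy

lemma dd_eq (hlen : ∀ i p x, ev i = some (p, x) → p.length ≤ i) (k : ℕ) :
    (dd ev k : ℝ) = 2 ^ k * ((hh (rk ev k) : ℝ) * uu (key ev k)) := by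
  cases hk : ev k with
  | none => simp [dd, uu, key, hk]
  | some a =>
    obtain ⟨p, x⟩ := a
    have hl := hlen k p x hk
    have : (2 : ℝ) ^ k = 2 ^ (k - p.length) * 2 ^ p.length := by
      rw [← pow_add]; congr 1; omega
    simp only [dd, uu, key, hk, Option.map_some, Option.getD_some]
    push_cast
    rw [this, one_div, inv_pow]
    field_simp

lemma AA_eq (i : ℕ) : (AA ev i : ℝ) = 2 ^ (i + 1) * ∑ k ∈ Finset.range i, (dd ev k : ℝ) / 2 ^ k := by
  induction i with
  | zero => simp [AA]
  | succ i ih =>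
    rw [AA_succ, Finset.sum_range_succ, mul_add]
    push_cast
    rw [ih]
    field_simp
    ring

lemma AA_le (hpf : ∀ i j p q x y, ev i = some (p, x) → ev j = some (q, y) → p <+: q → p = q)
    (hinj : ∀ i j p x x', ev i = some (p, x) → ev j = some (p, x') → i = j)
    (hlen : ∀ i p x, ev i = some (p, x) → p.length ≤ i) (i : ℕ) :
    AA ev i + 2 * dd ev i ≤ 2 ^ (i + 3) := by
  have key' : ∀ i, AA ev i ≤ 2 ^ (i + 2) := by
    intro i
    have h1 : ∑ k ∈ Finset.range i, (dd ev k : ℝ) / 2 ^ k ≤ 2 := by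
      have : ∀ k ∈ Finset.range i, (dd ev k : ℝ) / 2 ^ k =
          (hh (Nat.count (fun j => key ev j = key ev k) k) : ℝ) * uu (key ev k) := by
        intro k _
        rw [dd_eq ev hlen, rk]
        field_simp
      rw [Finset.sum_congr rfl this]
      have a := sum_group (key ev) uu uu_nonneg i
      have b := sum_uu ev hpf hinj i
      linarith
    have h2 : (AA ev i : ℝ) ≤ 2 ^ (i + 2) := by
      rw [AA_eq, pow_succ 2 (i + 1)]
      exact mul_le_mul_of_nonneg_left h1 (by positivity)
    exact_mod_cast h2
  have := key' (i + 1)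
  rw [AA_succ] at this
  have e : 2 ^ (i + 1 + 2) = 2 ^ (i + 3) := by ring
  omega

lemma AA_mono (i l : ℕ) : (AA ev i + 2 * dd ev i) * 2 ^ (l + 1) ≤ AA ev (i + 1 + l) := by
  induction l with
  | zero => rw [add_zero, AA_succ]; omega
  | succ l ih =>
    rw [← add_assoc, AA_succ, pow_succ]
    nlinarith

lemma val_append (q s : List Bool) :
    val q * 2 ^ s.length ≤ val (q ++ s) ∧ val (q ++ s) + 1 ≤ (val q + 1) * 2 ^ s.length := by
  induction s using List.reverseRecOn with
  | nil => simp
  | append_singleton s b ih =>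
    have : val (q ++ (s ++ [b])) = 2 * val (q ++ s) + b.toNat := by
      simp [val, List.foldl_append]
    rw [this, List.length_append, List.length_singleton, pow_succ]
    have hb : b.toNat ≤ 1 := Bool.toNat_le b
    constructor <;> nlinarith [ih.1, ih.2]

lemma exists_val (n k : ℕ) (hk : k < 2 ^ n) : ∃ q : List Bool, q.length = n ∧ val q = k := by
  induction n generalizing k with
  | zero => exact ⟨[], rfl, by simp at hk; simp [val, hk]⟩
  | succ n ih =>
    obtain ⟨q, h1, h2⟩ := ih (k / 2) (by rw [pow_succ] at hk; omega)
    refine ⟨q ++ [decide (k % 2 = 1)], by simp [h1], ?_⟩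
    have : val (q ++ [decide (k % 2 = 1)]) = 2 * val q + (decide (k % 2 = 1)).toNat := by
      simp [val, List.foldl_append]
    rw [this, h2]
    rcases Nat.mod_two_eq_zero_or_one k with h | h <;> simp [h] <;> omega

/-- code words of different events occupy disjoint intervals -/
lemma test_disj {q q' : List Bool} {i i' : ℕ} (h : test ev q i) (h' : test ev q' i') (hi : i < i') :
    ((val q : ℝ) + 1) / 2 ^ q.length < (val q' : ℝ) / 2 ^ q'.length := by
  have conv : ∀ (q : List Bool) (i : ℕ) (_ : test ev q i) (z : ℝ),
      z / 2 ^ q.length = z * dd ev i / 2 ^ (i + 3) := by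
    intro q i h z
    have e : (2 : ℝ) ^ q.length * dd ev i = 2 ^ (i + 3) := by exact_mod_cast h.1
    rw [← e]
    have : (dd ev i : ℝ) ≠ 0 := by
      intro h0
      rw [h0, mul_zero] at e
      have : (0 : ℝ) < 2 ^ (i + 3) := by positivity
      linarith
    field_simp
  rw [conv q i h, conv q' i' h']
  obtain ⟨l, rfl⟩ := Nat.exists_eq_add_of_le (Nat.succ_le_of_lt hi)
  have m : ((AA ev i : ℝ) + 2 * dd ev i) * 2 ^ (l + 1) ≤ AA ev (i + 1 + l) := by
    exact_mod_cast AA_mono ev i l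
  have a : (val q : ℝ) * dd ev i ≤ AA ev i + dd ev i := by exact_mod_cast h.2.2
  have b : (AA ev (i + 1 + l) : ℝ) < val q' * dd ev (i + 1 + l) := by exact_mod_cast h'.2.1
  rw [div_lt_div_iff₀ (by positivity) (by positivity)]
  have e : (2 : ℝ) ^ (i.succ + l + 3) = 2 ^ (l + 1) * 2 ^ (i + 3) := by
    rw [← pow_add]; congr 1; omega
  rw [e, ← mul_assoc]
  refine mul_lt_mul_of_pos_right ?_ (by positivity)
  refine lt_of_le_of_lt ?_ b
  refine le_trans ?_ m
  refine mul_le_mul_of_nonneg_right ?_ (by positivity)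
  linarith

lemma test_pf {q q' : List Bool} {i i' : ℕ} (h : test ev q i) (h' : test ev q' i')
    (hq : q <+: q') : q = q' := by
  obtain ⟨s, rfl⟩ := hq
  have v := val_append q s
  have v1 : (val q : ℝ) * 2 ^ s.length ≤ val (q ++ s) := by exact_mod_cast v.1
  have v2 : (val (q ++ s) : ℝ) + 1 ≤ (val q + 1) * 2 ^ s.length := by exact_mod_cast v.2
  rcases lt_trichotomy i i' with hi | hi | hi
  · exfalso
    have t := test_disj ev h h' hi
    rw [div_lt_div_iff₀ (by positivity) (by positivity), List.length_append, pow_add] at t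
    have : (0 : ℝ) < 2 ^ q.length := by positivity
    nlinarith
  · subst hi
    have e := h.1.trans h'.1.symm
    have hd : 0 < dd ev i := by
      rcases Nat.eq_zero_or_pos (dd ev i) with h0 | h0
      · have := h.1
        rw [h0, mul_zero] at this
        exact absurd this.symm (by positivity)
      · exact h0
    have := Nat.eq_of_mul_eq_mul_right hd e
    have := Nat.pow_right_injective (le_refl 2) this
    have hs : s = [] := by
      rw [List.length_append] at this
      exact List.length_eq_zero_iff.1 (by omega)
    simp [hs]
  · exfalso
    have t := test_disj ev h' h hi
    rw [div_lt_div_iff₀ (by positivity) (by positivity), List.length_append, pow_add] at t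
    have : (0 : ℝ) < 2 ^ q.length := by positivity
    nlinarith

lemma test_exists
    (hpf : ∀ i j p q x y, ev i = some (p, x) → ev j = some (q, y) → p <+: q → p = q)
    (hinj : ∀ i j p x x', ev i = some (p, x) → ev j = some (p, x') → i = j)
    (hlen : ∀ i p x, ev i = some (p, x) → p.length ≤ i) {i j : ℕ} {p : List Bool} {x : ℕ}
    (hi : ev i = some (p, x)) (hj : rk ev i + 1 = 2 ^ j) :
    ∃ q, test ev q i ∧ q.length + j = p.length + 3 := by
  have hl := hlen _ _ _ hi
  have hd : dd ev i = 2 ^ (j + (i - p.length)) := by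
    simp [dd, hi, hh_pow j _ hj, hj, pow_add]
  have hA := AA_le ev hpf hinj hlen i
  have hdpos : 0 < dd ev i := by rw [hd]; positivity
  have hjl : j ≤ p.length + 3 := by
    have : 2 ^ (j + (i - p.length)) ≤ 2 ^ (i + 3) := by omega
    rw [Nat.pow_le_pow_iff_right (by norm_num)] at this
    omega
  have hL : 2 ^ (p.length + 3 - j) * dd ev i = 2 ^ (i + 3) := by
    rw [hd, ← pow_add]; congr 1; omega
  have hm := Nat.div_add_mod (AA ev i) (dd ev i)
  have hm' := Nat.mod_lt (AA ev i) hdpos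
  have hm2 := Nat.mul_div_le (AA ev i) (dd ev i)
  have hk : AA ev i / dd ev i + 1 < 2 ^ (p.length + 3 - j) := by
    have : (AA ev i / dd ev i + 1 + 1) * dd ev i ≤ 2 ^ (p.length + 3 - j) * dd ev i := by
      rw [hL]; nlinarith
    exact Nat.le_of_mul_le_mul_right this hdpos
  obtain ⟨q, h1, h2⟩ := exists_val _ _ hk
  refine ⟨q, ⟨by rw [h1, hL], ?_, ?_⟩, by omega⟩ <;> rw [h2] <;> nlinarith

section computability

variable {ev}

lemma primrec_two_pow : Primrec fun n : ℕ => 2 ^ n := by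
  refine (Primrec.nat_rec₁ (f := fun _ a => 2 * a) 1
    (Primrec.nat_mul.comp (Primrec.const 2) Primrec.snd)).of_eq fun n => ?_
  induction n with
  | zero => rfl
  | succ n ih => rw [pow_succ, ← ih]; exact mul_comm _ _

lemma primrec_key (hev : Primrec ev) : Primrec (key ev) :=
  Primrec.option_map hev
    ((Primrec.list_length.comp (Primrec.fst.comp Primrec.snd)).pair
      (Primrec.snd.comp Primrec.snd)).to₂

lemma primrec_count (hev : Primrec ev) :
    Primrec₂ fun (o : Option (ℕ × ℕ)) (n : ℕ) => Nat.count (fun j => key ev j = o) n := by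
  have h1 : Primrec₂ fun (o : Option (ℕ × ℕ)) (a : ℕ × ℕ) =>
      if key ev a.1 = o then a.2 + 1 else a.2 := by
    refine Primrec.ite (Primrec.eq.comp
      ((primrec_key hev).comp (Primrec.fst.comp Primrec.snd)) Primrec.fst) ?_ ?_
    · exact Primrec.succ.comp (Primrec.snd.comp Primrec.snd)
    · exact Primrec.snd.comp Primrec.snd
  refine (Primrec.nat_rec (Primrec.const 0) h1).of_eq fun o n => ?_
  induction n with
  | zero => rfl
  | succ n ih =>
    simp only at ih ⊢
    rw [Nat.count_succ, ← ih]
    split_ifs <;> rfl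

lemma primrec_rk (hev : Primrec ev) : Primrec (rk ev) :=
  (primrec_count hev).comp (primrec_key hev) Primrec.id

lemma primrec_hh : Primrec hh := by
  refine Primrec.ite (Primrec.eq.comp (Primrec.nat_mod.comp
    (primrec_two_pow.comp Primrec.succ) Primrec.succ) (Primrec.const 0)) ?_ (Primrec.const 0)
  exact Primrec.succ

lemma primrec_dd (hev : Primrec ev) : Primrec (dd ev) := by
  refine Primrec.option_getD.comp (Primrec.option_map hev ?_) (Primrec.const 0)
  refine Primrec.nat_mul.comp (primrec_hh.comp ((primrec_rk hev).comp Primrec.fst))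
    (primrec_two_pow.comp (Primrec.nat_sub.comp Primrec.fst ?_))
  exact Primrec.list_length.comp (Primrec.fst.comp Primrec.snd)

lemma primrec_AA (hev : Primrec ev) : Primrec (AA ev) := by
  refine Primrec.nat_rec₁ (f := fun j A => 2 * A + 4 * dd ev j) 0 ?_
  exact Primrec.nat_add.comp (Primrec.nat_mul.comp (Primrec.const 2) Primrec.snd)
    (Primrec.nat_mul.comp (Primrec.const 4) ((primrec_dd hev).comp Primrec.fst))

lemma primrec_val : Primrec val := by
  refine Primrec.list_foldl (f := fun q : List Bool => q) (g := fun _ => 0)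
    (h := fun _ a => 2 * a.1 + a.2.toNat) Primrec.id (Primrec.const 0) ?_
  refine Primrec.nat_add.comp (Primrec.nat_mul.comp (Primrec.const 2)
    (Primrec.fst.comp Primrec.snd)) ?_
  exact (Primrec.dom_finite Bool.toNat).comp (Primrec.snd.comp Primrec.snd)

lemma primrec_test (hev : Primrec ev) : PrimrecRel (test ev) := by
  have hd : Primrec fun a : List Bool × ℕ => dd ev a.2 := (primrec_dd hev).comp Primrec.snd
  have hA : Primrec fun a : List Bool × ℕ => AA ev a.2 := (primrec_AA hev).comp Primrec.snd
  have hv : Primrec fun a : List Bool × ℕ => val a.1 * dd ev a.2 :=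
    Primrec.nat_mul.comp (primrec_val.comp Primrec.fst) hd
  refine PrimrecPred.and ?_ (PrimrecPred.and ?_ ?_)
  · exact Primrec.eq.comp (Primrec.nat_mul.comp
      (primrec_two_pow.comp (Primrec.list_length.comp Primrec.fst)) hd)
      (primrec_two_pow.comp (Primrec.nat_add.comp Primrec.snd (Primrec.const 3)))
  · exact Primrec.nat_lt.comp hA hv
  · exact Primrec.nat_le.comp hv (Primrec.nat_add.comp hA hd)

end computability

lemma test_unique {q : List Bool} {i i' : ℕ} (h : test ev q i) (h' : test ev q i') : i = i' := by
  by_contra hne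
  rcases lt_or_gt_of_ne hne with hi | hi
  · have := test_disj ev h h' hi
    rw [div_lt_div_iff_of_pos_right (by positivity)] at this
    linarith
  · have := test_disj ev h' h hi
    rw [div_lt_div_iff_of_pos_right (by positivity)] at this
    linarith

/-- The machine allotting a short code word to outputs with many programs. -/
def alloc (q : List Bool) (_ : ℕ) : Part ℕ :=
  Nat.rfindOpt fun i => if test ev q i then (ev i).map Prod.snd else none

lemma alloc_partrec (hev : Primrec ev) : Partrec₂ (alloc ev) := by
  refine Partrec.rfindOpt (f := fun (a : List Bool × ℕ) i =>
    if test ev a.1 i then (ev i).map Prod.snd else none) ?_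
  refine Primrec.to_comp ?_
  refine Primrec.ite ((primrec_test hev).comp (Primrec.fst.comp Primrec.fst) Primrec.snd) ?_
    (Primrec.const none)
  exact Primrec.option_map (hev.comp Primrec.snd) (Primrec.snd.comp Primrec.snd)

lemma alloc_spec {q : List Bool} {y x : ℕ} (h : x ∈ alloc ev q y) :
    ∃ i, test ev q i ∧ ∃ p, ev i = some (p, x) := by
  obtain ⟨i, hi⟩ := Nat.rfindOpt_spec h
  refine ⟨i, ?_⟩
  split_ifs at hi with ht
  · obtain ⟨⟨p, x'⟩, h1, h2⟩ := Option.map_eq_some_iff.1 hi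
    simp only at h2
    subst h2
    exact ⟨ht, p, h1⟩
  · cases hi

lemma alloc_pf (y : ℕ) (p q : List Bool) (hpq : p <+: q) (hp : (alloc ev p y).Dom)
    (hq : (alloc ev q y).Dom) : p = q := by
  obtain ⟨x, hx⟩ := Part.dom_iff_mem.1 hp
  obtain ⟨x', hx'⟩ := Part.dom_iff_mem.1 hq
  obtain ⟨i, hi, -⟩ := alloc_spec ev hx
  obtain ⟨i', hi', -⟩ := alloc_spec ev hx'
  exact test_pf ev hi hi' hpq

lemma alloc_mem {q p : List Bool} {i x : ℕ} (y : ℕ) (ht : test ev q i) (hi : ev i = some (p, x)) :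
    x ∈ alloc ev q y := by
  have hd : (alloc ev q y).Dom := by
    refine Nat.rfindOpt_dom.2 ⟨i, x, ?_⟩
    rw [if_pos ht, hi]
    rfl
  obtain ⟨x', hx'⟩ := Part.dom_iff_mem.1 hd
  obtain ⟨i', hi', p', hp'⟩ := alloc_spec ev hx'
  obtain rfl := test_unique ev ht hi'
  rw [hi] at hp'
  simp only [Option.some.injEq, Prod.mk.injEq] at hp'
  rw [hp'.2]
  exact hx'

lemma exists_count (P : ℕ → Prop) [DecidablePred P] (m n : ℕ) (h : m < Nat.count P n) :
    ∃ i, P i ∧ Nat.count P i = m := by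
  induction n with
  | zero => simp at h
  | succ n ih =>
    by_cases hm : m < Nat.count P n
    · exact ih hm
    · rw [Nat.count_succ] at h
      split_ifs at h with hp
      · exact ⟨n, hp, by omega⟩
      · omega

lemma rk_unique {i j : ℕ} (hk : key ev i = key ev j) (hr : rk ev i = rk ev j) : i = j := by
  unfold rk at hr
  rw [hk] at hr
  by_contra hne
  rcases lt_or_gt_of_ne hne with h | h
  · have := Nat.count_strict_mono (p := fun l => key ev l = key ev j) hk h
    omega
  · have := Nat.count_strict_mono (p := fun l => key ev l = key ev j) (rfl) h
    omega

section machine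

variable (U : OptimalInterpreter)

lemma K_le {p : List Bool} {x y : ℕ} (h : x ∈ U.Φ p y) : U.K x y ≤ p.length :=
  Nat.sInf_le ⟨p, rfl, h⟩

lemma exists_prog (x y : ℕ) : ∃ p : List Bool, p.length = U.K x y ∧ x ∈ U.Φ p y := by
  obtain ⟨p, hp⟩ := U.onto x y
  exact Nat.sInf_mem (s := {n | ∃ p : List Bool, p.length = n ∧ x ∈ U.Φ p y}) ⟨_, p, rfl, hp⟩

lemma star_spec (x y : ℕ) : (U.star x y).length = U.K x y ∧ x ∈ U.Φ (U.star x y) y := by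
  obtain ⟨p, hp⟩ := exists_prog U x y
  obtain ⟨q, hq, h⟩ := Nat.sInf_mem (s := {n | ∃ p : List Bool, Encodable.encode p = n ∧
        p.length = U.K x y ∧ x ∈ U.Φ p y}) ⟨_, p, rfl, hp⟩
  have : U.star x y = q := by
    unfold OptimalInterpreter.star
    rw [← hq, encodek]
    rfl
  rw [this]
  exact h

/-- The number of shortest programs is bounded. -/
lemma rk_bound (hev : Primrec ev)
    (hpf : ∀ i j p q x y, ev i = some (p, x) → ev j = some (q, y) → p <+: q → p = q)
    (hinj : ∀ i j p x x', ev i = some (p, x) → ev j = some (p, x') → i = j)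
    (hlen : ∀ i p x, ev i = some (p, x) → p.length ≤ i) :
    ∃ B, ∀ i p x, ev i = some (p, x) → p.length = U.K x 0 → rk ev i < B := by
  obtain ⟨c, hc⟩ := U.optimal (alloc ev) (alloc_partrec ev hev) (alloc_pf ev)
  refine ⟨2 ^ (c + 4), fun i p x hi hp => ?_⟩
  by_contra hlt
  have hpos : 0 < 2 ^ (c + 4) := by positivity
  have : ∃ i', key ev i' = key ev i ∧
      Nat.count (fun j => key ev j = key ev i) i' = 2 ^ (c + 4) - 1 :=
    exists_count (fun j => key ev j = key ev i) _ i (by unfold rk at hlt; omega)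
  obtain ⟨i', hk, hr⟩ := this
  have hr' : rk ev i' + 1 = 2 ^ (c + 4) := by
    unfold rk
    rw [hk]
    omega
  have hki : key ev i = some (p.length, x) := by simp [key, hi]
  rw [hki] at hk
  obtain ⟨⟨p', x'⟩, h1, h2⟩ := Option.map_eq_some_iff.1 hk
  simp only [Prod.mk.injEq] at h2
  obtain ⟨h2, rfl⟩ := h2
  obtain ⟨q, hq1, hq2⟩ := test_exists ev hpf hinj hlen h1 hr'
  obtain ⟨r, hr1, hr2⟩ := hc _ _ _ (alloc_mem ev 0 hq1 h1)
  have := K_le U hr1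
  omega

/-- From a program for the length `k` given `y`, find the `m`-th program of length `k` for `y`. -/
def pick (m : ℕ) (p : List Bool) (y : ℕ) : Part ℕ :=
  (U.Φ p y).bind fun k => Nat.rfindOpt fun i =>
    if rk ev i = m ∧ key ev i = some (k, y) then (ev i).map fun a => encode a.1 else none

lemma pick_partrec (hev : Primrec ev) (m : ℕ) : Partrec₂ (pick ev U m) := by
  refine Partrec.bind U.partrec ?_
  refine Partrec.rfindOpt (f := fun (a : (List Bool × ℕ) × ℕ) i =>
    if rk ev i = m ∧ key ev i = some (a.2, a.1.2) then
      (ev i).map fun a => encode a.1 else none) ?_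
  refine Primrec.to_comp ?_
  refine Primrec.ite (PrimrecPred.and ?_ ?_) ?_ (Primrec.const none)
  · exact Primrec.eq.comp ((primrec_rk hev).comp Primrec.snd) (Primrec.const m)
  · exact Primrec.eq.comp ((primrec_key hev).comp Primrec.snd)
      (Primrec.option_some.comp ((Primrec.snd.comp Primrec.fst).pair
        (Primrec.snd.comp (Primrec.fst.comp Primrec.fst))))
  · exact Primrec.option_map (hev.comp Primrec.snd)
      (Primrec.encode.comp (Primrec.fst.comp Primrec.snd))

lemma pick_pf (m y : ℕ) (p q : List Bool) (hpq : p <+: q) (hp : (pick ev U m p y).Dom)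
    (hq : (pick ev U m q y).Dom) : p = q :=
  U.prefixFree y p q hpq (Part.Dom.of_bind hp) (Part.Dom.of_bind hq)

lemma pick_mem {i x : ℕ} {p q : List Bool} (hi : ev i = some (p, x)) (hq : p.length ∈ U.Φ q x) :
    encode p ∈ pick ev U (rk ev i) q x := by
  refine Part.mem_bind hq ?_
  set f : ℕ → Option ℕ := fun i' =>
    if rk ev i' = rk ev i ∧ key ev i' = some (p.length, x) then
      (ev i').map fun a => encode a.1 else none with hf
  have hki : key ev i = some (p.length, x) := by simp [key, hi]
  have hfi : f i = some (encode p) := by simp [hf, hki, hi]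
  have hd : (Nat.rfindOpt f).Dom := Nat.rfindOpt_dom.2 ⟨i, _, hfi⟩
  obtain ⟨z, hz⟩ := Part.dom_iff_mem.1 hd
  obtain ⟨i', hi'⟩ := Nat.rfindOpt_spec hz
  have hi'' : f i' = some z := hi'
  have hii : i' = i := by
    simp only [hf] at hi''
    split_ifs at hi'' with hh
    exact rk_unique ev (hh.2.trans hki.symm) hh.1
  rw [hii, hfi] at hi''
  rw [Option.some.inj hi'']
  exact hz

/-- length of the program produced -/
def len (p : List Bool) (y : ℕ) : Part ℕ :=
  (U.Φ p y).map fun a => ((decode (α := List Bool) a).getD []).length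

lemma len_partrec : Partrec₂ (len U) := by
  refine Partrec.map U.partrec (Primrec.to_comp ?_)
  exact Primrec.list_length.comp (Primrec.option_getD.comp
    (Primrec.decode.comp Primrec.snd) (Primrec.const []))

lemma len_pf (y : ℕ) (p q : List Bool) (hpq : p <+: q) (hp : (len U p y).Dom)
    (hq : (len U q y).Dom) : p = q :=
  U.prefixFree y p q hpq hp hq

end machine

end KC

/-- For any binary string `b`, `K(b* | b) =⁺ K(K(b) | b)`. -/
theorem K_shortest_eq_K_complexity (U : OptimalInterpreter) :
    ∃ C : ℕ, ∀ b : List Bool,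
      U.K (encode (U.star (encode b) 0)) (encode b) ≤
        U.K (U.Kp (encode b)) (encode b) + C ∧
      U.K (U.Kp (encode b)) (encode b) ≤
        U.K (encode (U.star (encode b) 0)) (encode b) + C := by
  obtain ⟨ev, hev, hmem, hinj, hlen⟩ := KC.exists_enum (fun p => U.Φ p 0)
    (U.partrec.comp Computable.id (Computable.const 0))
  have hpf : ∀ i j p q x y, ev i = some (p, x) → ev j = some (q, y) → p <+: q → p = q := by
    intro i j p q x y hi hj hpq
    exact U.prefixFree 0 p q hpq (Part.dom_iff_mem.2 ⟨x, (hmem p x).2 ⟨i, hi⟩⟩)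
      (Part.dom_iff_mem.2 ⟨y, (hmem q y).2 ⟨j, hj⟩⟩)
  obtain ⟨B, hB⟩ := KC.rk_bound ev U hev hpf hinj hlen
  -- first inequality, one machine for every rank below `B`
  choose c hc using fun m => U.optimal (KC.pick ev U m) (KC.pick_partrec ev U hev m)
    (KC.pick_pf ev U m)
  obtain ⟨c', hc'⟩ := U.optimal (KC.len U) (KC.len_partrec U) (KC.len_pf U)
  refine ⟨(Finset.range B).sup c + c', fun b => ⟨?_, ?_⟩⟩
  · obtain ⟨h1, h2⟩ := KC.star_spec U (encode b) 0
    obtain ⟨i, hi⟩ := (hmem _ _).1 h2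
    have hr := hB i _ _ hi h1
    obtain ⟨p, hp1, hp2⟩ := KC.exists_prog U (U.Kp (encode b)) (encode b)
    have hm := KC.pick_mem ev U hi (h1 ▸ hp2 : _ ∈ U.Φ p (encode b))
    obtain ⟨q, hq1, hq2⟩ := hc _ _ _ _ hm
    have := KC.K_le U hq1
    have hs : c (KC.rk ev i) ≤ (Finset.range B).sup c :=
      Finset.le_sup (f := c) (Finset.mem_range.2 hr)
    omega
  · obtain ⟨h1, h2⟩ := KC.star_spec U (encode b) 0
    obtain ⟨p, hp1, hp2⟩ := KC.exists_prog U (encode (U.star (encode b) 0)) (encode b)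
    have hm : U.Kp (encode b) ∈ KC.len U p (encode b) := by
      refine Part.mem_map_iff _ |>.2 ⟨_, hp2, ?_⟩
      simp [h1, OptimalInterpreter.Kp]
    obtain ⟨q, hq1, hq2⟩ := hc' _ _ _ hm
    have := KC.K_le U hq1
    omega
end

section
/- Symmetry of information (additivity): for all U, V, W, K(U, V | W) = K(U | W) + K(V | U*[W], W) up to an additive constant, where U*[W] is the shortest program computing U from W. -/
open Encodable

namespace SymInfo

/-- Enumeration of halting programs. -/
theorem exists_enum (U : OptimalInterpreter) :
    ∃ e : ℕ → ℕ → Option (List Bool × ℕ), Primrec₂ e ∧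
      (∀ w s p x, e w s = some (p, x) → x ∈ U.Φ p w) ∧
      (∀ w p x, x ∈ U.Φ p w → ∃ s, e w s = some (p, x)) ∧
      (∀ w s s' p x x', e w s = some (p, x) → e w s' = some (p, x') → s = s') := by
  obtain ⟨c, hc⟩ := Nat.Partrec.Code.exists_code.1 U.partrec
  have hev : ∀ (p : List Bool) (w : ℕ), c.eval (encode (p, w)) = U.Φ p w := by
    intro p w
    rw [hc]
    simp only [encodek, Part.coe_some, Part.bind_some]
    exact Part.map_id' (fun x => rfl) _
  let e : ℕ → ℕ → Option (List Bool × ℕ) := fun w s =>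
    (decode₂ (List Bool) s.unpair.2).bind fun p =>
      if Nat.Partrec.Code.evaln s.unpair.1 c (encode (p, w)) = none then
        (Nat.Partrec.Code.evaln (s.unpair.1 + 1) c (encode (p, w))).map (fun x => (p, x))
      else none
  have key : ∀ w s p x, e w s = some (p, x) ↔ s.unpair.2 = encode p ∧
      Nat.Partrec.Code.evaln s.unpair.1 c (encode (p, w)) = none ∧
      Nat.Partrec.Code.evaln (s.unpair.1 + 1) c (encode (p, w)) = some x := by
    intro w s p x
    simp only [e, Option.bind_eq_some_iff]
    constructor
    · rintro ⟨q, hq, h⟩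
      rw [← Option.mem_def, Encodable.mem_decode₂] at hq
      split_ifs at h with h1
      simp only [Option.map_eq_some_iff, Prod.mk.injEq] at h
      obtain ⟨z, hz, rfl, rfl⟩ := h
      exact ⟨hq.symm, h1, hz⟩
    · rintro ⟨h1, h2, h3⟩
      refine ⟨p, ?_, ?_⟩
      · rw [← Option.mem_def, Encodable.mem_decode₂, h1]
      · rw [if_pos h2, h3]; rfl
  refine ⟨e, ?_, ?_, ?_, ?_⟩
  · have hs1 : Primrec fun a : (ℕ × ℕ) × List Bool => a.1.2.unpair.1 :=
      Primrec.fst.comp (Primrec.unpair.comp (Primrec.snd.comp Primrec.fst))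
    have hpw : Primrec fun a : (ℕ × ℕ) × List Bool => encode (a.2, a.1.1) :=
      Primrec.encode.comp (Primrec.snd.pair (Primrec.fst.comp Primrec.fst))
    have hE : Primrec fun a : (ℕ × ℕ) × List Bool =>
        Nat.Partrec.Code.evaln a.1.2.unpair.1 c (encode (a.2, a.1.1)) :=
      Nat.Partrec.Code.primrec_evaln.comp ((hs1.pair (Primrec.const c)).pair hpw)
    have hE' : Primrec fun a : (ℕ × ℕ) × List Bool =>
        Nat.Partrec.Code.evaln (a.1.2.unpair.1 + 1) c (encode (a.2, a.1.1)) :=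
      Nat.Partrec.Code.primrec_evaln.comp
        (((Primrec.succ.comp hs1).pair (Primrec.const c)).pair hpw)
    refine Primrec.option_bind
      (Primrec.decode₂.comp (Primrec.snd.comp (Primrec.unpair.comp Primrec.snd))) ?_
    refine Primrec.ite (Primrec.eq.comp hE (Primrec.const none)) ?_ (Primrec.const none)
    exact Primrec.option_map hE' ((Primrec.snd.comp Primrec.fst).pair Primrec.snd)
  · intro w s p x h
    rw [key] at h
    rw [← hev]
    exact Nat.Partrec.Code.evaln_sound h.2.2
  · intro w p x h
    rw [← hev, Nat.Partrec.Code.evaln_complete] at h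
    classical
    have hf := Nat.find_spec h
    have hmin := fun m => Nat.find_min h (m := m)
    set k := Nat.find h with hk
    obtain _ | k := k
    · exact absurd (Nat.Partrec.Code.evaln_bound hf) (by omega)
    refine ⟨Nat.pair k (encode p), ?_⟩
    rw [key]
    simp only [Nat.unpair_pair]
    refine ⟨trivial, ?_, hf⟩
    cases hz : Nat.Partrec.Code.evaln k c (encode (p, w)) with
    | none => rfl
    | some z =>
      have := Nat.Partrec.Code.evaln_mono (Nat.le_succ k) hz
      have hzx : z = x := Option.mem_unique this hf
      exact absurd (hzx ▸ hz) (hmin k (Nat.lt_succ_self k))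
  · intro w s s' p x x' h h'
    rw [key] at h h'
    have aux : ∀ s s' x x' : ℕ, Nat.Partrec.Code.evaln s c (encode (p, w)) = none →
      Nat.Partrec.Code.evaln (s' + 1) c (encode (p, w)) = some x' → s ≤ s' := by
      intro s s' x x' h1 h2
      by_contra hlt
      have := Nat.Partrec.Code.evaln_mono (show s' + 1 ≤ s by omega) h2
      rw [h1] at this
      exact absurd this (by simp)
    have h1 : s.unpair.1 = s'.unpair.1 :=
      le_antisymm (aux _ _ x x' h.2.1 h'.2.2) (aux _ _ x' x h'.2.1 h.2.2)
    rw [← Nat.pair_unpair s, ← Nat.pair_unpair s', h1, h.1, h'.1]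

theorem K_le (U : OptimalInterpreter) {p : List Bool} {x y : ℕ} (h : x ∈ U.Φ p y) :
    U.K x y ≤ p.length := Nat.sInf_le ⟨p, rfl, h⟩

theorem K_spec (U : OptimalInterpreter) (x y : ℕ) :
    ∃ p : List Bool, p.length = U.K x y ∧ x ∈ U.Φ p y := by
  obtain ⟨p, hp⟩ := U.onto x y
  exact Nat.sInf_mem (s := {n | ∃ p : List Bool, p.length = n ∧ x ∈ U.Φ p y}) ⟨_, p, rfl, hp⟩

theorem star_spec (U : OptimalInterpreter) (x y : ℕ) :
    (U.star x y).length = U.K x y ∧ x ∈ U.Φ (U.star x y) y := by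
  obtain ⟨p, hp⟩ := K_spec U x y
  obtain ⟨q, hq, h⟩ := Nat.sInf_mem (s := {n | ∃ p : List Bool, Encodable.encode p = n ∧
        p.length = U.K x y ∧ x ∈ U.Φ p y}) ⟨_, p, rfl, hp⟩
  have : U.star x y = q := by
    unfold OptimalInterpreter.star
    rw [← hq, encodek]; rfl
  rw [this]; exact h

/-- A search machine gives an upper bound for complexity. -/
theorem search_bound (U : OptimalInterpreter) (g : List Bool × ℕ → ℕ → Option ℕ)
    (hg : Primrec₂ g)
    (hpf : ∀ y p q n m x x', p <+: q → g (p, y) n = some x → g (q, y) m = some x' →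
      p = q ∧ x = x') :
    ∃ c : ℕ, ∀ p y n x, g (p, y) n = some x → U.K x y ≤ p.length + c := by
  obtain ⟨c, hc⟩ := U.optimal (fun p y => Nat.rfindOpt (g (p, y)))
    (Partrec.rfindOpt hg.to_comp) (by
      intro y p q hpq h1 h2
      obtain ⟨n, x, hn⟩ := Nat.rfindOpt_dom.1 h1
      obtain ⟨m, x', hm⟩ := Nat.rfindOpt_dom.1 h2
      exact (hpf y p q n m x x' hpq hn hm).1)
  refine ⟨c, fun p y n x h => ?_⟩
  have hd : (Nat.rfindOpt (g (p, y))).Dom := Nat.rfindOpt_dom.2 ⟨n, x, h⟩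
  obtain ⟨m, hm⟩ := Nat.rfindOpt_spec (Part.get_mem hd)
  have : x = (Nat.rfindOpt (g (p, y))).get hd :=
    (hpf y p p n m _ _ (List.prefix_refl _) h hm).2
  obtain ⟨q, hq, hl⟩ := hc x y p (this ▸ Part.get_mem hd)
  exact (K_le U hq).trans hl

/-- Easy direction. -/
theorem easy (U : OptimalInterpreter) :
    ∃ C : ℕ, ∀ u v w : ℕ, U.K (Nat.pair u v) w ≤
        U.K u w + U.K v (Nat.pair (encode (U.star u w)) w) + C := by
  obtain ⟨e, he, h1, h2, -⟩ := exists_enum U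
  let g : List Bool × ℕ → ℕ → Option ℕ := fun a t =>
    (e a.2 t.unpair.1).bind fun r =>
      (e (Nat.pair (encode r.1) a.2) t.unpair.2).bind fun r' =>
        if r.1 ++ r'.1 = a.1 then some (Nat.pair r.2 r'.2) else none
  have key : ∀ p y t x, g (p, y) t = some x ↔ ∃ a u b v, e y t.unpair.1 = some (a, u) ∧
      e (Nat.pair (encode a) y) t.unpair.2 = some (b, v) ∧ a ++ b = p ∧ x = Nat.pair u v := by
    intro p y t x
    simp only [g, Option.bind_eq_some_iff]
    constructor
    · rintro ⟨⟨a, u⟩, ha, ⟨b, v⟩, hb, h⟩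
      split_ifs at h with hh
      exact ⟨a, u, b, v, ha, hb, hh, (Option.some.inj h).symm⟩
    · rintro ⟨a, u, b, v, ha, hb, hh, rfl⟩
      exact ⟨(a, u), ha, (b, v), hb, by rw [if_pos hh]⟩
  have hg : Primrec₂ g := by
    have A : Primrec fun a : (List Bool × ℕ) × ℕ => a.2.unpair.1 :=
      Primrec.fst.comp (Primrec.unpair.comp Primrec.snd)
    have B : Primrec fun a : (List Bool × ℕ) × ℕ => a.2.unpair.2 :=
      Primrec.snd.comp (Primrec.unpair.comp Primrec.snd)
    refine Primrec.option_bind (he.comp (Primrec.snd.comp Primrec.fst) A) ?_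
    refine Primrec.option_bind (he.comp (Primrec₂.natPair.comp
      (Primrec.encode.comp (Primrec.fst.comp Primrec.snd))
      (Primrec.snd.comp (Primrec.fst.comp Primrec.fst))) (B.comp Primrec.fst)) ?_
    refine Primrec.ite (Primrec.eq.comp (Primrec.list_append.comp
      (Primrec.fst.comp (Primrec.snd.comp Primrec.fst)) (Primrec.fst.comp Primrec.snd))
      (Primrec.fst.comp (Primrec.fst.comp (Primrec.fst.comp Primrec.fst))))
      (Primrec.option_some.comp (Primrec₂.natPair.comp
        (Primrec.snd.comp (Primrec.snd.comp Primrec.fst)) (Primrec.snd.comp Primrec.snd)))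
      (Primrec.const none)
  obtain ⟨c, hc⟩ := search_bound U g hg (by
    intro y p q n m x x' hpq hx hx'
    rw [key] at hx hx'
    obtain ⟨a, u, b, v, ha, hb, rfl, rfl⟩ := hx
    obtain ⟨a', u', b', v', ha', hb', rfl, rfl⟩ := hx'
    have ha := h1 _ _ _ _ ha
    have ha' := h1 _ _ _ _ ha'
    have hb := h1 _ _ _ _ hb
    have hb' := h1 _ _ _ _ hb'
    have haa : a = a' := by
      have p1 : a <+: a' ++ b' := (List.prefix_append a b).trans hpq
      have p2 : a' <+: a' ++ b' := List.prefix_append a' b'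
      rcases List.prefix_or_prefix_of_prefix p1 p2 with h | h
      · exact U.prefixFree y _ _ h (Part.dom_iff_mem.2 ⟨_, ha⟩) (Part.dom_iff_mem.2 ⟨_, ha'⟩)
      · exact (U.prefixFree y _ _ h (Part.dom_iff_mem.2 ⟨_, ha'⟩)
          (Part.dom_iff_mem.2 ⟨_, ha⟩)).symm
    subst haa
    have hbb : b = b' := U.prefixFree _ _ _ ((List.prefix_append_right_inj a).1 hpq)
      (Part.dom_iff_mem.2 ⟨_, hb⟩) (Part.dom_iff_mem.2 ⟨_, hb'⟩)
    subst hbb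
    rw [Part.mem_unique ha ha', Part.mem_unique hb hb']
    exact ⟨rfl, rfl⟩)
  refine ⟨c, fun u v w => ?_⟩
  obtain ⟨l1, s1⟩ := star_spec U u w
  obtain ⟨b, l2, s2⟩ := K_spec U v (Nat.pair (encode (U.star u w)) w)
  obtain ⟨t1, ht1⟩ := h2 _ _ _ s1
  obtain ⟨t2, ht2⟩ := h2 _ _ _ s2
  have := hc (U.star u w ++ b) w (Nat.pair t1 t2) (Nat.pair u v) (by
    rw [key]; exact ⟨_, u, b, v, by simpa using ht1, by simpa using ht2, rfl, rfl⟩)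
  rw [List.length_append, l1, l2] at this
  exact this

/-- The weight of a length request. -/
noncomputable def wt : Option ℕ → ℝ
  | none => 0
  | some n => (1 / 2 : ℝ) ^ n

theorem wt_nonneg (o : Option ℕ) : 0 ≤ wt o := by
  cases o with
  | none => exact le_rfl
  | some n => unfold wt; positivity

/-- Exact dyadic accumulator: `(N, M)` represents `N / 2 ^ M`. -/
def acc (L : ℕ → Option ℕ) (t : ℕ) : ℕ × ℕ :=
  Nat.rec (motive := fun _ => ℕ × ℕ) (0, 0) (fun s IH =>
    Option.casesOn (motive := fun _ => ℕ × ℕ) (L s) IH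
      (fun n => (IH.1 * 2 ^ n + 2 ^ IH.2, IH.2 + n))) t

/-- The rational value of the accumulator. -/
noncomputable def S (L : ℕ → Option ℕ) (t : ℕ) : ℝ := ∑ s ∈ Finset.range t, wt (L s)

theorem acc_eq (L : ℕ → Option ℕ) (t : ℕ) : ((acc L t).1 : ℝ) / 2 ^ (acc L t).2 = S L t := by
  induction t with
  | zero => simp [acc, S]
  | succ t ih =>
    have hS : S L (t + 1) = S L t + wt (L t) := Finset.sum_range_succ _ _
    rw [hS, ← ih]
    have hs : acc L (t + 1) = Option.casesOn (motive := fun _ => ℕ × ℕ) (L t) (acc L t)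
      (fun n => ((acc L t).1 * 2 ^ n + 2 ^ (acc L t).2, (acc L t).2 + n)) := rfl
    rw [hs]
    cases L t with
    | none => simp [wt]
    | some n =>
      simp only [wt]
      push_cast
      rw [pow_add, one_div, inv_pow]
      field_simp

theorem S_mono (L : ℕ → Option ℕ) {s t : ℕ} (h : s ≤ t) : S L s ≤ S L t :=
  Finset.sum_le_sum_of_subset_of_nonneg (Finset.range_mono h) fun _ _ _ => wt_nonneg _

theorem S_succ (L : ℕ → Option ℕ) (t : ℕ) : S L (t + 1) = S L t + wt (L t) :=
  Finset.sum_range_succ _ _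

theorem primrec_pow2 : Primrec fun n : ℕ => 2 ^ n :=
  (Primrec₂.unpaired'.1 Nat.Primrec.pow).comp (Primrec.const 2) Primrec.id

theorem primrec_acc {α : Type*} [Primcodable α] {L : α → ℕ → Option ℕ} (hL : Primrec₂ L) :
    Primrec₂ fun a t => acc (L a) t := by
  unfold acc
  refine Primrec.nat_rec (Primrec.const (0, 0)) (g := fun a p =>
    Option.casesOn (motive := fun _ => ℕ × ℕ) (L a p.1) p.2
      (fun n => (p.2.1 * 2 ^ n + 2 ^ p.2.2, p.2.2 + n))) ?_
  refine Primrec.option_casesOn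
    (hL.comp Primrec.fst (Primrec.fst.comp Primrec.snd)) (Primrec.snd.comp Primrec.snd) ?_
  have hN : Primrec fun a : (α × ℕ × ℕ × ℕ) × ℕ => a.1.2.2.1 :=
    Primrec.fst.comp (Primrec.snd.comp (Primrec.snd.comp Primrec.fst))
  have hM : Primrec fun a : (α × ℕ × ℕ × ℕ) × ℕ => a.1.2.2.2 :=
    Primrec.snd.comp (Primrec.snd.comp (Primrec.snd.comp Primrec.fst))
  exact (Primrec.nat_add.comp (Primrec.nat_mul.comp hN (primrec_pow2.comp Primrec.snd))
    (primrec_pow2.comp hM)).pair (Primrec.nat_add.comp hM Primrec.snd)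

/-- Binary value of a string. -/
def val (p : List Bool) : ℕ := p.foldl (fun s b => 2 * s + b.toNat) 0

theorem val_snoc (p : List Bool) (b : Bool) : val (p ++ [b]) = 2 * val p + b.toNat := by
  simp [val]

theorem primrec_val : Primrec val :=
  Primrec.list_foldl (h := fun (_ : List Bool) (a : ℕ × Bool) => 2 * a.1 + a.2.toNat)
    Primrec.id (Primrec.const 0)
    (Primrec.nat_add.comp
      (Primrec.nat_mul.comp (Primrec.const 2) (Primrec.fst.comp Primrec.snd))
      ((Primrec.dom_bool Bool.toNat).comp (Primrec.snd.comp Primrec.snd))).to₂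

theorem exists_val (n : ℕ) : ∀ k, k < 2 ^ n → ∃ p : List Bool, p.length = n ∧ val p = k := by
  induction n with
  | zero => intro k hk; exact ⟨[], rfl, by simp at hk; simp [val, hk]⟩
  | succ n ih =>
    intro k hk
    obtain ⟨p, hp, hv⟩ := ih (k / 2) (by rw [pow_succ] at hk; omega)
    refine ⟨p ++ [decide (k % 2 = 1)], by simp [hp], ?_⟩
    rw [val_snoc, hv]
    by_cases h : k % 2 = 1 <;> simp [h] <;> omega

/-- Left end point of the interval of `p`. -/
noncomputable def lo (p : List Bool) : ℝ := val p / 2 ^ p.length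
/-- Right end point of the interval of `p`. -/
noncomputable def hi (p : List Bool) : ℝ := (val p + 1) / 2 ^ p.length

theorem lo_lt_hi (p : List Bool) : lo p < hi p := by
  unfold lo hi; gcongr; linarith

theorem lo_hi_append (p r : List Bool) : lo p ≤ lo (p ++ r) ∧ hi (p ++ r) ≤ hi p := by
  induction r using List.reverseRecOn with
  | nil => simp
  | append_singleton r b ih =>
    have h : lo (p ++ r) ≤ lo (p ++ r ++ [b]) ∧ hi (p ++ r ++ [b]) ≤ hi (p ++ r) := by
      unfold lo hi
      rw [val_snoc, List.length_append (as := p ++ r), List.length_singleton, pow_succ]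
      have hb : (b.toNat : ℝ) = 0 ∨ (b.toNat : ℝ) = 1 := by cases b <;> simp
      push_cast
      constructor
      · rw [div_le_div_iff₀ (by positivity) (by positivity)]
        rcases hb with h | h <;> rw [h] <;> nlinarith [show (0:ℝ) < 2 ^ (p ++ r).length by positivity]
      · rw [div_le_div_iff₀ (by positivity) (by positivity)]
        rcases hb with h | h <;> rw [h] <;> nlinarith [show (0:ℝ) < 2 ^ (p ++ r).length by positivity]
    rw [← List.append_assoc]
    exact ⟨ih.1.trans h.1, h.2.trans ih.2⟩

/-- Kraft–Chaitin. -/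
theorem kraft_chaitin (U : OptimalInterpreter) (r : ℕ → ℕ → Option (ℕ × ℕ)) (hr : Primrec₂ r) :
    ∃ c : ℕ, ∀ y, (∀ T, S (fun t => (r y t).map Prod.fst) T ≤ 1) →
      ∀ t n x, r y t = some (n, x) → U.K x y ≤ n + c := by
  let L : ℕ → ℕ → Option ℕ := fun y t => (r y t).map Prod.fst
  have hL : Primrec₂ L := Primrec.option_map hr (Primrec.fst.comp Primrec.snd)
  let g : List Bool × ℕ → ℕ → Option ℕ := fun a t =>
    (r a.2 t).bind fun z =>
      if a.1.length = z.1 + 1 ∧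
        (acc (L a.2) t).1 * 2 ^ a.1.length ≤ val a.1 * 2 ^ (acc (L a.2) t).2 ∧
        (val a.1 + 1) * 2 ^ (acc (L a.2) (t + 1)).2 ≤ (acc (L a.2) (t + 1)).1 * 2 ^ a.1.length
      then some z.2 else none
  have key : ∀ p y t x, g (p, y) t = some x ↔ ∃ n, r y t = some (n, x) ∧ p.length = n + 1 ∧
      S (L y) t ≤ lo p ∧ hi p ≤ S (L y) (t + 1) := by
    intro p y t x
    simp only [g, Option.bind_eq_some_iff]
    rw [← acc_eq, ← acc_eq, lo, hi, div_le_div_iff₀ (by positivity) (by positivity),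
      div_le_div_iff₀ (by positivity) (by positivity)]
    norm_cast
    constructor
    · rintro ⟨⟨n, z⟩, hz, h⟩
      split_ifs at h with hh
      obtain rfl := Option.some.inj h
      exact ⟨n, hz, hh⟩
    · rintro ⟨n, hz, hh⟩
      exact ⟨(n, x), hz, by rw [if_pos hh]⟩
  have hg : Primrec₂ g := by
    have hp : Primrec fun a : ((List Bool × ℕ) × ℕ) × ℕ × ℕ => a.1.1.1 :=
      Primrec.fst.comp (Primrec.fst.comp Primrec.fst)
    have hy : Primrec fun a : ((List Bool × ℕ) × ℕ) × ℕ × ℕ => a.1.1.2 :=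
      Primrec.snd.comp (Primrec.fst.comp Primrec.fst)
    have ht : Primrec fun a : ((List Bool × ℕ) × ℕ) × ℕ × ℕ => a.1.2 :=
      Primrec.snd.comp Primrec.fst
    have hl := Primrec.list_length.comp hp
    have hv := primrec_val.comp hp
    have hA := (primrec_acc hL).comp hy ht
    have hA' := (primrec_acc hL).comp hy (Primrec.succ.comp ht)
    refine Primrec.option_bind (hr.comp (Primrec.snd.comp Primrec.fst) Primrec.snd) ?_
    refine Primrec.ite (PrimrecPred.and ?_ (PrimrecPred.and ?_ ?_))
      (Primrec.option_some.comp (Primrec.snd.comp Primrec.snd)) (Primrec.const none)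
    · exact Primrec.eq.comp hl (Primrec.succ.comp (Primrec.fst.comp Primrec.snd))
    · exact Primrec.nat_le.comp
        (Primrec.nat_mul.comp (Primrec.fst.comp hA) (primrec_pow2.comp hl))
        (Primrec.nat_mul.comp hv (primrec_pow2.comp (Primrec.snd.comp hA)))
    · exact Primrec.nat_le.comp
        (Primrec.nat_mul.comp (Primrec.succ.comp hv) (primrec_pow2.comp (Primrec.snd.comp hA')))
        (Primrec.nat_mul.comp (Primrec.fst.comp hA') (primrec_pow2.comp hl))
  obtain ⟨c, hc⟩ := search_bound U g hg (by
    intro y p q t t' x x' hpq hx hx'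
    rw [key] at hx hx'
    obtain ⟨n, h1, h2, h3, h4⟩ := hx
    obtain ⟨n', h1', h2', h3', h4'⟩ := hx'
    obtain ⟨s, rfl⟩ := hpq
    obtain ⟨i1, i2⟩ := lo_hi_append p s
    have i3 := lo_lt_hi (p ++ s)
    have htt : t = t' := by
      rcases lt_trichotomy t t' with h | h | h
      · have := S_mono (L y) (show t + 1 ≤ t' from h)
        linarith
      · exact h
      · have := S_mono (L y) (show t' + 1 ≤ t from h)
        linarith
    subst htt
    rw [h1] at h1'
    obtain ⟨rfl, rfl⟩ := Prod.mk.inj (Option.some.inj h1')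
    refine ⟨?_, rfl⟩
    rw [List.length_append] at h2'
    have : s = [] := List.eq_nil_of_length_eq_zero (by omega)
    simp [this])
  refine ⟨c + 1, fun y hy t n x h => ?_⟩
  have hS := hy (t + 1)
  change S (L y) (t + 1) ≤ 1 at hS
  have hS' := S_succ (L y) t
  have hw : wt (L y t) = (1 / 2 : ℝ) ^ n := by simp [L, h, wt]
  have h0 : 0 ≤ S (L y) t := Finset.sum_nonneg fun _ _ => wt_nonneg _
  have hpos : (0 : ℝ) < 2 ^ (n + 1) := by positivity
  have hwn : wt (L y t) * 2 ^ (n + 1) = 2 := by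
    rw [hw, pow_succ, ← mul_assoc, ← mul_pow]; norm_num
  set k := ⌈S (L y) t * 2 ^ (n + 1)⌉₊ with hk
  have k1 : S (L y) t * 2 ^ (n + 1) ≤ k := Nat.le_ceil _
  have k2 : (k : ℝ) < S (L y) t * 2 ^ (n + 1) + 1 := Nat.ceil_lt_add_one (by positivity)
  have k3 : (k : ℝ) + 1 ≤ S (L y) (t + 1) * 2 ^ (n + 1) := by
    rw [hS', add_mul, hwn]; linarith
  obtain ⟨p, hp, hv⟩ := exists_val (n + 1) k (by
    have : (k : ℝ) < 2 ^ (n + 1) := by nlinarith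
    exact_mod_cast this)
  have := hc p y t x (by
    rw [key]
    refine ⟨n, h, hp, ?_, ?_⟩
    · rw [lo, hp, hv, le_div_iff₀ hpos]; exact k1
    · rw [hi, hp, hv, div_le_iff₀ hpos]; exact k3)
  omega

theorem uniquelyDecodable_of_prefixFree (P : Set (List Bool))
    (h : ∀ p ∈ P, ∀ q ∈ P, p <+: q → p = q) (h0 : [] ∉ P) :
    InformationTheory.UniquelyDecodable P := by
  intro L₁
  induction L₁ with
  | nil =>
    intro L₂ _ h2 hf
    cases L₂ with
    | nil => rfl
    | cons b L₂ =>
      have : b = [] := by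
        have := hf.symm
        simp at this
        exact this.1
      exact absurd (this ▸ h2 b (by simp)) h0
  | cons a L₁ ih =>
    intro L₂ h1 h2 hf
    cases L₂ with
    | nil =>
      have : a = [] := by
        simp at hf
        exact hf.1
      exact absurd (this ▸ h1 a (by simp)) h0
    | cons b L₂ =>
      rw [List.flatten_cons, List.flatten_cons] at hf
      have ha := h1 a (by simp)
      have hb := h2 b (by simp)
      have hab : a = b := by
        rcases List.prefix_or_prefix_of_prefix (List.prefix_append a L₁.flatten)
          (hf ▸ List.prefix_append b L₂.flatten) with hh | hh
        · exact h a ha b hb hh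
        · exact (h b hb a ha hh).symm
      subst hab
      rw [ih L₂ (fun w hw => h1 w (by simp [hw])) (fun w hw => h2 w (by simp [hw]))
        (List.append_cancel_left hf)]

theorem kraft (P : Finset (List Bool)) (h : ∀ p ∈ P, ∀ q ∈ P, p <+: q → p = q) :
    ∑ p ∈ P, (1 / 2 : ℝ) ^ p.length ≤ 1 := by
  by_cases h0 : [] ∈ P
  · have : P = {[]} := by
      ext q
      rw [Finset.mem_singleton]
      constructor
      · intro hq; exact (h [] h0 q hq List.nil_prefix).symm
      · rintro rfl; exact h0
    rw [this]; simp
  · have := InformationTheory.kraft_mcmillan_inequality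
      (uniquelyDecodable_of_prefixFree (P : Set (List Bool)) (by simpa using h) (by simpa using h0))
    simpa using this

/-- Kraft inequality along the enumeration. -/
theorem kraft_enum (U : OptimalInterpreter) (e : ℕ → ℕ → Option (List Bool × ℕ))
    (h1 : ∀ w s p x, e w s = some (p, x) → x ∈ U.Φ p w)
    (h3 : ∀ w s s' p x x', e w s = some (p, x) → e w s' = some (p, x') → s = s')
    (w T : ℕ) : S (fun s => (e w s).map fun z => z.1.length) T ≤ 1 := by
  classical
  let A := (Finset.range T).filter fun s => (e w s).isSome
  let f : ℕ → List Bool := fun s => ((e w s).map Prod.fst).getD []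
  have hf : ∀ s ∈ A, ∃ x, e w s = some (f s, x) := by
    intro s hs
    obtain ⟨⟨p, x⟩, hz⟩ := Option.isSome_iff_exists.1 (Finset.mem_filter.1 hs).2
    exact ⟨x, by simp [f, hz]⟩
  have hinj : Set.InjOn f A := by
    intro s hs s' hs' hss
    obtain ⟨x, hx⟩ := hf s hs
    obtain ⟨x', hx'⟩ := hf s' hs'
    rw [← hss] at hx'
    exact h3 w s s' _ _ _ hx hx'
  have e1 : S (fun s => (e w s).map fun z => z.1.length) T
      = ∑ s ∈ A, (1 / 2 : ℝ) ^ (f s).length := by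
    rw [S, Finset.sum_filter]
    refine Finset.sum_congr rfl fun s _ => ?_
    cases hz : e w s with
    | none => simp [wt]
    | some z => simp [wt, f, hz]
  rw [e1, ← Finset.sum_image (f := fun p : List Bool => (1 / 2 : ℝ) ^ p.length) hinj]
  refine kraft _ ?_
  intro p hp q hq hpq
  obtain ⟨s, hs, rfl⟩ := Finset.mem_image.1 hp
  obtain ⟨s', hs', rfl⟩ := Finset.mem_image.1 hq
  obtain ⟨x, hx⟩ := hf s hs
  obtain ⟨x', hx'⟩ := hf s' hs'
  exact U.prefixFree w _ _ hpq (Part.dom_iff_mem.2 ⟨_, h1 _ _ _ _ hx⟩)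
    (Part.dom_iff_mem.2 ⟨_, h1 _ _ _ _ hx'⟩)

theorem geo (x : ℝ) (hx : 0 ≤ x) (M : ℕ) :
    ∑ k ∈ (Finset.range M).filter (fun k => (1 / 2 : ℝ) ^ k ≤ x), (1 / 2 : ℝ) ^ (k + 1) ≤ x := by
  suffices h : ∑ k ∈ (Finset.range M).filter (fun k => (1 / 2 : ℝ) ^ k ≤ x), (1 / 2 : ℝ) ^ (k + 1)
      ≤ max 0 (x - (1 / 2 : ℝ) ^ M) by
    refine h.trans (max_le hx ?_)
    have : (0 : ℝ) < (1 / 2) ^ M := by positivity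
    linarith
  induction M with
  | zero => simp
  | succ M ih =>
    rw [Finset.sum_filter] at ih ⊢
    rw [Finset.sum_range_succ]
    split_ifs with h
    · rw [max_eq_right (by linarith)] at ih
      refine le_max_of_le_right ?_
      rw [pow_succ] at *
      linarith
    · rw [max_eq_left (by linarith)] at ih
      exact le_max_of_le_left (by linarith)

/-- Lengths of the programs whose output has first component `u`. -/
def Lu (e : ℕ → ℕ → Option (List Bool × ℕ)) (a : ℕ × ℕ) (s : ℕ) : Option ℕ :=
  (e a.1 s).bind fun z => if z.2.unpair.1 = a.2 then some z.1.length else none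

theorem primrec_Lu {e : ℕ → ℕ → Option (List Bool × ℕ)} (he : Primrec₂ e) : Primrec₂ (Lu e) := by
  refine Primrec.option_bind (he.comp (Primrec.fst.comp Primrec.fst) Primrec.snd) ?_
  exact Primrec.ite (Primrec.eq.comp
    (Primrec.fst.comp (Primrec.unpair.comp (Primrec.snd.comp Primrec.snd)))
    (Primrec.snd.comp (Primrec.fst.comp Primrec.fst)))
    (Primrec.option_some.comp (Primrec.list_length.comp (Primrec.fst.comp Primrec.snd)))
    (Primrec.const none)

/-- Coding theorem. -/
theorem coding (U : OptimalInterpreter) (e : ℕ → ℕ → Option (List Bool × ℕ)) (he : Primrec₂ e)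
    (h1 : ∀ w s p x, e w s = some (p, x) → x ∈ U.Φ p w)
    (h3 : ∀ w s s' p x x', e w s = some (p, x) → e w s' = some (p, x') → s = s') :
    ∃ c : ℕ, ∀ w u T, S (Lu e (w, u)) T * 2 ^ U.K u w ≤ 2 ^ c := by
  classical
  have hL := primrec_Lu he
  let r : ℕ → ℕ → Option (ℕ × ℕ) := fun w t =>
    (e w t.unpair.1).bind fun z =>
      if (acc (Lu e (w, z.2.unpair.1)) t.unpair.1).1 * 2 ^ t.unpair.2
            < 2 ^ (acc (Lu e (w, z.2.unpair.1)) t.unpair.1).2 ∧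
        2 ^ (acc (Lu e (w, z.2.unpair.1)) (t.unpair.1 + 1)).2
            ≤ (acc (Lu e (w, z.2.unpair.1)) (t.unpair.1 + 1)).1 * 2 ^ t.unpair.2
      then some (t.unpair.2 + 1, z.2.unpair.1) else none
  have hr : Primrec₂ r := by
    have hw : Primrec fun a : (ℕ × ℕ) × List Bool × ℕ => a.1.1 := Primrec.fst.comp Primrec.fst
    have hs : Primrec fun a : (ℕ × ℕ) × List Bool × ℕ => a.1.2.unpair.1 :=
      Primrec.fst.comp (Primrec.unpair.comp (Primrec.snd.comp Primrec.fst))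
    have hk : Primrec fun a : (ℕ × ℕ) × List Bool × ℕ => a.1.2.unpair.2 :=
      Primrec.snd.comp (Primrec.unpair.comp (Primrec.snd.comp Primrec.fst))
    have hu : Primrec fun a : (ℕ × ℕ) × List Bool × ℕ => a.2.2.unpair.1 :=
      Primrec.fst.comp (Primrec.unpair.comp (Primrec.snd.comp Primrec.snd))
    have hA := (primrec_acc hL).comp (hw.pair hu) hs
    have hA' := (primrec_acc hL).comp (hw.pair hu) (Primrec.succ.comp hs)
    refine Primrec.option_bind
      (he.comp Primrec.fst (Primrec.fst.comp (Primrec.unpair.comp Primrec.snd))) ?_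
    refine Primrec.ite (PrimrecPred.and ?_ ?_)
      (Primrec.option_some.comp ((Primrec.succ.comp hk).pair hu)) (Primrec.const none)
    · exact Primrec.nat_lt.comp (Primrec.nat_mul.comp (Primrec.fst.comp hA) (primrec_pow2.comp hk))
        (primrec_pow2.comp (Primrec.snd.comp hA))
    · exact Primrec.nat_le.comp (primrec_pow2.comp (Primrec.snd.comp hA'))
        (Primrec.nat_mul.comp (Primrec.fst.comp hA') (primrec_pow2.comp hk))
  have key : ∀ w t n u, r w t = some (n, u) ↔ n = t.unpair.2 + 1 ∧
      (∃ p v, e w t.unpair.1 = some (p, v) ∧ v.unpair.1 = u) ∧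
      S (Lu e (w, u)) t.unpair.1 < (1 / 2 : ℝ) ^ t.unpair.2 ∧
      (1 / 2 : ℝ) ^ t.unpair.2 ≤ S (Lu e (w, u)) (t.unpair.1 + 1) := by
    intro w t n u
    simp only [r, Option.bind_eq_some_iff]
    rw [← acc_eq, ← acc_eq, one_div_pow, div_lt_div_iff₀ (by positivity) (by positivity),
      div_le_div_iff₀ (by positivity) (by positivity), one_mul, one_mul]
    norm_cast
    constructor
    · rintro ⟨⟨p, v⟩, hz, h⟩
      split_ifs at h with hh
      obtain ⟨rfl, rfl⟩ := Prod.mk.inj (Option.some.inj h)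
      exact ⟨rfl, ⟨p, v, hz, rfl⟩, hh⟩
    · rintro ⟨rfl, ⟨p, v, hz, rfl⟩, hh⟩
      exact ⟨(p, v), hz, by rw [if_pos hh]⟩
  obtain ⟨c, hc⟩ := kraft_chaitin U r hr
  have hsum : ∀ w T, S (fun t => (r w t).map Prod.fst) T ≤ 1 := by
    intro w T
    let A := (Finset.range T).filter fun t => (r w t).isSome
    let f : ℕ → ℕ × ℕ := fun t => (((r w t).map Prod.snd).getD 0, t.unpair.2)
    have hf : ∀ t ∈ A, r w t = some (t.unpair.2 + 1, (f t).1) := by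
      intro t ht
      obtain ⟨⟨n, u⟩, hz⟩ := Option.isSome_iff_exists.1 (Finset.mem_filter.1 ht).2
      have := ((key _ _ _ _).1 hz).1
      simp [f, hz, this]
    have hinj : Set.InjOn f A := by
      intro t ht t' ht' htt
      have q := ((key _ _ _ _).1 (hf t ht)).2.2
      have q' := ((key _ _ _ _).1 (hf t' ht')).2.2
      have e2 : t.unpair.2 = t'.unpair.2 := (Prod.ext_iff.1 htt).2
      rw [← htt, ← e2] at q'
      have e1 : t.unpair.1 = t'.unpair.1 := by
        rcases lt_trichotomy t.unpair.1 t'.unpair.1 with h | h | h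
        · have := S_mono (Lu e (w, (f t).1)) (show t.unpair.1 + 1 ≤ t'.unpair.1 from h)
          linarith [q.2, q'.1]
        · exact h
        · have := S_mono (Lu e (w, (f t).1)) (show t'.unpair.1 + 1 ≤ t.unpair.1 from h)
          linarith [q'.2, q.1]
      rw [← Nat.pair_unpair t, ← Nat.pair_unpair t', e1, e2]
    let I := A.image fun t => (f t).1
    have step1 : S (fun t => (r w t).map Prod.fst) T = ∑ t ∈ A, (1 / 2 : ℝ) ^ ((f t).2 + 1) := by
      rw [S, ← Finset.sum_subset (Finset.filter_subset _ _ : A ⊆ Finset.range T)]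
      · refine Finset.sum_congr rfl fun t ht => ?_
        rw [hf t ht]; rfl
      · intro t ht hn
        have : r w t = none := by
          by_contra hne
          exact hn (Finset.mem_filter.2 ⟨ht, Option.isSome_iff_ne_none.2 hne⟩)
        rw [this]; rfl
    have step2 : ∑ t ∈ A, (1 / 2 : ℝ) ^ ((f t).2 + 1) ≤
        ∑ u ∈ I, ∑ k ∈ (Finset.range T).filter
          (fun k => (1 / 2 : ℝ) ^ k ≤ S (Lu e (w, u)) T), (1 / 2 : ℝ) ^ (k + 1) := by
      rw [Finset.sum_sigma', ← Finset.sum_image (s := A) (g := fun t => (⟨(f t).1, (f t).2⟩ : Σ _ : ℕ, ℕ))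
        (f := fun b : (Σ _ : ℕ, ℕ) => (1 / 2 : ℝ) ^ (b.2 + 1))]
      · refine Finset.sum_le_sum_of_subset_of_nonneg ?_ fun _ _ _ => by positivity
        intro b hb
        obtain ⟨t, ht, rfl⟩ := Finset.mem_image.1 hb
        have htT : t < T := Finset.mem_range.1 (Finset.mem_filter.1 ht).1
        have q := ((key _ _ _ _).1 (hf t ht)).2.2
        refine Finset.mem_sigma.2 ⟨Finset.mem_image_of_mem _ ht, Finset.mem_filter.2 ⟨?_, ?_⟩⟩
        · exact Finset.mem_range.2 ((Nat.unpair_right_le t).trans_lt htT)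
        · exact q.2.trans (S_mono _ (Nat.succ_le_of_lt ((Nat.unpair_left_le t).trans_lt htT)))
      · intro t ht t' ht' h
        refine hinj ht ht' ?_
        simp only [Sigma.mk.injEq, heq_eq_eq] at h
        exact Prod.ext h.1 h.2
    have step3 : ∑ u ∈ I, ∑ k ∈ (Finset.range T).filter
          (fun k => (1 / 2 : ℝ) ^ k ≤ S (Lu e (w, u)) T), (1 / 2 : ℝ) ^ (k + 1) ≤
        ∑ u ∈ I, S (Lu e (w, u)) T :=
      Finset.sum_le_sum fun u _ => geo _ (Finset.sum_nonneg fun _ _ => wt_nonneg _) _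
    have step4 : ∑ u ∈ I, S (Lu e (w, u)) T ≤ S (fun s => (e w s).map fun z => z.1.length) T := by
      unfold S
      rw [Finset.sum_comm]
      refine Finset.sum_le_sum fun s _ => ?_
      unfold Lu
      dsimp only
      cases e w s with
      | none => simp [wt]
      | some z =>
        have : ∀ u, wt ((some z).bind fun z : List Bool × ℕ =>
            if z.2.unpair.1 = u then some z.1.length else none) =
            if z.2.unpair.1 = u then (1 / 2 : ℝ) ^ z.1.length else 0 := by
          intro u
          simp only [Option.bind_some]
          split_ifs <;> rfl
        simp only [this, Finset.sum_ite_eq, Option.map_some]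
        split_ifs
        · exact le_rfl
        · exact wt_nonneg _
    rw [step1]
    exact step2.trans (step3.trans (step4.trans (kraft_enum U e h1 h3 w T)))
  refine ⟨c + 2, fun w u T => ?_⟩
  have hx0 : 0 ≤ S (Lu e (w, u)) T := Finset.sum_nonneg fun _ _ => wt_nonneg _
  rcases hx0.eq_or_lt with hx | hx
  · rw [← hx]; simp
  have hx1 : S (Lu e (w, u)) T ≤ 1 := by
    refine le_trans (Finset.sum_le_sum fun s _ => ?_) (kraft_enum U e h1 h3 w T)
    unfold Lu
    dsimp only
    cases e w s with
    | none => exact le_rfl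
    | some z =>
      simp only [Option.bind_some, Option.map_some]
      split_ifs
      · exact le_rfl
      · exact wt_nonneg _
  have hex : ∃ k : ℕ, (1 / 2 : ℝ) ^ k ≤ S (Lu e (w, u)) T := by
    obtain ⟨k, hk⟩ := exists_pow_lt_of_lt_one hx (show (1 / 2 : ℝ) < 1 by norm_num)
    exact ⟨k, hk.le⟩
  obtain ⟨k, hk, hk2⟩ : ∃ k : ℕ, (1 / 2 : ℝ) ^ k ≤ S (Lu e (w, u)) T ∧
      S (Lu e (w, u)) T ≤ 2 * (1 / 2 : ℝ) ^ k := by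
    refine ⟨Nat.find hex, Nat.find_spec hex, ?_⟩
    rcases hn : Nat.find hex with _ | m
    · simp; linarith
    · have := Nat.find_min hex (m := m) (by omega)
      rw [pow_succ]; linarith
  have hex2 : ∃ s : ℕ, (1 / 2 : ℝ) ^ k ≤ S (Lu e (w, u)) s := ⟨T, hk⟩
  obtain ⟨s, hs1, hs2⟩ : ∃ s, S (Lu e (w, u)) s < (1 / 2 : ℝ) ^ k ∧
      (1 / 2 : ℝ) ^ k ≤ S (Lu e (w, u)) (s + 1) := by
    have hspec := Nat.find_spec hex2
    rcases hn : Nat.find hex2 with _ | m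
    · rw [hn] at hspec
      have : (0 : ℝ) < (1 / 2) ^ k := by positivity
      simp only [S, Finset.range_zero, Finset.sum_empty] at hspec
      linarith
    · rw [hn] at hspec
      exact ⟨m, not_le.1 (Nat.find_min hex2 (by omega)), hspec⟩
  have hp : ∃ p v, e w s = some (p, v) ∧ v.unpair.1 = u := by
    have hlt : S (Lu e (w, u)) s < S (Lu e (w, u)) (s + 1) := hs1.trans_le hs2
    rw [S_succ] at hlt
    unfold Lu at hlt
    dsimp only at hlt
    cases hz : e w s with
    | none => rw [hz] at hlt; simp [wt] at hlt
    | some z =>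
      refine ⟨z.1, z.2, rfl, ?_⟩
      by_contra hne
      rw [hz] at hlt; simp [wt, hne] at hlt
  have hK := hc w (hsum w) (Nat.pair s k) (k + 1) u (by
    rw [key]; simp only [Nat.unpair_pair]; exact ⟨trivial, hp, hs1, hs2⟩)
  calc S (Lu e (w, u)) T * 2 ^ U.K u w
      ≤ (2 * (1 / 2 : ℝ) ^ k) * 2 ^ (k + 1 + c) := by
        gcongr
        norm_num
    _ = 2 ^ (c + 2) := by
        rw [one_div_pow, pow_add, pow_add, pow_add]; field_simp

theorem trunc (x a : ℕ) : (1 / 2 : ℝ) ^ (x - a) ≤ (1 / 2 : ℝ) ^ x * 2 ^ a := by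
  rw [one_div_pow, one_div_pow, div_mul_eq_mul_div, div_le_div_iff₀ (by positivity) (by positivity),
    one_mul, one_mul, ← pow_add]
  exact pow_le_pow_right₀ (by norm_num) (by omega)

/-- Hard direction. -/
theorem hard (U : OptimalInterpreter) :
    ∃ C : ℕ, ∀ u v w : ℕ, U.K u w + U.K v (Nat.pair (encode (U.star u w)) w) ≤
        U.K (Nat.pair u v) w + C := by
  classical
  obtain ⟨e, he, h1, h2, h3⟩ := exists_enum U
  obtain ⟨c, hc⟩ := coding U e he h1 h3
  let r : ℕ → ℕ → Option (ℕ × ℕ) := fun y t =>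
    (e y.unpair.2 t.unpair.1).bind fun z =>
      (e y.unpair.2 t.unpair.2).bind fun z' =>
        if encode z'.1 = y.unpair.1 ∧ z.2.unpair.1 = z'.2 then
          some (z.1.length + c - z'.1.length, z.2.unpair.2) else none
  have hr : Primrec₂ r := by
    have hy1 : Primrec fun a : ℕ × ℕ => a.1.unpair.1 :=
      Primrec.fst.comp (Primrec.unpair.comp Primrec.fst)
    have hy2 : Primrec fun a : ℕ × ℕ => a.1.unpair.2 :=
      Primrec.snd.comp (Primrec.unpair.comp Primrec.fst)
    have ht1 : Primrec fun a : ℕ × ℕ => a.2.unpair.1 :=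
      Primrec.fst.comp (Primrec.unpair.comp Primrec.snd)
    have ht2 : Primrec fun a : ℕ × ℕ => a.2.unpair.2 :=
      Primrec.snd.comp (Primrec.unpair.comp Primrec.snd)
    refine Primrec.option_bind (he.comp hy2 ht1) ?_
    refine Primrec.option_bind (he.comp (hy2.comp Primrec.fst) (ht2.comp Primrec.fst)) ?_
    have hz : Primrec fun a : ((ℕ × ℕ) × List Bool × ℕ) × List Bool × ℕ => a.1.2 :=
      Primrec.snd.comp Primrec.fst
    have hzu := Primrec.unpair.comp (Primrec.snd.comp hz)
    refine Primrec.ite (PrimrecPred.and ?_ ?_) ?_ (Primrec.const none)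
    · exact Primrec.eq.comp (Primrec.encode.comp (Primrec.fst.comp Primrec.snd))
        (hy1.comp (Primrec.fst.comp Primrec.fst))
    · exact Primrec.eq.comp (Primrec.fst.comp hzu) (Primrec.snd.comp Primrec.snd)
    · exact Primrec.option_some.comp ((Primrec.nat_sub.comp
        (Primrec.nat_add.comp (Primrec.list_length.comp (Primrec.fst.comp hz)) (Primrec.const c))
        (Primrec.list_length.comp (Primrec.fst.comp Primrec.snd))).pair (Primrec.snd.comp hzu))
  obtain ⟨c', hc'⟩ := kraft_chaitin U r hr
  refine ⟨c + c', fun u v w => ?_⟩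
  obtain ⟨l1, s1⟩ := star_spec U u w
  set a := U.star u w with ha
  obtain ⟨p, l2, s2⟩ := K_spec U (Nat.pair u v) w
  obtain ⟨n0, hn0⟩ := h2 _ _ _ s1
  obtain ⟨s0, hs0⟩ := h2 _ _ _ s2
  have hlen : a.length ≤ p.length + c := by
    have hS : (1 / 2 : ℝ) ^ p.length ≤ S (Lu e (w, u)) (s0 + 1) := by
      rw [S_succ]
      have : Lu e (w, u) s0 = some p.length := by simp [Lu, hs0]
      rw [this]
      have h0 : 0 ≤ S (Lu e (w, u)) s0 := Finset.sum_nonneg fun _ _ => wt_nonneg _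
      simpa [wt] using h0
    have := (mul_le_mul_of_nonneg_right hS (by positivity)).trans (hc w u (s0 + 1))
    rw [one_div_pow, div_mul_eq_mul_div, div_le_iff₀ (by positivity), one_mul, ← pow_add,
      ← l1] at this
    have := (pow_le_pow_iff_right₀ (by norm_num : (1 : ℝ) < 2)).1 this
    omega
  have hsum : ∀ T, S (fun t => (r (Nat.pair (encode a) w) t).map Prod.fst) T ≤ 1 := by
    intro T
    have hb : ∀ t, t.unpair.2 ≠ n0 → r (Nat.pair (encode a) w) t = none := by
      intro t ht
      by_contra hne
      obtain ⟨z, hz⟩ := Option.ne_none_iff_exists'.1 hne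
      simp only [r, Option.bind_eq_some_iff, Nat.unpair_pair] at hz
      obtain ⟨⟨q, x⟩, _, ⟨a', u'⟩, hz', h⟩ := hz
      split_ifs at h with hh
      have haa : a' = a := Encodable.encode_injective hh.1
      rw [haa] at hz'
      exact ht (h3 _ _ _ _ _ _ hz' hn0)
    have hb2 : ∀ t, t.unpair.2 = n0 → wt ((r (Nat.pair (encode a) w) t).map Prod.fst) ≤
        wt (Lu e (w, u) t.unpair.1) * (2 ^ a.length / 2 ^ c) := by
      intro t ht
      simp only [r, Nat.unpair_pair, ht, hn0, Lu, Option.bind_some]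
      cases e w t.unpair.1 with
      | none => simp [wt]
      | some z =>
        simp only [Option.bind_some, true_and]
        split_ifs with hh
        · simp only [Option.map_some, wt]
          refine (trunc _ _).trans (le_of_eq ?_)
          rw [pow_add, one_div_pow _ c]; ring
        · simp [wt]
    let A := (Finset.range T).filter fun t => t.unpair.2 = n0
    calc S (fun t => (r (Nat.pair (encode a) w) t).map Prod.fst) T
        = ∑ t ∈ A, wt ((r (Nat.pair (encode a) w) t).map Prod.fst) := by
          symm
          refine Finset.sum_subset (Finset.filter_subset _ _) fun t ht hn => ?_
          rw [hb t (fun h => hn (Finset.mem_filter.2 ⟨ht, h⟩))]; rfl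
      _ ≤ ∑ t ∈ A, wt (Lu e (w, u) t.unpair.1) * (2 ^ a.length / 2 ^ c) :=
          Finset.sum_le_sum fun t ht => hb2 t (Finset.mem_filter.1 ht).2
      _ = ∑ s ∈ A.image (fun t => t.unpair.1), wt (Lu e (w, u) s) * (2 ^ a.length / 2 ^ c) := by
          rw [Finset.sum_image]
          intro t ht t' ht' h
          rw [← Nat.pair_unpair t, ← Nat.pair_unpair t', (Finset.mem_filter.1 ht).2,
            (Finset.mem_filter.1 ht').2]
          exact congrArg (fun x => Nat.pair x n0) h
      _ ≤ ∑ s ∈ Finset.range T, wt (Lu e (w, u) s) * (2 ^ a.length / 2 ^ c) := by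
          refine Finset.sum_le_sum_of_subset_of_nonneg ?_
            fun _ _ _ => mul_nonneg (wt_nonneg _) (by positivity)
          intro s hs
          obtain ⟨t, ht, rfl⟩ := Finset.mem_image.1 hs
          exact Finset.mem_range.2 ((Nat.unpair_left_le t).trans_lt
            (Finset.mem_range.1 (Finset.mem_filter.1 ht).1))
      _ = S (Lu e (w, u)) T * 2 ^ a.length / 2 ^ c := by
          rw [← Finset.sum_mul, S]; ring
      _ ≤ 1 := by
          rw [div_le_one (by positivity), l1]; exact hc w u T
  have := hc' _ hsum (Nat.pair s0 n0) (p.length + c - a.length) v (by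
    simp [r, hs0, hn0])
  omega

end SymInfo

/-- Symmetry of information: `K(U,V|W) =⁺ K(U|W) + K(V | U*[W], W)`. -/
theorem symmetry_of_information (U : OptimalInterpreter) :
    ∃ C : ℕ, ∀ u v w : ℕ,
      U.K (Nat.pair u v) w ≤
        U.K u w + U.K v (Nat.pair (encode (U.star u w)) w) + C ∧
      U.K u w + U.K v (Nat.pair (encode (U.star u w)) w) ≤
        U.K (Nat.pair u v) w + C := by

  obtain ⟨c, hc⟩ := SymInfo.easy U
  obtain ⟨c', hc'⟩ := SymInfo.hard U
  refine ⟨c + c', fun u v w => ⟨?_, ?_⟩⟩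
  · have := hc u v w
    omega
  · have := hc' u v w
    omega
end
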